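/- Let k ∈ ℕ ∪ {0}, let Ω ⊂ ℝ^d be a bounded domain with C^{k+2} boundary, and let p ∈ (1, ∞). Suppose u ∈ W^{2,p}(Ω) and f ∈ W^{k,p}(Ω) satisfy Δu = f in Ω and u = 0 on ∂Ω. Then for every subdomain Ω' compactly contained in Ω ∪ ∂Ω (i.e., Ω' may touch the boundary), u ∈ W^{k+2,p}(Ω') and ‖D^{k+2} u‖_{L^p(Ω')} ≤ C ( ‖u‖_{L^p(Ω)} + ‖f‖_{W^{k,p}(Ω)} ) for some constant C. -/

import Mathlib

open MeasureTheory Filter Topology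
open scoped ENNReal NNReal

noncomputable section

/-- Euclidean space `ℝ^d`. -/
abbrev Euc (d : ℕ) := EuclideanSpace ℝ (Fin d)

variable {d : ℕ}

/-- `φ` is a test function on `Ω`, i.e. `φ ∈ C_c^∞(Ω)`. -/
def IsTestFun (Ω : Set (Euc d)) (φ : Euc d → ℝ) : Prop :=
  ContDiff ℝ (⊤ : ℕ∞) φ ∧ HasCompactSupport φ ∧ tsupport φ ⊆ Ω

/-- Classical partial derivative in the `i`-th coordinate direction. -/
def pd (i : Fin d) (f : Euc d → ℝ) (x : Euc d) : ℝ :=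
  fderiv ℝ f x (EuclideanSpace.single i 1)

/-- Classical Laplacian. -/
def lap (f : Euc d → ℝ) (x : Euc d) : ℝ := ∑ i, pd i (pd i f) x

/-- Iterated classical partial derivatives along a multi-index. -/
def iterPD : {m : ℕ} → (Fin m → Fin d) → (Euc d → ℝ) → Euc d → ℝ
  | 0, _, f => f
  | _ + 1, a, f => iterPD (fun i => a i.succ) (pd (a 0) f)

/-- `v` is the family of `m`-th order weak partial derivatives of `u` on `Ω`. -/
def HasWeakDerivs (Ω : Set (Euc d)) (m : ℕ) (u : Euc d → ℝ)
    (v : (Fin m → Fin d) → Euc d → ℝ) : Prop :=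
  ∀ a : Fin m → Fin d, ∀ φ : Euc d → ℝ, IsTestFun Ω φ →
    ∫ x in Ω, u x * iterPD a φ x = (-1 : ℝ) ^ m * ∫ x in Ω, v a x * φ x

/-- Membership in the Sobolev space `W^{k,p}(Ω)`. -/
def MemW (Ω : Set (Euc d)) (p : ℝ≥0∞) (k : ℕ) (u : Euc d → ℝ) : Prop :=
  ∀ m : ℕ, m ≤ k → ∃ v, HasWeakDerivs Ω m u v ∧
    ∀ a, MemLp (v a) p (volume.restrict Ω)

/-- Pointwise magnitude of a family of `m`-th order derivatives. -/
def Dmag {m : ℕ} (v : (Fin m → Fin d) → Euc d → ℝ) (x : Euc d) : ℝ :=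
  ∑ a : Fin m → Fin d, |v a x|

/-- `L^p(Ω)` norm of a family of `m`-th order derivatives. -/
def DkNorm (Ω : Set (Euc d)) (p : ℝ≥0∞) {m : ℕ}
    (v : (Fin m → Fin d) → Euc d → ℝ) : ℝ≥0∞ :=
  eLpNorm (Dmag v) p (volume.restrict Ω)

/-- Membership in `W^{1,p}_0(Ω)`: there is a weak gradient, and `u` is approximated
together with its gradient by test functions in the `L^p` norm. -/
def MemW10 (Ω : Set (Euc d)) (p : ℝ≥0∞) (u : Euc d → ℝ) : Prop :=
  ∃ v : Fin d → Euc d → ℝ,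
    HasWeakDerivs Ω 1 u (fun a => v (a 0)) ∧
    (∀ i, MemLp (v i) p (volume.restrict Ω)) ∧
    ∃ φ : ℕ → Euc d → ℝ, (∀ n, IsTestFun Ω (φ n)) ∧
      Tendsto (fun n =>
        eLpNorm (fun x => u x - φ n x) p (volume.restrict Ω) +
        ∑ i : Fin d, eLpNorm (fun x => v i x - pd i (φ n) x) p (volume.restrict Ω))
        atTop (𝓝 0)

/-- `Δu = f` holds weakly (in the distributional sense) in `Ω`. -/
def IsWeakLap (Ω : Set (Euc d)) (u f : Euc d → ℝ) : Prop :=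
  ∀ φ : Euc d → ℝ, IsTestFun Ω φ →
    ∫ x in Ω, u x * lap φ x = ∫ x in Ω, f x * φ x

/-- `Ω` is a bounded domain. -/
def IsBoundedDomain (Ω : Set (Euc d)) : Prop :=
  IsOpen Ω ∧ IsConnected Ω ∧ Bornology.IsBounded Ω

/-- `Ω` has a `C^k` boundary, described by local level sets of `C^k` defining
functions with nonvanishing gradient. -/
def HasCkBoundary (Ω : Set (Euc d)) (k : ℕ∞) : Prop :=
  ∀ x ∈ frontier Ω, ∃ (U : Set (Euc d)) (ρ : Euc d → ℝ),
    IsOpen U ∧ x ∈ U ∧ ContDiffOn ℝ k ρ U ∧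
    (∀ y ∈ U, fderiv ℝ ρ y ≠ 0) ∧
    Ω ∩ U = {y ∈ U | ρ y < 0} ∧ frontier Ω ∩ U = {y ∈ U | ρ y = 0}

/-- `L^p(Ω)` norm of the (classical) `m`-th order derivatives of `f`. -/
def cDNorm (Ω : Set (Euc d)) (p : ℝ≥0∞) (m : ℕ) (f : Euc d → ℝ) : ℝ≥0∞ :=
  eLpNorm (fun x => ‖iteratedFDeriv ℝ m f x‖) p (volume.restrict Ω)

/-- `u` is the solution of the heat equation on `Ω` with Dirichlet boundary
condition and initial data `u₀`: it is continuous up to the parabolic boundary,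
smooth in space for positive times, satisfies `∂ₜ u = Δu` in `Ω`, vanishes on
`∂Ω`, and starts from `u₀`. -/
def IsHeatSol (Ω : Set (Euc d)) (u₀ : Euc d → ℝ) (u : ℝ → Euc d → ℝ) : Prop :=
  ContinuousOn (fun q : ℝ × Euc d => u q.1 q.2) (Set.Ici 0 ×ˢ closure Ω) ∧
  (∀ t, 0 < t → ContDiffOn ℝ (⊤ : ℕ∞) (u t) Ω) ∧
  (∀ t, 0 < t → ∀ x ∈ Ω, HasDerivAt (fun s => u s x) (lap (u t) x) t) ∧
  (∀ t, 0 < t → ∀ x ∈ frontier Ω, u t x = 0) ∧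
  (∀ x, u 0 x = u₀ x)

/-- The quantity `N[u](t,x) = |u| + t^{1/2}|∇u| + t|∇²u| + t|∂ₜ u|`. -/
def Nfun (u : ℝ → Euc d → ℝ) (t : ℝ) (x : Euc d) : ℝ :=
  |u t x| + Real.sqrt t * ‖fderiv ℝ (u t) x‖ + t * ‖iteratedFDeriv ℝ 2 (u t) x‖ +
    t * |deriv (fun s => u s x) t|

/-- The upper half space `ℝ^{d+1}_+`. -/
def halfSpace (d : ℕ) : Set (Euc (d+1)) := {x | 0 < x (Fin.last d)}

/-- The cube of side length `t^{1/2}` centered at `t^{1/2} n`, `n ∈ ℤ^d`. -/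
def cube (t : ℝ) (n : Fin d → ℤ) : Set (Euc d) :=
  {x | ∀ i, |x i - Real.sqrt t * (n i : ℝ)| ≤ Real.sqrt t / 2}

end

set_option linter.unusedVariables false
set_option linter.unusedSectionVars false
set_option linter.style.haveILetI false

noncomputable section EllReg1

/-- the elementary biconcave function -/
def ellHat (t c m : ℝ) : ℝ :=
  if max |c| |m| ≤ t then 0 else t ^ 2 - t * |c - m| - c * m

lemma ellHat_eq_min (t c m : ℝ) (ht : 0 < t) : ellHat t c m =
    if |c| ≤ t then min 0 (min ((t - c) * (t + m)) ((t - m) * (t + c)))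
    else min ((t - c) * (t + m)) ((t - m) * (t + c)) := by
  have key : min ((t - c) * (t + m)) ((t - m) * (t + c)) = t ^ 2 - t * |c - m| - c * m := by
    rcases le_total c m with h | h
    · rw [abs_of_nonpos (by linarith), min_eq_right (by nlinarith)]; ring
    · rw [abs_of_nonneg (by linarith), min_eq_left (by nlinarith)]; ring
  unfold ellHat
  by_cases hc : |c| ≤ t
  · by_cases hm : |m| ≤ t
    · rw [if_pos (by simp [hc, hm]), if_pos hc, min_eq_left]
      rw [abs_le] at hc hm
      apply le_min <;> apply mul_nonneg <;> linarith
    · rw [if_neg (by simp [hm]), if_pos hc, ← key]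
      symm
      apply min_eq_right
      rw [abs_le] at hc
      rw [not_le, lt_abs] at hm
      rcases hm with h | h
      · exact (min_le_right _ _).trans (by nlinarith)
      · exact (min_le_left _ _).trans (by nlinarith)
  · rw [if_neg (by simp [hc]), if_neg hc, key]

lemma min_conc {x1 y1 x2 y2 x y a b : ℝ} (ha : 0 ≤ a) (hb : 0 ≤ b)
    (hx : a * x1 + b * x2 ≤ x) (hy : a * y1 + b * y2 ≤ y) :
    a * min x1 y1 + b * min x2 y2 ≤ min x y := by
  apply le_min
  · refine le_trans ?_ hx
    gcongr <;> exact min_le_left _ _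
  · refine le_trans ?_ hy
    gcongr <;> exact min_le_right _ _

lemma ellHat_conc (t c m1 m2 a b : ℝ) (ht : 0 < t) (ha : 0 ≤ a) (hb : 0 ≤ b) (hab : a + b = 1) :
    a * ellHat t c m1 + b * ellHat t c m2 ≤ ellHat t c (a * m1 + b * m2) := by
  rw [ellHat_eq_min _ _ _ ht, ellHat_eq_min _ _ _ ht, ellHat_eq_min _ _ _ ht]
  have hb' : b = 1 - a := by linarith
  have h1 : a * ((t - c) * (t + m1)) + b * ((t - c) * (t + m2)) ≤ (t - c) * (t + (a * m1 + b * m2)) := by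
    subst hb'; apply le_of_eq; ring
  have h2 : a * ((t - m1) * (t + c)) + b * ((t - m2) * (t + c)) ≤ (t - (a * m1 + b * m2)) * (t + c) := by
    subst hb'; apply le_of_eq; ring
  split_ifs
  · exact min_conc ha hb (by simp) (min_conc ha hb h1 h2)
  · exact min_conc ha hb h1 h2

/-- Burkholder's function. -/
def BU (r ξ ζ : ℝ) : ℝ := (|ζ| - (r - 1) * |ξ|) * (|ξ| + |ζ|) ^ (r - 1)

lemma max_abs_id (ξ ζ : ℝ) : max |ξ - ζ| |ξ + ζ| = |ξ| + |ζ| := by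
  rcases abs_cases ξ with h | h <;> rcases abs_cases ζ with h' | h' <;>
    rcases abs_cases (ξ - ζ) with h1 | h1 <;> rcases abs_cases (ξ + ζ) with h2 | h2 <;>
    rcases max_cases |ξ - ζ| |ξ + ζ| with h3 | h3 <;> linarith

lemma ellHat_integrable (r T c m : ℝ) (hr : 2 < r) (hT : 0 ≤ T) :
    IntervalIntegrable (fun t => t ^ (r - 3) * ellHat t c m) volume 0 T := by
  have h0 : IntervalIntegrable (fun t : ℝ => t ^ (r - 3)) volume 0 T :=
    intervalIntegral.intervalIntegrable_rpow' (by linarith)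
  have : IntervalIntegrable (fun t : ℝ => t ^ (r - 3) * (t ^ 2 - t * |c - m| - c * m)) volume 0 T :=
    h0.mul_continuousOn (by fun_prop)
  rw [intervalIntegrable_iff] at this ⊢
  have h2 := Integrable.indicator (μ := volume.restrict (Set.uIoc 0 T)) (s := {t | ¬ max |c| |m| ≤ t}) this
    (measurableSet_le measurable_const measurable_id).compl
  refine h2.congr (ae_of_all _ fun t => ?_)
  simp only [Set.indicator, Set.mem_setOf_eq, ellHat]
  split_ifs <;> simp_all

lemma BU_integral (r T ξ ζ : ℝ) (hr : 2 < r) (hT : |ξ| + |ζ| ≤ T) :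
    ∫ t in (0:ℝ)..T, t ^ (r - 3) * ellHat t (ξ - ζ) (ξ + ζ)
      = 2 / (r * (r - 1) * (r - 2)) * BU r ξ ζ := by
  set M := |ξ| + |ζ| with hM
  have hM0 : 0 ≤ M := by positivity
  rw [← intervalIntegral.integral_add_adjacent_intervals (b := M)
    (ellHat_integrable r M _ _ hr hM0)
    ((ellHat_integrable r T _ _ hr (hM0.trans hT)).mono_set (by
      rw [Set.uIcc_of_le hT, Set.uIcc_of_le (hM0.trans hT)]; exact Set.Icc_subset_Icc hM0 le_rfl))]
  have h2 : ∫ t in M..T, t ^ (r - 3) * ellHat t (ξ - ζ) (ξ + ζ) = 0 := by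
    rw [intervalIntegral.integral_congr (g := fun _ => 0)]
    · simp
    · intro t ht
      rw [Set.uIcc_of_le hT] at ht
      simp only [ellHat]
      rw [if_pos (by rw [max_abs_id]; exact ht.1)]; simp
  have h1 : ∫ t in (0:ℝ)..M, t ^ (r - 3) * ellHat t (ξ - ζ) (ξ + ζ) =
      ∫ t in (0:ℝ)..M, (t ^ (r - 1) - 2 * |ζ| * t ^ (r - 2) - (ξ ^ 2 - ζ ^ 2) * t ^ (r - 3)) := by
    apply intervalIntegral.integral_congr_ae
    have : ∀ᵐ t : ℝ, t ≠ M := by simp [ae_iff]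
    filter_upwards [this] with t htM ht
    rw [Set.uIoc_of_le hM0] at ht
    have htlt : t < M := lt_of_le_of_ne ht.2 htM
    simp only [ellHat]
    rw [if_neg (by rw [max_abs_id]; exact not_le.2 htlt)]
    have e1 : t ^ (r - 1) = t ^ (r - 3) * t ^ 2 := by
      rw [← Real.rpow_natCast, ← Real.rpow_add ht.1]; congr 1; push_cast; ring
    have e2 : t ^ (r - 2) = t ^ (r - 3) * t := by
      nth_rw 3 [← Real.rpow_one t]
      rw [← Real.rpow_add ht.1]; congr 1; ring
    have e3 : |ξ - ζ - (ξ + ζ)| = 2 * |ζ| := by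
      rw [show ξ - ζ - (ξ + ζ) = -(2 * ζ) by ring, abs_neg, abs_mul]; simp
    rw [e1, e2, e3]; ring
  rw [h1, h2, add_zero]
  have i1 : IntervalIntegrable (fun t : ℝ => t ^ (r - 1)) volume 0 M :=
    intervalIntegral.intervalIntegrable_rpow' (by linarith)
  have i2 : IntervalIntegrable (fun t : ℝ => t ^ (r - 2)) volume 0 M :=
    intervalIntegral.intervalIntegrable_rpow' (by linarith)
  have i3 : IntervalIntegrable (fun t : ℝ => t ^ (r - 3)) volume 0 M :=
    intervalIntegral.intervalIntegrable_rpow' (by linarith)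
  rw [intervalIntegral.integral_sub (i1.sub (i2.const_mul _)) (i3.const_mul _),
    intervalIntegral.integral_sub i1 (i2.const_mul _), intervalIntegral.integral_const_mul,
    intervalIntegral.integral_const_mul, integral_rpow (by left; linarith),
    integral_rpow (by left; linarith), integral_rpow (by left; linarith)]
  rw [Real.zero_rpow (by linarith), Real.zero_rpow (by linarith), Real.zero_rpow (by linarith)]
  unfold BU
  rw [← hM]
  rcases hM0.eq_or_lt with h | h
  · rw [← h, Real.zero_rpow (by linarith), Real.zero_rpow (by linarith), Real.zero_rpow (by linarith),
      Real.zero_rpow (by linarith)]; simp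
  have e1 : M ^ (r - 1 + 1) = M ^ (r - 1) * M := by rw [Real.rpow_add h, Real.rpow_one]
  have e3 : M ^ (r - 1) = M ^ (r - 3 + 1) * M := by
    nth_rw 3 [← Real.rpow_one M]
    rw [← Real.rpow_add h]; congr 1; ring
  have e2 : M ^ (r - 2 + 1) = M ^ (r - 3 + 1) * M := by
    rw [← e3]; congr 1; ring
  have e4 : ξ ^ 2 - ζ ^ 2 = (|ξ| - |ζ|) * M := by
    rw [← sq_abs ξ, ← sq_abs ζ, hM]; ring
  rw [e1, e2, e3, e4, show r - 1 + 1 = r by ring, show r - 2 + 1 = r - 1 by ring,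
    show r - 3 + 1 = r - 2 by ring]
  have : r ≠ 0 := by linarith
  have : r - 1 ≠ 0 := by linarith
  have : r - 2 ≠ 0 := by linarith
  rw [hM]
  field_simp
  ring

lemma BU_neg (r ξ ζ : ℝ) : BU r ξ (-ζ) = BU r ξ ζ := by simp [BU]

lemma BU_conc (r ξ1 ζ1 ξ2 ζ2 a b : ℝ) (hr : 2 < r) (ha : 0 ≤ a) (hb : 0 ≤ b) (hab : a + b = 1)
    (h : ξ1 - ζ1 = ξ2 - ζ2) :
    a * BU r ξ1 ζ1 + b * BU r ξ2 ζ2 ≤ BU r (a * ξ1 + b * ξ2) (a * ζ1 + b * ζ2) := by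
  set T := max (|ξ1| + |ζ1|) (max (|ξ2| + |ζ2|)
    (|a * ξ1 + b * ξ2| + |a * ζ1 + b * ζ2|)) with hT
  have hT0 : 0 ≤ T := le_trans (by positivity) (le_max_left _ _)
  have k : 0 < 2 / (r * (r - 1) * (r - 2)) := by
    apply div_pos two_pos
    apply mul_pos (mul_pos _ _) <;> linarith
  have I1 := BU_integral r T ξ1 ζ1 hr (le_max_left _ _)
  have I2 := BU_integral r T ξ2 ζ2 hr ((le_max_left _ _).trans (le_max_right _ _))
  have I3 := BU_integral r T (a * ξ1 + b * ξ2) (a * ζ1 + b * ζ2) hr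
    ((le_max_right _ _).trans (le_max_right _ _))
  rw [← mul_le_mul_iff_right₀ k, mul_add, mul_left_comm, mul_left_comm _ b, ← I1, ← I2, ← I3,
    ← intervalIntegral.integral_const_mul, ← intervalIntegral.integral_const_mul,
    ← intervalIntegral.integral_add ((ellHat_integrable r T _ _ hr hT0).const_mul _)
      ((ellHat_integrable r T _ _ hr hT0).const_mul _)]
  apply intervalIntegral.integral_mono_on_of_le_Ioo hT0
  · exact ((ellHat_integrable r T _ _ hr hT0).const_mul _).add
      ((ellHat_integrable r T _ _ hr hT0).const_mul _)
  · exact ellHat_integrable r T _ _ hr hT0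
  intro t ht
  have := ellHat_conc t (ξ1 - ζ1) (ξ1 + ζ1) (ξ2 + ζ2) a b ht.1 ha hb hab
  rw [← h]
  have e1 : a * ξ1 + b * ξ2 - (a * ζ1 + b * ζ2) = ξ1 - ζ1 := by
    have : b = 1 - a := by linarith
    subst this; linear_combination (-(1 - a)) * h
  have e2 : a * ξ1 + b * ξ2 + (a * ζ1 + b * ζ2) = a * (ξ1 + ζ1) + b * (ξ2 + ζ2) := by ring
  rw [e1, e2]
  have h3 : 0 ≤ t ^ (r - 3) := Real.rpow_nonneg ht.1.le _
  calc _ = t ^ (r - 3) * (a * ellHat t (ξ1 - ζ1) (ξ1 + ζ1) + b * ellHat t (ξ1 - ζ1) (ξ2 + ζ2)) := by ring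
    _ ≤ _ := by gcongr

lemma BU_lower (r : ℝ) (hr : 2 < r) : ∃ C : ℝ, 0 < C ∧ ∀ ξ ζ,
    (1 / 2) * |ζ| ^ r - C * |ξ| ^ r ≤ BU r ξ ζ := by
  refine ⟨(1 / 2) * (2 * (r - 1)) ^ r + (r - 1) * (2 * r - 1) ^ (r - 1), ?_, fun ξ ζ => ?_⟩
  · have : 0 < r - 1 := by linarith
    have : 0 < 2 * r - 1 := by linarith
    positivity
  have hr1 : 0 < r - 1 := by linarith
  have hr2 : 0 < 2 * r - 1 := by linarith
  set x := |ξ|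
  set z := |ζ|
  have hx : 0 ≤ x := abs_nonneg _
  have hz : 0 ≤ z := abs_nonneg _
  have ex : ∀ y : ℝ, 0 ≤ y → y ^ r = y * y ^ (r - 1) := fun y hy => by
    nth_rw 2 [← Real.rpow_one y]
    rw [← Real.rpow_add_of_nonneg hy (by norm_num) hr1.le]; congr 1; ring
  unfold BU
  have hCn : 0 ≤ ((1 / 2) * (2 * (r - 1)) ^ r + (r - 1) * (2 * r - 1) ^ (r - 1)) * x ^ r := by positivity
  rcases le_total (2 * (r - 1) * x) z with h | h
  · have h1 : (1 / 2) * z ≤ z - (r - 1) * x := by linarith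
    have h2 : z ^ (r - 1) ≤ (x + z) ^ (r - 1) := Real.rpow_le_rpow hz (by linarith) hr1.le
    have : (1 / 2) * z ^ r ≤ (z - (r - 1) * x) * (x + z) ^ (r - 1) := by
      rw [ex z hz, ← mul_assoc]
      exact mul_le_mul h1 h2 (by positivity) (le_trans (by positivity) h1)
    linarith
  · have h1 : (x + z) ^ (r - 1) ≤ (2 * r - 1) ^ (r - 1) * x ^ (r - 1) := by
      rw [← Real.mul_rpow hr2.le hx]
      exact Real.rpow_le_rpow (by positivity) (by linarith) hr1.le
    have h2 : z ^ r ≤ (2 * (r - 1)) ^ r * x ^ r := by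
      rw [← Real.mul_rpow (by linarith) hx]
      exact Real.rpow_le_rpow (by positivity) (by linarith) (by linarith)
    have h3 : -((r - 1) * x * ((2 * r - 1) ^ (r - 1) * x ^ (r - 1))) ≤
        (z - (r - 1) * x) * (x + z) ^ (r - 1) := by
      have : (r - 1) * x * (x + z) ^ (r - 1) ≤ (r - 1) * x * ((2 * r - 1) ^ (r - 1) * x ^ (r - 1)) := by
        gcongr
      have h4 : 0 ≤ z * (x + z) ^ (r - 1) := by positivity
      linarith
    have h5 := ex x hx
    have : (r - 1) * x * ((2 * r - 1) ^ (r - 1) * x ^ (r - 1)) = (r - 1) * (2 * r - 1) ^ (r - 1) * x ^ r := by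
      rw [h5]; ring
    nlinarith

lemma BU_cont (r : ℝ) (hr : 2 < r) : Continuous (fun z : ℝ × ℝ => BU r z.1 z.2) := by
  unfold BU
  refine Continuous.mul (by fun_prop) (Continuous.rpow_const (by fun_prop) ?_)
  intro x; right; linarith

/-- Properties of a Bellman function for the pair `(r, q)`. -/
def IsBellman (B : ℝ → ℝ → ℝ) (C r q : ℝ) : Prop :=
  0 < C ∧ Measurable (fun z : ℝ × ℝ => B z.1 z.2) ∧ (∀ ξ η, 0 ≤ B ξ η) ∧
  (∀ ξ η, B ξ η ≤ C * (|ξ| ^ r + |η| ^ q)) ∧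
  ∀ σ a b ξ1 ξ2 η1 η2 : ℝ, (σ = 1 ∨ σ = -1) → 0 ≤ a → 0 ≤ b → a + b = 1 →
    B (a * ξ1 + b * ξ2) (a * η1 + b * η2) + σ * (a * b * (ξ1 - ξ2) * (η1 - η2)) ≤
      a * B ξ1 η1 + b * B ξ2 η2

lemma bellman_gt (r q : ℝ) (hr : 2 < r) (hq : r.HolderConjugate q) :
    ∃ B C, IsBellman B C r q := by
  obtain ⟨C, hC, hlow⟩ := BU_lower r hr
  have up : ∀ ξ η ζ, ζ * η - BU r ξ ζ ≤ (C + 1) * (|ξ| ^ r + |η| ^ q) := by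
    intro ξ η ζ
    have h1 := Real.young_inequality ζ η hq
    have h2 := hlow ξ ζ
    have h3 : |ζ| ^ r / r ≤ (1 / 2) * |ζ| ^ r := by
      have : 0 ≤ |ζ| ^ r := by positivity
      rw [div_le_iff₀ (by linarith)]; nlinarith
    have h4 : |η| ^ q / q ≤ |η| ^ q := div_le_self (by positivity) hq.symm.lt.le
    have : 0 ≤ |ξ| ^ r := by positivity
    have : 0 ≤ |η| ^ q := by positivity
    nlinarith
  have bdd : ∀ ξ η, BddAbove (Set.range fun ζ => ζ * η - BU r ξ ζ) := fun ξ η =>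
    ⟨_, by rintro _ ⟨ζ, rfl⟩; exact up ξ η ζ⟩
  refine ⟨fun ξ η => ⨆ ζ, (ζ * η - BU r ξ ζ), C + 1, by linarith, ?_, ?_, ?_, ?_⟩
  · apply LowerSemicontinuous.measurable
    show LowerSemicontinuous (fun z : ℝ × ℝ => ⨆ ζ, (ζ * z.2 - BU r z.1 ζ))
    apply lowerSemicontinuous_ciSup (fun z : ℝ × ℝ => bdd z.1 z.2)
    intro ζ
    apply Continuous.lowerSemicontinuous
    have := BU_cont r hr
    have h2 : Continuous (fun z : ℝ × ℝ => BU r z.1 ζ) := this.comp (continuous_fst.prodMk continuous_const)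
    fun_prop
  · intro ξ η
    refine le_trans ?_ (le_ciSup (bdd ξ η) 0)
    simp only [BU, zero_mul, abs_zero, zero_sub, add_zero]
    have : 0 ≤ (r - 1) * |ξ| * |ξ| ^ (r - 1) := by
      have : 0 < r - 1 := by linarith
      positivity
    nlinarith
  · intro ξ η
    exact ciSup_le (up ξ η)
  · intro σ a b ξ1 ξ2 η1 η2 hσ ha hb hab
    rw [← le_sub_iff_add_le]
    apply ciSup_le
    intro ζ
    have k1 := le_ciSup (bdd ξ1 η1) (ζ + σ * b * (ξ1 - ξ2))
    have k2 := le_ciSup (bdd ξ2 η2) (ζ - σ * a * (ξ1 - ξ2))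
    have hb' : b = 1 - a := by linarith
    have conc : a * BU r ξ1 (ζ + σ * b * (ξ1 - ξ2)) + b * BU r ξ2 (ζ - σ * a * (ξ1 - ξ2)) ≤
        BU r (a * ξ1 + b * ξ2) ζ := by
      rcases hσ with rfl | rfl
      · have := BU_conc r ξ1 (ζ + 1 * b * (ξ1 - ξ2)) ξ2 (ζ - 1 * a * (ξ1 - ξ2)) a b hr ha hb hab
          (by subst hb'; ring)
        convert this using 2
        subst hb'; ring
      · have := BU_conc r ξ1 (-(ζ + (-1) * b * (ξ1 - ξ2))) ξ2 (-(ζ - (-1) * a * (ξ1 - ξ2))) a b hr ha hb hab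
          (by subst hb'; ring)
        rw [BU_neg, BU_neg] at this
        rw [← BU_neg r _ ζ]
        convert this using 2
        subst hb'; ring
    have e : ζ * (a * η1 + b * η2) = a * ((ζ + σ * b * (ξ1 - ξ2)) * η1)
        + b * ((ζ - σ * a * (ξ1 - ξ2)) * η2) - σ * (a * b * (ξ1 - ξ2) * (η1 - η2)) := by
      subst hb'; ring
    rw [e]
    have := mul_le_mul_of_nonneg_left k1 ha
    have := mul_le_mul_of_nonneg_left k2 hb
    linarith

lemma IsBellman.swap {B C r q} (h : IsBellman B C r q) : IsBellman (fun ξ η => B η ξ) C q r := by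
  obtain ⟨h1, h2, h3, h4, h5⟩ := h
  refine ⟨h1, h2.comp measurable_swap, fun ξ η => h3 _ _, fun ξ η => ?_, ?_⟩
  · rw [add_comm]; exact h4 _ _
  · intro σ a b ξ1 ξ2 η1 η2 hσ ha hb hab
    have := h5 σ a b η1 η2 ξ1 ξ2 hσ ha hb hab
    calc _ = _ := by ring_nf
      _ ≤ _ := this

lemma bellman_two : ∃ B C, IsBellman B C 2 2 := by
  refine ⟨fun ξ η => (ξ ^ 2 + η ^ 2) / 2, 1, one_pos, by fun_prop, fun ξ η => by positivity, ?_, ?_⟩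
  · intro ξ η
    rw [Real.rpow_two, Real.rpow_two, sq_abs, sq_abs]
    nlinarith [sq_nonneg ξ, sq_nonneg η]
  · intro σ a b ξ1 ξ2 η1 η2 hσ ha hb hab
    have hb' : b = 1 - a := by linarith
    have hab0 : 0 ≤ a * b := mul_nonneg ha hb
    have : a * ((ξ1 ^ 2 + η1 ^ 2) / 2) + b * ((ξ2 ^ 2 + η2 ^ 2) / 2) -
      ((a * ξ1 + b * ξ2) ^ 2 + (a * η1 + b * η2) ^ 2) / 2 =
      a * b * ((ξ1 - ξ2) ^ 2 + (η1 - η2) ^ 2) / 2 := by subst hb'; ring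
    rcases hσ with rfl | rfl
    · have := mul_nonneg hab0 (sq_nonneg ((ξ1 - ξ2) - (η1 - η2)))
      nlinarith
    · have := mul_nonneg hab0 (sq_nonneg ((ξ1 - ξ2) + (η1 - η2)))
      nlinarith

theorem bellman_exists (r q : ℝ) (hq : r.HolderConjugate q) : ∃ B C, IsBellman B C r q := by
  rcases lt_trichotomy r 2 with h | h | h
  · have : 2 < q := by
      have := hq.inv_add_inv_eq_one
      have h1 := hq.pos
      have h2 := hq.symm.pos
      have h3 : (1:ℝ)/2 < r⁻¹ := by rw [inv_eq_one_div]; exact one_div_lt_one_div_of_lt h1 h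
      have h4 : q⁻¹ < 2⁻¹ := by linarith
      exact (inv_lt_inv₀ h2 two_pos).1 h4
    obtain ⟨B, C, hB⟩ := bellman_gt q r this hq.symm
    exact ⟨_, C, hB.swap⟩
  · subst h
    have : q = 2 := by
      have := hq.inv_add_inv_eq_one
      have h2 := hq.symm.pos
      field_simp at this; linarith
    subst this
    exact bellman_two
  · exact bellman_gt r q h hq

end EllReg1

noncomputable section EllReg2

variable {d : ℕ}

/-- continuous with compact support -/
def CC (f : Euc d → ℝ) : Prop := Continuous f ∧ HasCompactSupport f

lemma CC.tr {f : Euc d → ℝ} (hf : CC f) (a : Euc d) : CC (fun x => f (x + a)) :=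
  ⟨hf.1.comp (by fun_prop), hf.2.comp_homeomorph (Homeomorph.addRight a)⟩

lemma CC.trs {f : Euc d → ℝ} (hf : CC f) (a : Euc d) : CC (fun x => f (x - a)) := by
  simpa [sub_eq_add_neg] using hf.tr (-a)

lemma CC.add {f g : Euc d → ℝ} (hf : CC f) (hg : CC g) : CC (fun x => f x + g x) :=
  ⟨hf.1.add hg.1, hf.2.add hg.2⟩

lemma CC.cmul {f : Euc d → ℝ} (hf : CC f) (c : ℝ) : CC (fun x => c * f x) :=
  ⟨continuous_const.mul hf.1, hf.2.mul_left⟩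

lemma CC.sub {f g : Euc d → ℝ} (hf : CC f) (hg : CC g) : CC (fun x => f x - g x) := by
  simpa [sub_eq_add_neg] using hf.add (hg.cmul (-1))

lemma CC.zero : CC (fun _ : Euc d => (0:ℝ)) := ⟨continuous_const, HasCompactSupport.zero⟩

lemma CC.sum {ι : Type*} (s : Finset ι) {f : ι → Euc d → ℝ} (hf : ∀ i, CC (f i)) :
    CC (fun x => ∑ i ∈ s, f i x) := by
  classical
  induction s using Finset.induction_on with
  | empty => simpa using CC.zero
  | insert a s ha ih => simpa [Finset.sum_insert ha] using (hf a).add ih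

lemma CC.mul {f g : Euc d → ℝ} (hf : CC f) (hg : CC g) : CC (fun x => f x * g x) :=
  ⟨hf.1.mul hg.1, hf.2.mul_right⟩

lemma CC.comp {f : Euc d → ℝ} (hf : CC f) {ψ : ℝ → ℝ} (h : Continuous ψ) (h0 : ψ 0 = 0) :
    CC (fun x => ψ (f x)) := ⟨h.comp hf.1, hf.2.comp_left h0⟩

lemma CC.integrable {f : Euc d → ℝ} (hf : CC f) : Integrable f := hf.1.integrable_of_hasCompactSupport hf.2

lemma CC.rpow {f : Euc d → ℝ} (hf : CC f) {r : ℝ} (hr : 0 < r) : CC (fun x => |f x| ^ r) :=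
  CC.comp hf (ψ := fun t => |t| ^ r) (by
    refine Continuous.rpow_const (by fun_prop) (fun x => Or.inr hr.le)) (by simp [hr.ne'])

lemma bell_convex {B : ℝ → ℝ → ℝ} {C r q : ℝ} (hB : IsBellman B C r q) :
    ConvexOn ℝ Set.univ (fun z : ℝ × ℝ => B z.1 z.2) := by
  refine ⟨convex_univ, ?_⟩
  intro x _ y _ a b ha hb hab
  have h1 := hB.2.2.2.2 1 a b x.1 y.1 x.2 y.2 (Or.inl rfl) ha hb hab
  have h2 := hB.2.2.2.2 (-1) a b x.1 y.1 x.2 y.2 (Or.inr rfl) ha hb hab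
  simp only [Prod.fst_add, Prod.snd_add, Prod.smul_fst, Prod.smul_snd, smul_eq_mul]
  linarith

lemma bell_gain {B : ℝ → ℝ → ℝ} {C r q : ℝ} (hB : IsBellman B C r q) (ξ1 ξ2 η1 η2 : ℝ) :
    B ((1/2) * (ξ1 + ξ2)) ((1/2) * (η1 + η2)) + (1/4) * |(ξ1 - ξ2) * (η1 - η2)| ≤
      (1/2) * (B ξ1 η1 + B ξ2 η2) := by
  have h1 := hB.2.2.2.2 1 (1/2) (1/2) ξ1 ξ2 η1 η2 (Or.inl rfl) (by norm_num) (by norm_num) (by norm_num)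
  have h2 := hB.2.2.2.2 (-1) (1/2) (1/2) ξ1 ξ2 η1 η2 (Or.inr rfl) (by norm_num) (by norm_num) (by norm_num)
  rw [← mul_add, ← mul_add, ← mul_add] at h1 h2
  rcases abs_cases ((ξ1 - ξ2) * (η1 - η2)) with h | h <;> rw [h.1] <;> linarith

lemma bell_integrable {B : ℝ → ℝ → ℝ} {C r q : ℝ} (hr : 0 < r) (hq : 0 < q)
    (hB : IsBellman B C r q) {f g : Euc d → ℝ} (hf : CC f) (hg : CC g) :
    Integrable (fun x => B (f x) (g x)) := by
  have := ((hf.rpow hr).add (hg.rpow hq)).cmul C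
  refine Integrable.mono' this.integrable ?_ (ae_of_all _ fun x => ?_)
  · exact (hB.2.1.comp (hf.1.measurable.prodMk hg.1.measurable)).aestronglyMeasurable
  · rw [Real.norm_of_nonneg (hB.2.2.1 _ _)]; exact hB.2.2.2.1 _ _

variable {ι : Type*} [Fintype ι]

/-- averaging operator -/
def avP (w : ι → Euc d) (f : Euc d → ℝ) (x : Euc d) : ℝ :=
  ∑ i, (Fintype.card ι : ℝ)⁻¹ * ((1/2) * (f (x + w i) + f (x - w i)))

/-- symmetric difference -/
def dlt (a : Euc d) (f : Euc d → ℝ) (x : Euc d) : ℝ := f (x + a) - f (x - a)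

lemma CC.avP {f : Euc d → ℝ} (hf : CC f) (w : ι → Euc d) : CC (avP w f) :=
  CC.sum _ fun i => (((hf.tr _).add (hf.trs _)).cmul _).cmul _

lemma CC.dlt {f : Euc d → ℝ} (hf : CC f) (a : Euc d) : CC (dlt a f) := (hf.tr a).sub (hf.trs a)

lemma integral_tr (f : Euc d → ℝ) (a : Euc d) : ∫ x, f (x + a) = ∫ x, f x :=
  integral_add_right_eq_self f a

lemma integral_trs (f : Euc d → ℝ) (a : Euc d) : ∫ x, f (x - a) = ∫ x, f x :=
  integral_sub_right_eq_self f a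

lemma avP_selfadj (w : ι → Euc d) {f g : Euc d → ℝ} (hf : CC f) (hg : CC g) :
    ∫ x, avP w f x * g x = ∫ x, f x * avP w g x := by
  unfold avP
  simp only [Finset.sum_mul, Finset.mul_sum]
  rw [integral_finsetSum, integral_finsetSum]
  · refine Finset.sum_congr rfl fun i _ => ?_
    have e1 : ∫ x, f (x + w i) * g x = ∫ x, f x * g (x - w i) := by
      rw [← integral_trs _ (w i)]; simp
    have e2 : ∫ x, f (x - w i) * g x = ∫ x, f x * g (x + w i) := by
      rw [← integral_tr _ (w i)]; simp
    have l : ∀ x, (Fintype.card ι : ℝ)⁻¹ * ((1/2) * (f (x + w i) + f (x - w i))) * g x =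
      ((Fintype.card ι : ℝ)⁻¹ * (1/2)) * (f (x + w i) * g x + f (x - w i) * g x) := fun x => by ring
    have l' : ∀ x, f x * ((Fintype.card ι : ℝ)⁻¹ * ((1/2) * (g (x + w i) + g (x - w i)))) =
      ((Fintype.card ι : ℝ)⁻¹ * (1/2)) * (f x * g (x + w i) + f x * g (x - w i)) := fun x => by ring
    simp only [l, l']
    rw [integral_const_mul, integral_const_mul,
      integral_add ((hf.tr _).mul hg).integrable ((hf.trs _).mul hg).integrable,
      integral_add (hf.mul (hg.tr _)).integrable (hf.mul (hg.trs _)).integrable, e1, e2, add_comm]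
  · intro i _; exact (hf.mul ((((hg.tr _).add (hg.trs _)).cmul _).cmul _)).integrable
  · intro i _; exact (((((hf.tr _).add (hf.trs _)).cmul _).cmul _).mul hg).integrable

lemma dlt_skew (a : Euc d) {f g : Euc d → ℝ} (hf : CC f) (hg : CC g) :
    ∫ x, dlt a f x * g x = - ∫ x, f x * dlt a g x := by
  unfold dlt
  simp only [sub_mul, mul_sub]
  rw [integral_sub ((hf.tr _).mul hg).integrable ((hf.trs _).mul hg).integrable,
    integral_sub (hf.mul (hg.tr _)).integrable (hf.mul (hg.trs _)).integrable]
  have e1 : ∫ x, f (x + a) * g x = ∫ x, f x * g (x - a) := by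
    rw [← integral_trs _ a]; simp
  have e2 : ∫ x, f (x - a) * g x = ∫ x, f x * g (x + a) := by
    rw [← integral_tr _ a]; simp
  rw [e1, e2]; ring

lemma dlt_avP (a : Euc d) (w : ι → Euc d) (f : Euc d → ℝ) :
    dlt a (avP w f) = avP w (dlt a f) := by
  funext x
  simp only [dlt, avP, ← Finset.sum_sub_distrib]
  refine Finset.sum_congr rfl fun i _ => ?_
  rw [show x + a + w i = x + w i + a by abel, show x + a - w i = x - w i + a by abel,
    show x - a + w i = x + w i - a by abel, show x - a - w i = x - w i - a by abel]
  ring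

lemma avP_sub (w : ι → Euc d) (f g : Euc d → ℝ) :
    avP w (fun x => f x - g x) = fun x => avP w f x - avP w g x := by
  funext x
  simp only [avP, ← Finset.sum_sub_distrib]
  exact Finset.sum_congr rfl fun i _ => by ring

lemma bell_step [Nonempty ι] {B : ℝ → ℝ → ℝ} {C r q : ℝ} (hr : 0 < r) (hq : 0 < q)
    (hB : IsBellman B C r q) {f g : Euc d → ℝ} (hf : CC f) (hg : CC g) (w : ι → Euc d) (j : ι) :
    (∫ x, B (avP w f x) (avP w g x)) +
      (Fintype.card ι : ℝ)⁻¹ * (1/4) * ∫ x, |dlt (w j) f x * dlt (w j) g x| ≤ ∫ x, B (f x) (g x) := by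
  set N : ℝ := (Fintype.card ι : ℝ) with hN
  have hN0 : 0 < N := by rw [hN]; exact_mod_cast Fintype.card_pos
  have pt : ∀ x, B (avP w f x) (avP w g x) + N⁻¹ * (1/4) * |dlt (w j) f x * dlt (w j) g x| ≤
      ∑ i, N⁻¹ * ((1/2) * (B (f (x + w i)) (g (x + w i)) + B (f (x - w i)) (g (x - w i)))) := by
    intro x
    have c := (bell_convex hB).map_sum_le (t := Finset.univ) (w := fun _ : ι => N⁻¹)
      (p := fun i => ((1/2) * (f (x + w i) + f (x - w i)), (1/2) * (g (x + w i) + g (x - w i))))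
      (fun _ _ => by positivity) (by simp [← hN, hN0.ne']) (fun _ _ => Set.mem_univ _)
    simp only [Prod.fst_sum, Prod.snd_sum, Prod.smul_fst, Prod.smul_snd, smul_eq_mul] at c
    have g1 : ∑ i, N⁻¹ * B ((1/2) * (f (x + w i) + f (x - w i))) ((1/2) * (g (x + w i) + g (x - w i)))
        + ∑ i, N⁻¹ * ((1/4) * |dlt (w i) f x * dlt (w i) g x|) ≤
        ∑ i, N⁻¹ * ((1/2) * (B (f (x + w i)) (g (x + w i)) + B (f (x - w i)) (g (x - w i)))) := by
      rw [← Finset.sum_add_distrib]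
      refine Finset.sum_le_sum fun i _ => ?_
      rw [← mul_add]
      exact mul_le_mul_of_nonneg_left (bell_gain hB _ _ _ _) (by positivity)
    have g2 : N⁻¹ * ((1/4) * |dlt (w j) f x * dlt (w j) g x|) ≤
        ∑ i, N⁻¹ * ((1/4) * |dlt (w i) f x * dlt (w i) g x|) :=
      Finset.single_le_sum (f := fun i => N⁻¹ * ((1/4) * |dlt (w i) f x * dlt (w i) g x|))
        (fun i _ => by positivity) (Finset.mem_univ j)
    have c' : B (avP w f x) (avP w g x) ≤
      ∑ i, N⁻¹ * B ((1/2) * (f (x + w i) + f (x - w i))) ((1/2) * (g (x + w i) + g (x - w i))) := c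
    linarith
  have iB := bell_integrable hr hq hB hf hg
  have i1 : ∀ i, Integrable (fun x => B (f (x + w i)) (g (x + w i))) := fun i =>
    bell_integrable hr hq hB (hf.tr _) (hg.tr _)
  have i2 : ∀ i, Integrable (fun x => B (f (x - w i)) (g (x - w i))) := fun i =>
    bell_integrable hr hq hB (hf.trs _) (hg.trs _)
  have i3 := bell_integrable hr hq hB (hf.avP w) (hg.avP w)
  have i4 : Integrable (fun x => N⁻¹ * (1/4) * |dlt (w j) f x * dlt (w j) g x|) :=
    (((hf.dlt (w j)).mul (hg.dlt (w j))).integrable.abs).const_mul _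
  rw [← integral_const_mul, ← integral_add i3 i4]
  refine (integral_mono (i3.add i4) ?_ pt).trans (le_of_eq ?_)
  · exact integrable_finsetSum _ fun i _ => (((i1 i).add (i2 i)).const_mul _).const_mul _
  have i5 : ∀ i ∈ Finset.univ, Integrable (fun x => N⁻¹ * ((1/2) * (B (f (x + w i)) (g (x + w i)) +
      B (f (x - w i)) (g (x - w i))))) := fun i _ => (((i1 i).add (i2 i)).const_mul _).const_mul _
  rw [integral_finsetSum _ i5]
  have : ∀ i, ∫ x, N⁻¹ * ((1/2) * (B (f (x + w i)) (g (x + w i)) + B (f (x - w i)) (g (x - w i)))) =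
      N⁻¹ * ∫ x, B (f x) (g x) := by
    intro i
    rw [integral_const_mul, integral_const_mul, integral_add (i1 i) (i2 i),
      integral_tr (fun x => B (f x) (g x)), integral_trs (fun x => B (f x) (g x))]
    ring
  simp only [this, Finset.sum_const, Finset.card_univ, nsmul_eq_mul, ← hN]
  field_simp

lemma CC.iter {f : Euc d → ℝ} (hf : CC f) (w : ι → Euc d) (n : ℕ) : CC ((_root_.avP w)^[n] f) := by
  induction n with
  | zero => exact hf
  | succ n ih => rw [Function.iterate_succ_apply']; exact ih.avP w

lemma bell_sum [Nonempty ι] {B : ℝ → ℝ → ℝ} {C r q : ℝ} (hr : 0 < r) (hq : 0 < q)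
    (hB : IsBellman B C r q) {f g : Euc d → ℝ} (hf : CC f) (hg : CC g) (w : ι → Euc d) (j : ι) (M : ℕ) :
    ∑ n ∈ Finset.range M, ∫ x, |dlt (w j) ((avP w)^[n] f) x * dlt (w j) ((avP w)^[n] g) x| ≤
      4 * Fintype.card ι * ∫ x, B (f x) (g x) := by
  set N : ℝ := (Fintype.card ι : ℝ) with hN
  have hN0 : 0 < N := by rw [hN]; exact_mod_cast Fintype.card_pos
  have : (∫ x, B ((avP w)^[M] f x) ((avP w)^[M] g x)) + N⁻¹ * (1/4) * ∑ n ∈ Finset.range M,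
      ∫ x, |dlt (w j) ((avP w)^[n] f) x * dlt (w j) ((avP w)^[n] g) x| ≤ ∫ x, B (f x) (g x) := by
    induction M with
    | zero => simp
    | succ M ih =>
      have := bell_step hr hq hB (hf.iter w M) (hg.iter w M) w j
      rw [Finset.sum_range_succ, Function.iterate_succ_apply', Function.iterate_succ_apply']
      rw [← hN] at this
      linarith
  have h0 : 0 ≤ ∫ x, B ((avP w)^[M] f x) ((avP w)^[M] g x) := integral_nonneg fun x => hB.2.2.1 _ _
  have h1 : N⁻¹ * (1/4) * ∑ n ∈ Finset.range M,
      ∫ x, |dlt (w j) ((avP w)^[n] f) x * dlt (w j) ((avP w)^[n] g) x| ≤ ∫ x, B (f x) (g x) := by linarith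
  have := mul_le_mul_of_nonneg_left h1 (show 0 ≤ 4 * N by positivity)
  rw [← mul_assoc] at this
  rwa [show 4 * N * (N⁻¹ * (1/4)) = 1 by field_simp, one_mul] at this

lemma dlt_iter (a : Euc d) (w : ι → Euc d) (n : ℕ) (f : Euc d → ℝ) :
    dlt a ((avP w)^[n] f) = (avP w)^[n] (dlt a f) := by
  induction n generalizing f with
  | zero => rfl
  | succ n ih => rw [Function.iterate_succ_apply, ih, dlt_avP, Function.iterate_succ_apply]

lemma iter_sub (w : ι → Euc d) (n : ℕ) (f g : Euc d → ℝ) :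
    (avP w)^[n] (fun x => f x - g x) = fun x => (avP w)^[n] f x - (avP w)^[n] g x := by
  induction n generalizing f g with
  | zero => rfl
  | succ n ih => rw [Function.iterate_succ_apply, avP_sub, ih]; rfl

lemma cz_dual [Nonempty ι] {B : ℝ → ℝ → ℝ} {C r q : ℝ} (hr : 0 < r) (hq : 0 < q)
    (hB : IsBellman B C r q) {φ g : Euc d → ℝ} (hφ : CC φ) (hg : CC g) (w : ι → Euc d) (j : ι) :
    |∫ x, dlt (w j) (dlt (w j) φ) x * g x| ≤
      4 * Fintype.card ι * ∫ x, B (φ x - avP w (avP w φ) x) (g x) := by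
  set a := w j
  set f : Euc d → ℝ := fun x => φ x - avP w (avP w φ) x with hfdef
  have hf : CC f := hφ.sub ((hφ.avP w).avP w)
  let h : ℕ → ℝ := fun n => ∫ x, dlt a ((avP w)^[n] φ) x * dlt a ((avP w)^[n] g) x
  have hstep : ∀ n, h n - h (n+1) = ∫ x, dlt a ((avP w)^[n] f) x * dlt a ((avP w)^[n] g) x := by
    intro n
    have e : h (n+1) = ∫ x, dlt a ((avP w)^[n] (avP w (avP w φ))) x * dlt a ((avP w)^[n] g) x := by
      show ∫ x, dlt a ((avP w)^[n+1] φ) x * dlt a ((avP w)^[n+1] g) x = _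
      rw [Function.iterate_succ_apply' _ _ g, dlt_avP, ← avP_selfadj w ((hφ.iter w _).dlt a)
        ((hg.iter w _).dlt a), ← dlt_avP, ← Function.iterate_succ_apply' (avP w),
        Function.iterate_succ_apply, Function.iterate_succ_apply]
    rw [e, ← integral_sub (((hφ.iter w _).dlt a).mul ((hg.iter w _).dlt a)).integrable
      (((((hφ.avP w).avP w).iter w _).dlt a).mul ((hg.iter w _).dlt a)).integrable]
    rw [hfdef, iter_sub]
    congr 1; funext x; simp only [dlt]; ring
  have hsum : ∀ M, |h 0| ≤ |h M| + 4 * Fintype.card ι * ∫ x, B (f x) (g x) := by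
    intro M
    have t : h 0 = h M + ∑ n ∈ Finset.range M, (h n - h (n+1)) := by
      rw [Finset.sum_range_sub']; ring
    rw [t]
    refine (abs_add_le _ _).trans (add_le_add_right ?_ _)
    refine (Finset.abs_sum_le_sum_abs _ _).trans ?_
    refine le_trans (Finset.sum_le_sum fun n _ => ?_) (bell_sum hr hq hB hf hg w j M)
    rw [hstep]
    exact abs_integral_le_integral_abs
  have htend : Tendsto (fun M => |h M|) atTop (𝓝 0) := by
    have : Summable (fun n => |h n|) := by
      refine summable_of_sum_range_le (c := 4 * Fintype.card ι * ∫ x, B (φ x) (g x))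
        (fun _ => abs_nonneg _) fun M => ?_
      exact le_trans (Finset.sum_le_sum fun n _ => abs_integral_le_integral_abs)
        (bell_sum hr hq hB hφ hg w j M)
    exact this.tendsto_atTop_zero
  have fin : |h 0| ≤ 0 + 4 * Fintype.card ι * ∫ x, B (f x) (g x) :=
    ge_of_tendsto' (htend.add_const _) hsum
  rw [zero_add] at fin
  rw [dlt_skew a (hφ.dlt a) hg, abs_neg]
  exact fin

end EllReg2

noncomputable section EllReg3

variable {d : ℕ}

/-- the duality map -/
def dualMap (r t : ℝ) : ℝ := (max t 0) ^ (r - 1) - (max (-t) 0) ^ (r - 1)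

lemma dualMap_cont (r : ℝ) (hr : 1 < r) : Continuous (dualMap r) := by
  unfold dualMap
  refine Continuous.sub (Continuous.rpow_const (by fun_prop) fun x => Or.inr (by linarith))
    (Continuous.rpow_const (by fun_prop) fun x => Or.inr (by linarith))

lemma dualMap_mul (r t : ℝ) (hr : 1 < r) : t * dualMap r t = |t| ^ r := by
  have h0 : (0:ℝ) ^ (r - 1) = 0 := Real.zero_rpow (by linarith)
  have ex : ∀ y : ℝ, 0 ≤ y → y ^ r = y * y ^ (r - 1) := fun y hy => by
    nth_rw 2 [← Real.rpow_one y]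
    rw [← Real.rpow_add_of_nonneg hy (by norm_num) (by linarith)]; congr 1; ring
  unfold dualMap
  rcases le_total 0 t with h | h
  · rw [max_eq_left h, max_eq_right (by linarith), h0, abs_of_nonneg h, sub_zero, ex t h]
  · rw [max_eq_right h, max_eq_left (by linarith), h0, abs_of_nonpos h, zero_sub, ex (-t) (by linarith)]
    ring

lemma dualMap_abs (r q t : ℝ) (hr : 1 < r) (hq : r.HolderConjugate q) : |dualMap r t| ^ q = |t| ^ r := by
  have h0 : (0:ℝ) ^ (r - 1) = 0 := Real.zero_rpow (by linarith)
  have e : (r - 1) * q = r := by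
    have := hq.sub_one_mul_conj; linarith
  have : |dualMap r t| = |t| ^ (r - 1) := by
    unfold dualMap
    rcases le_total 0 t with h | h
    · rw [max_eq_left h, max_eq_right (by linarith), h0, abs_of_nonneg h, sub_zero,
        abs_of_nonneg (by positivity)]
    · rw [max_eq_right h, max_eq_left (by linarith), h0, abs_of_nonpos h, zero_sub, abs_neg,
        abs_of_nonneg (Real.rpow_nonneg (by linarith) _)]
  rw [this, ← Real.rpow_mul (abs_nonneg _), e]

lemma cz_int (N : ℕ) (r q : ℝ) (hr : 1 < r) (hq : r.HolderConjugate q) :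
    ∃ K : ℝ, 0 < K ∧ ∀ (ι : Type) [Fintype ι] [Nonempty ι], Fintype.card ι = N →
    ∀ (φ : Euc d → ℝ), CC φ → ∀ (w : ι → Euc d) (j : ι),
    ∫ x, |dlt (w j) (dlt (w j) φ) x| ^ r ≤ K * ∫ x, |φ x - avP w (avP w φ) x| ^ r := by
  obtain ⟨B, C, hB⟩ := bellman_exists r q hq
  have hq1 : 1 < q := hq.symm.lt
  have hC := hB.1
  set K := 4 * (N + 1) * C with hK
  have hK0 : 0 < K := by positivity
  -- choose s with K s^(q-1) = 1/2
  set s := (2 * K)⁻¹ ^ (1 / (q - 1)) with hs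
  have hs0 : 0 < s := by positivity
  have hsq : K * s ^ q = s / 2 := by
    have : s ^ (q - 1) = (2 * K)⁻¹ := by
      rw [hs, ← Real.rpow_mul (by positivity), one_div, inv_mul_cancel₀ (by linarith), Real.rpow_one]
    have e : s ^ q = s ^ (q - 1) * s := by
      nth_rw 3 [← Real.rpow_one s]
      rw [← Real.rpow_add hs0]; congr 1; ring
    rw [e, this]; field_simp
  refine ⟨K * 2 / s, by positivity, ?_⟩
  intro ι _ _ hN φ hφ w j
  set F := dlt (w j) (dlt (w j) φ) with hF
  have hFc : CC F := (hφ.dlt _).dlt _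
  set g : Euc d → ℝ := fun x => s * dualMap r (F x) with hg
  have hgc : CC g := (hFc.comp (dualMap_cont r hr) (by simp [dualMap])).cmul s
  set f : Euc d → ℝ := fun x => φ x - avP w (avP w φ) x with hf
  have hfc : CC f := hφ.sub ((hφ.avP w).avP w)
  have h1 := cz_dual (by linarith) (by linarith) hB hφ hgc w j
  have e1 : ∀ x, F x * g x = s * |F x| ^ r := fun x => by
    rw [hg, ← dualMap_mul r _ hr]; ring
  have e2 : ∀ x, |g x| ^ q = s ^ q * |F x| ^ r := fun x => by
    rw [hg, abs_mul, Real.mul_rpow (abs_nonneg _) (abs_nonneg _), dualMap_abs r q _ hr hq,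
      abs_of_pos hs0]
  have I0 : 0 ≤ ∫ x, |F x| ^ r := integral_nonneg fun x => by positivity
  have J0 : 0 ≤ ∫ x, |f x| ^ r := integral_nonneg fun x => by positivity
  have h2 : ∫ x, B (f x) (g x) ≤ C * (∫ x, |f x| ^ r) + C * (s ^ q * ∫ x, |F x| ^ r) := by
    have := integral_mono (bell_integrable (by linarith) (by linarith) hB hfc hgc)
      (((hfc.rpow (r := r) (by linarith)).add (hgc.rpow (r := q) (by linarith))).cmul C).integrable
      (fun x => hB.2.2.2.1 _ _)
    refine this.trans (le_of_eq ?_)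
    rw [integral_const_mul, integral_add (hfc.rpow (by linarith)).integrable
      (hgc.rpow (by linarith)).integrable]
    simp only [e2]
    rw [integral_const_mul]; ring
  rw [← hF] at h1
  simp only [e1] at h1
  rw [integral_const_mul, abs_of_nonneg (by positivity)] at h1
  have h3 : (4 * Fintype.card ι : ℝ) * ∫ x, B (f x) (g x) ≤ 4 * (N + 1) * ∫ x, B (f x) (g x) := by
    have : 0 ≤ ∫ x, B (f x) (g x) := integral_nonneg fun x => hB.2.2.1 _ _
    rw [hN]; gcongr; linarith
  have h4 : 4 * ((N:ℝ) + 1) * ∫ x, B (f x) (g x) ≤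
     K * (∫ x, |f x| ^ r) + K * s ^ q * ∫ x, |F x| ^ r := by
    have := mul_le_mul_of_nonneg_left h2 (show 0 ≤ 4 * ((N:ℝ) + 1) by positivity)
    refine this.trans (le_of_eq ?_)
    rw [hK]; ring
  rw [hsq] at h4
  have h5 : s / 2 * ∫ x, |F x| ^ r ≤ K * ∫ x, |f x| ^ r := by linarith
  rw [mul_div_assoc, mul_assoc, mul_comm]
  rw [mul_comm] at h5
  have h6 : (∫ x, |F x| ^ r) * (s/2) * (2/s) ≤ (K * ∫ x, |f x| ^ r) * (2/s) := by gcongr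
  have h7 : (∫ x, |F x| ^ r) * (s/2) * (2/s) = ∫ x, |F x| ^ r := by field_simp
  rw [h7] at h6
  linarith

lemma CC.memLp {f : Euc d → ℝ} (hf : CC f) (p : ℝ≥0∞) : MemLp f p volume :=
  hf.1.memLp_of_hasCompactSupport hf.2

lemma mp_add (a : Euc d) : MeasurePreserving (fun x : Euc d => x + a) volume volume :=
  measurePreserving_add_right volume a
lemma mp_sub (a : Euc d) : MeasurePreserving (fun x : Euc d => x - a) volume volume :=
  measurePreserving_sub_right volume a

lemma MemLp.tr' {p : ℝ≥0∞} {f : Euc d → ℝ} (hf : MemLp f p volume) (a : Euc d) :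
    MemLp (fun x => f (x + a)) p volume := hf.comp_measurePreserving (mp_add a)
lemma MemLp.trs' {p : ℝ≥0∞} {f : Euc d → ℝ} (hf : MemLp f p volume) (a : Euc d) :
    MemLp (fun x => f (x - a)) p volume := hf.comp_measurePreserving (mp_sub a)
lemma eLpNorm_tr {p : ℝ≥0∞} {f : Euc d → ℝ} (hf : AEStronglyMeasurable f volume) (a : Euc d) :
    eLpNorm (fun x => f (x + a)) p volume = eLpNorm f p volume :=
  eLpNorm_comp_measurePreserving hf (mp_add a)
lemma eLpNorm_trs {p : ℝ≥0∞} {f : Euc d → ℝ} (hf : AEStronglyMeasurable f volume) (a : Euc d) :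
    eLpNorm (fun x => f (x - a)) p volume = eLpNorm f p volume :=
  eLpNorm_comp_measurePreserving hf (mp_sub a)

/-- second difference -/
def dd (a : Euc d) (f : Euc d → ℝ) (x : Euc d) : ℝ := f (x + a) - 2 * f x + f (x - a)

lemma eLpNorm_cmul {p : ℝ≥0∞} {μ : Measure (Euc d)} (c : ℝ) (f : Euc d → ℝ) :
    eLpNorm (fun x => c * f x) p μ = ‖c‖ₑ * eLpNorm f p μ :=
  eLpNorm_const_smul c f p μ

lemma MemLp.dd {p : ℝ≥0∞} {f : Euc d → ℝ} (hf : MemLp f p volume) (a : Euc d) :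
    MemLp (dd a f) p volume := ((MemLp.tr' hf a).sub (hf.const_mul 2)).add (MemLp.trs' hf a)

lemma eLpNorm_dd_le {p : ℝ≥0∞} (hp : 1 ≤ p) {f : Euc d → ℝ} (hf : MemLp f p volume) (a : Euc d) :
    eLpNorm (dd a f) p volume ≤ 4 * eLpNorm f p volume := by
  have h1 := eLpNorm_add_le ((MemLp.tr' hf a).sub (hf.const_mul 2)).1 (MemLp.trs' hf a).1 hp
  have h2 := eLpNorm_sub_le (MemLp.tr' hf a).1 (hf.const_mul 2).1 hp
  rw [eLpNorm_trs hf.1] at h1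
  rw [eLpNorm_tr hf.1, eLpNorm_cmul] at h2
  have e : ‖(2:ℝ)‖ₑ = 2 := by simp [← ofReal_norm]
  rw [e] at h2
  calc _ ≤ _ := h1
    _ ≤ _ := add_le_add_left h2 _
    _ = _ := by ring

/-- sum of second differences -/
def ddS {ι : Type} [Fintype ι] (w : ι → Euc d) (f : Euc d → ℝ) (x : Euc d) : ℝ := ∑ i, dd (w i) f x

lemma eLpNorm_ddS_le {ι : Type} [Fintype ι] {p : ℝ≥0∞} (hp : 1 ≤ p) {f : Euc d → ℝ}
    (hf : MemLp f p volume) (w : ι → Euc d) :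
    eLpNorm (ddS w f) p volume ≤ 4 * Fintype.card ι * eLpNorm f p volume := by
  have : ddS w f = ∑ i, dd (w i) f := by funext x; simp [ddS]
  rw [this]
  refine (eLpNorm_sum_le (fun i _ => (MemLp.dd hf (w i)).1) hp).trans ?_
  refine (Finset.sum_le_sum fun i _ => eLpNorm_dd_le hp hf (w i)).trans (le_of_eq ?_)
  simp; ring

lemma MemLp.ddS {ι : Type} [Fintype ι] {p : ℝ≥0∞} {f : Euc d → ℝ} (hf : MemLp f p volume)
    (w : ι → Euc d) : MemLp (ddS w f) p volume := by
  have : _root_.ddS w f = ∑ i, _root_.dd (w i) f := by funext x; simp [_root_.ddS]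
  rw [this]; exact memLp_finsetSum' _ fun i _ => MemLp.dd hf (w i)

lemma sub_avP {ι : Type} [Fintype ι] [Nonempty ι] (w : ι → Euc d) (f : Euc d → ℝ) (x : Euc d) :
    f x - avP w f x = -(1 / (2 * (Fintype.card ι : ℝ))) * ddS w f x := by
  have hN0 : (Fintype.card ι : ℝ) ≠ 0 := by exact_mod_cast Fintype.card_ne_zero
  have : ∑ i : ι, (Fintype.card ι : ℝ)⁻¹ * f x = f x := by
    simp [hN0]
  conv_lhs => rw [← this]
  unfold avP ddS dd
  rw [← Finset.sum_sub_distrib, Finset.mul_sum]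
  refine Finset.sum_congr rfl fun i _ => ?_
  field_simp; ring

lemma eLpNorm_avP {ι : Type} [Fintype ι] [Nonempty ι] {p : ℝ≥0∞} (hp : 1 ≤ p) (w : ι → Euc d)
    {f : Euc d → ℝ} (hf : CC f) : eLpNorm (avP w f) p volume ≤ 3 * eLpNorm f p volume := by
  have e : avP w f = fun x => f x - (f x - avP w f x) := by funext x; ring
  have h2 := eLpNorm_sub_le (hf.memLp p).1 (hf.sub (hf.avP w) |>.memLp p).1 hp (μ := volume)
  have h3 : eLpNorm (fun x => f x - avP w f x) p volume ≤ 2 * eLpNorm f p volume := by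
    have : (fun x => f x - avP w f x) = fun x => -(1 / (2 * (Fintype.card ι : ℝ))) * ddS w f x := by
      funext x; exact sub_avP w f x
    rw [this, eLpNorm_cmul]
    refine (mul_le_mul_right (eLpNorm_ddS_le hp (hf.memLp p) w) _).trans (le_of_eq ?_)
    have hN0 : (0:ℝ) < Fintype.card ι := by exact_mod_cast Fintype.card_pos
    rw [← mul_assoc]
    congr 1
    have : (4 * (Fintype.card ι) : ℝ≥0∞) = ENNReal.ofReal (4 * Fintype.card ι) := by
      rw [ENNReal.ofReal_mul (by norm_num)]; simp
    rw [this, ← ofReal_norm, ← ENNReal.ofReal_mul (norm_nonneg _), norm_neg,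
      Real.norm_of_nonneg (by positivity)]
    have : (1 / (2 * (Fintype.card ι : ℝ)) * (4 * Fintype.card ι)) = 2 := by field_simp; norm_num
    rw [this]; simp
  calc eLpNorm (avP w f) p volume = eLpNorm (f - fun x => (f x - avP w f x)) p volume := by
        congr 1
    _ ≤ _ := h2
    _ ≤ eLpNorm f p volume + 2 * eLpNorm f p volume := by gcongr
    _ = _ := by ring

lemma dlt_dlt (a : Euc d) (f : Euc d → ℝ) : dlt a (dlt a f) = dd ((2:ℝ) • a) f := by
  funext x
  simp only [dlt, dd, two_smul]
  rw [show x + a + a = x + (a + a) by abel, show x + a - a = x by abel, show x - a + a = x by abel,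
    show x - a - a = x - (a + a) by abel]; ring

lemma cz_CC (N : ℕ) (p : ℝ≥0∞) (hp1 : 1 < p) (hp2 : p ≠ ⊤) :
    ∃ K : ℝ≥0, ∀ (ι : Type) [Fintype ι] [Nonempty ι], Fintype.card ι = N →
    ∀ (φ : Euc d → ℝ), CC φ → ∀ (w : ι → Euc d) (j : ι),
    eLpNorm (dd ((2:ℝ) • w j) φ) p volume ≤ K * eLpNorm (ddS w φ) p volume := by
  set r := p.toReal with hr
  have hr1 : 1 < r := by
    rw [hr, ← ENNReal.toReal_one]; exact (ENNReal.toReal_lt_toReal (by simp) hp2).2 hp1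
  have hp0 : p ≠ 0 := (zero_lt_one.trans hp1).ne'
  obtain ⟨K, hK, h⟩ := cz_int (d := d) N r r.conjExponent hr1 (Real.HolderConjugate.conjExponent hr1)
  refine ⟨(Real.toNNReal (K ^ r⁻¹)) * 4, ?_⟩
  intro ι _ _ hN φ hφ w j
  have h1 := h ι hN φ hφ w j
  rw [dlt_dlt] at h1
  set f : Euc d → ℝ := fun x => φ x - avP w (avP w φ) x with hf
  have hfc : CC f := hφ.sub ((hφ.avP w).avP w)
  have h2 : eLpNorm (dd ((2:ℝ) • w j) φ) p volume ≤ ENNReal.ofReal (K ^ r⁻¹) * eLpNorm f p volume := by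
    rw [MemLp.eLpNorm_eq_integral_rpow_norm hp0 hp2 (MemLp.dd (hφ.memLp p) _),
      MemLp.eLpNorm_eq_integral_rpow_norm hp0 hp2 (hfc.memLp p), ← ENNReal.ofReal_mul (by positivity),
      ← hr, ← Real.mul_rpow hK.le (integral_nonneg fun x => by positivity)]
    apply ENNReal.ofReal_le_ofReal
    apply Real.rpow_le_rpow (integral_nonneg fun x => by positivity) h1
    positivity
  set u : Euc d → ℝ := fun x => φ x - avP w φ x with hu
  have huc : CC u := hφ.sub (hφ.avP w)
  have e3 : f = u + avP w u := by
    funext x; simp only [hf, hu, Pi.add_apply, avP_sub]; ring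
  have h3 : eLpNorm f p volume ≤ 4 * eLpNorm u p volume := by
    rw [e3]
    refine (eLpNorm_add_le (huc.memLp p).1 ((huc.avP w).memLp p).1 hp1.le).trans ?_
    calc _ ≤ eLpNorm u p volume + 3 * eLpNorm u p volume := by gcongr; exact eLpNorm_avP hp1.le w huc
      _ = _ := by ring
  have h4 : eLpNorm u p volume ≤ eLpNorm (ddS w φ) p volume := by
    have : u = fun x => -(1 / (2 * (Fintype.card ι : ℝ))) * ddS w φ x := by
      funext x; exact sub_avP w φ x
    rw [this, eLpNorm_cmul]
    have hN0 : (1:ℝ) ≤ Fintype.card ι := by exact_mod_cast Fintype.card_pos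
    have : ‖-(1 / (2 * (Fintype.card ι : ℝ)))‖ₑ ≤ 1 := by
      rw [← ofReal_norm, ENNReal.ofReal_le_one, norm_neg, Real.norm_of_nonneg (by positivity),
        div_le_one (by positivity)]
      linarith
    exact mul_le_of_le_one_left (by simp) this
  calc _ ≤ _ := h2
    _ ≤ ENNReal.ofReal (K ^ r⁻¹) * (4 * eLpNorm (ddS w φ) p volume) := by gcongr; exact h3.trans (by gcongr)
    _ = _ := by
      rw [← mul_assoc]; congr 1

theorem cz_Lp (N : ℕ) (p : ℝ≥0∞) (hp1 : 1 < p) (hp2 : p ≠ ⊤) :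
    ∃ K : ℝ≥0, ∀ (ι : Type) [Fintype ι] [Nonempty ι], Fintype.card ι = N →
    ∀ (φ : Euc d → ℝ), MemLp φ p volume → ∀ (w : ι → Euc d) (j : ι),
    eLpNorm (dd ((2:ℝ) • w j) φ) p volume ≤ K * eLpNorm (ddS w φ) p volume := by
  obtain ⟨K, h⟩ := cz_CC (d := d) N p hp1 hp2
  refine ⟨K, ?_⟩
  intro ι _ _ hN φ hφ w j
  refine ENNReal.le_of_forall_pos_le_add fun ε hε _ => ?_
  set D : ℝ≥0 := 4 + K * (4 * N) with hD
  have hD0 : 0 < D := by positivity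
  obtain ⟨g, hgs, hg, hgc, hgm⟩ := hφ.exists_hasCompactSupport_eLpNorm_sub_le hp2 (ε := (ε / D : ℝ≥0))
    (by rw [Ne, ENNReal.coe_eq_zero]; positivity)
  have gCC : CC g := ⟨hgc, hgs⟩
  have hsub : MemLp (φ - g) p volume := hφ.sub hgm
  have e1 : dd ((2:ℝ) • w j) φ = dd ((2:ℝ) • w j) g + dd ((2:ℝ) • w j) (φ - g) := by
    funext x; simp only [dd, Pi.add_apply, Pi.sub_apply]; ring
  have e2 : ddS w g = ddS w φ - ddS w (φ - g) := by
    funext x; simp only [ddS, dd, Pi.sub_apply, ← Finset.sum_sub_distrib]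
    exact Finset.sum_congr rfl fun i _ => by ring
  have h1 : eLpNorm (ddS w g) p volume ≤ eLpNorm (ddS w φ) p volume + 4 * N * (ε / D : ℝ≥0) := by
    rw [e2]
    refine (eLpNorm_sub_le (MemLp.ddS hφ w).1 (MemLp.ddS hsub w).1 hp1.le).trans ?_
    gcongr
    refine (eLpNorm_ddS_le hp1.le hsub w).trans ?_
    rw [hN]; gcongr
  calc _ ≤ eLpNorm (dd ((2:ℝ) • w j) g) p volume + eLpNorm (dd ((2:ℝ) • w j) (φ - g)) p volume := by
        rw [e1]; exact eLpNorm_add_le (MemLp.dd hgm _).1 (MemLp.dd hsub _).1 hp1.le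
    _ ≤ K * (eLpNorm (ddS w φ) p volume + 4 * N * (ε / D : ℝ≥0)) + 4 * (ε / D : ℝ≥0) := by
        gcongr
        · exact (h ι hN g gCC w j).trans (by gcongr)
        · exact (eLpNorm_dd_le hp1.le hsub _).trans (by gcongr)
    _ = K * eLpNorm (ddS w φ) p volume + (D * (ε / D) : ℝ≥0) := by
        rw [hD]; push_cast; ring
    _ = _ := by rw [mul_div_cancel₀ _ hD0.ne']

end EllReg3

noncomputable section EllReg4

variable {d : ℕ} {p : ℝ≥0∞} [hp : Fact (1 ≤ p)]

/-- `C^1_c(U)` test functions -/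
def T1 (U : Set (Euc d)) (φ : Euc d → ℝ) : Prop :=
  ContDiff ℝ 1 φ ∧ HasCompactSupport φ ∧ tsupport φ ⊆ U

/-- weak directional derivative -/
def WD (U : Set (Euc d)) (e : Euc d) (u v : Euc d → ℝ) : Prop :=
  ∀ φ, T1 U φ → ∫ x, u x * fderiv ℝ φ x e = - ∫ x, v x * φ x

/-- `L^p(U)` -/
abbrev LpU (p : ℝ≥0∞) (U : Set (Euc d)) (u : Euc d → ℝ) : Prop := MemLp u p (volume.restrict U)

lemma IsTestFun.t1 {U : Set (Euc d)} {φ : Euc d → ℝ} (h : IsTestFun U φ) : T1 U φ :=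
  ⟨h.1.of_le (by exact_mod_cast le_top), h.2⟩

lemma T1.cc {U : Set (Euc d)} {φ : Euc d → ℝ} (h : T1 U φ) : CC φ := ⟨h.1.continuous, h.2.1⟩
lemma C1.ccd {φ : Euc d → ℝ} (h1 : ContDiff ℝ 1 φ) (h2 : HasCompactSupport φ) (e : Euc d) :
    CC (fun x => fderiv ℝ φ x e) :=
  ⟨(h1.continuous_fderiv (by norm_num)).clm_apply continuous_const, h2.fderiv_apply ℝ e⟩
lemma T1.ccd {U : Set (Euc d)} {φ : Euc d → ℝ} (h : T1 U φ) (e : Euc d) :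
    CC (fun x => fderiv ℝ φ x e) := C1.ccd h.1 h.2.1 e
lemma T1.z {U : Set (Euc d)} {φ : Euc d → ℝ} (h : T1 U φ) : ∀ x ∉ U, φ x = 0 := fun x hx =>
  image_eq_zero_of_notMem_tsupport fun h' => hx (h.2.2 h')
lemma T1.zd {U : Set (Euc d)} {φ : Euc d → ℝ} (h : T1 U φ) (e : Euc d) :
    ∀ x ∉ U, fderiv ℝ φ x e = 0 := fun x hx =>
  image_eq_zero_of_notMem_tsupport (f := fun x => fderiv ℝ φ x e) fun h' => hx (h.2.2 (tsupport_fderiv_apply_subset ℝ e h'))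
lemma T1.mono {U V : Set (Euc d)} {φ : Euc d → ℝ} (h : T1 U φ) (hUV : U ⊆ V) : T1 V φ :=
  ⟨h.1, h.2.1, h.2.2.trans hUV⟩

lemma LpU.mono {U V : Set (Euc d)} {u : Euc d → ℝ} (h : LpU p V u) (hUV : U ⊆ V) : LpU p U u :=
  h.mono_measure (Measure.restrict_mono hUV le_rfl)

lemma int_mul {U : Set (Euc d)} (hU : MeasurableSet U) {u ψ : Euc d → ℝ} (hu : LpU p U u)
    (hψ : CC ψ) (hz : ∀ x ∉ U, ψ x = 0) : Integrable (fun x => u x * ψ x) := by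
  have h1 := ((memLp_indicator_iff_restrict hU).2 hu).locallyIntegrable hp.out
  have h2 := h1.integrable_smul_right_of_hasCompactSupport hψ.1 hψ.2
  refine h2.congr (ae_of_all _ fun x => ?_)
  by_cases hx : x ∈ U
  · simp [hx]
  · simp [hx, hz x hx]

lemma int_mul' {U : Set (Euc d)} (hU : MeasurableSet U) {u ψ : Euc d → ℝ} (hu : LpU p U u)
    (hψ : CC ψ) : IntegrableOn (fun x => u x * ψ x) U := by
  have h1 := ((memLp_indicator_iff_restrict hU).2 hu).locallyIntegrable hp.out
  have h2 := h1.integrable_smul_right_of_hasCompactSupport hψ.1 hψ.2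
  refine (h2.integrableOn (s := U)).congr_fun (fun x hx => ?_) hU
  simp [hx]

lemma setInt_eq {U : Set (Euc d)} (hU : MeasurableSet U) {u ψ : Euc d → ℝ}
    (hz : ∀ x ∉ U, ψ x = 0) : ∫ x in U, u x * ψ x = ∫ x, u x * ψ x := by
  apply setIntegral_eq_integral_of_forall_compl_eq_zero
  intro x hx; simp [hz x hx]

/-- Hölder bound for testing -/
lemma test_bound (p : ℝ≥0∞) [hp : Fact (1 ≤ p)] {U : Set (Euc d)} (hU : MeasurableSet U) {ψ : Euc d → ℝ} (hψ : CC ψ) :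
    ∃ C : ℝ≥0, ∀ u, LpU p U u → ‖∫ x in U, u x * ψ x‖ₑ ≤ C * eLpNorm u p (volume.restrict U) := by
  set q := ENNReal.conjExponent p
  haveI : p.HolderConjugate q := ENNReal.HolderConjugate.conjExponent hp.out
  haveI : ENNReal.HolderTriple p q 1 := this
  have hψq : MemLp ψ q (volume.restrict U) := (hψ.memLp q).restrict U
  refine ⟨(eLpNorm ψ q (volume.restrict U)).toNNReal, fun u hu => ?_⟩
  rw [ENNReal.coe_toNNReal hψq.2.ne, mul_comm]
  refine (enorm_integral_le_lintegral_enorm _).trans ?_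
  have := eLpNorm_smul_le_mul_eLpNorm (p := p) (q := q) (r := 1) hψq.1 hu.1
  rw [eLpNorm_one_eq_lintegral_enorm] at this
  exact this

lemma test_tendsto {U : Set (Euc d)} (hU : MeasurableSet U) {ψ : Euc d → ℝ} (hψ : CC ψ)
    {un : ℕ → Euc d → ℝ} {u : Euc d → ℝ} (hn : ∀ n, LpU p U (un n)) (hu : LpU p U u)
    (h : Tendsto (fun n => eLpNorm (un n - u) p (volume.restrict U)) atTop (𝓝 0)) :
    Tendsto (fun n => ∫ x in U, un n x * ψ x) atTop (𝓝 (∫ x in U, u x * ψ x)) := by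
  obtain ⟨C, hC⟩ := test_bound p hU hψ
  rw [tendsto_iff_edist_tendsto_0]
  have h0 : Tendsto (fun n => C * eLpNorm (un n - u) p (volume.restrict U)) atTop (𝓝 0) := by
    simpa using ENNReal.Tendsto.const_mul h (Or.inr ENNReal.coe_ne_top)
  refine tendsto_of_tendsto_of_tendsto_of_le_of_le tendsto_const_nhds h0 (fun _ => zero_le) fun n => ?_
  have := hC (un n - u) ((hn n).sub hu)
  refine le_trans (le_of_eq ?_) this
  rw [edist_eq_enorm_sub, ← integral_sub (int_mul' hU (hn n) hψ) (int_mul' hU hu hψ)]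
  simp [sub_mul]

lemma WD.lim {U : Set (Euc d)} (hU : MeasurableSet U) {e : Euc d}
    {un vn : ℕ → Euc d → ℝ} {u v : Euc d → ℝ} (hn : ∀ n, LpU p U (un n)) (hu : LpU p U u)
    (hvn : ∀ n, LpU p U (vn n)) (hv : LpU p U v)
    (h : Tendsto (fun n => eLpNorm (un n - u) p (volume.restrict U)) atTop (𝓝 0))
    (h' : Tendsto (fun n => eLpNorm (vn n - v) p (volume.restrict U)) atTop (𝓝 0))
    (hw : ∀ n, WD U e (un n) (vn n)) : WD U e u v := by
  intro φ hφ
  have t1 := test_tendsto hU (hφ.ccd e) hn hu h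
  have t2 := (test_tendsto hU hφ.cc hvn hv h').neg
  simp only [setInt_eq hU (hφ.z), setInt_eq hU (hφ.zd e)] at t1 t2
  simp only [fun n => hw n φ hφ] at t1
  exact tendsto_nhds_unique t1 t2

lemma ae_eq_of_test {U : Set (Euc d)} (hU : IsOpen U) {u v : Euc d → ℝ} (hu : LpU p U u) (hv : LpU p U v)
    (h : ∀ φ, IsTestFun U φ → ∫ x, u x * φ x = ∫ x, v x * φ x) : u =ᵐ[volume.restrict U] v := by
  have hl : LocallyIntegrableOn (fun x => u x - v x) U := by
    have h1 := ((memLp_indicator_iff_restrict hU.measurableSet).2 (hu.sub hv)).locallyIntegrable hp.out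
    refine (h1.locallyIntegrableOn U).congr ?_ |>.mono_set subset_rfl
    rw [EventuallyEq, ae_restrict_iff' hU.measurableSet]
    exact ae_of_all _ fun x hx => by simp [hx]
  have := hU.ae_eq_zero_of_integral_contDiff_smul_eq_zero hl (fun g h1 h2 h3 => by
    have hT : IsTestFun U g := ⟨h1, h2, h3⟩
    have := h g hT
    have e : ∀ x, g x • (u x - v x) = u x * g x - v x * g x := fun x => by simp [mul_sub, mul_comm]
    simp only [e]
    rw [integral_sub (int_mul hU.measurableSet hu hT.t1.cc hT.t1.z)
      (int_mul hU.measurableSet hv hT.t1.cc hT.t1.z), this, sub_self])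
  rw [EventuallyEq, ae_restrict_iff' hU.measurableSet]
  filter_upwards [this] with x hx hxU
  linarith [hx hxU]

lemma WD.unique {U : Set (Euc d)} (hU : IsOpen U) {e : Euc d} {u v w : Euc d → ℝ}
    (hv : LpU p U v) (hw : LpU p U w) (h1 : WD U e u v) (h2 : WD U e u w) : v =ᵐ[volume.restrict U] w :=
  ae_eq_of_test hU hv hw fun φ hφ => by
    have := h1 φ hφ.t1
    have := h2 φ hφ.t1
    linarith

lemma int_congr {U : Set (Euc d)} (hU : MeasurableSet U) {u v ψ : Euc d → ℝ}
    (h : u =ᵐ[volume.restrict U] v) (hz : ∀ x ∉ U, ψ x = 0) :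
    ∫ x, u x * ψ x = ∫ x, v x * ψ x := by
  rw [← setInt_eq hU hz, ← setInt_eq hU hz]
  apply integral_congr_ae
  filter_upwards [h] with x hx
  rw [hx]

lemma WD.congr {U : Set (Euc d)} (hU : MeasurableSet U) {e : Euc d} {u u' v v' : Euc d → ℝ}
    (h : WD U e u v) (hu : u =ᵐ[volume.restrict U] u') (hv : v =ᵐ[volume.restrict U] v') : WD U e u' v' := by
  intro φ hφ
  rw [← int_congr hU hu (hφ.zd e), ← int_congr hU hv hφ.z]
  exact h φ hφ

lemma WD.mono {U V : Set (Euc d)} {e : Euc d} {u v : Euc d → ℝ} (h : WD V e u v) (hUV : U ⊆ V) :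
    WD U e u v := fun φ hφ => h φ (hφ.mono hUV)

lemma WD.add {U : Set (Euc d)} (hU : MeasurableSet U) {e : Euc d} {u v u' v' : Euc d → ℝ}
    (hu : LpU p U u) (hv : LpU p U v) (hu' : LpU p U u') (hv' : LpU p U v')
    (h : WD U e u v) (h' : WD U e u' v') : WD U e (fun x => u x + u' x) (fun x => v x + v' x) := by
  intro φ hφ
  simp only [add_mul]
  rw [integral_add (int_mul hU hu (hφ.ccd e) (hφ.zd e)) (int_mul hU hu' (hφ.ccd e) (hφ.zd e)),
    integral_add (int_mul hU hv hφ.cc hφ.z) (int_mul hU hv' hφ.cc hφ.z), h φ hφ, h' φ hφ]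
  ring

lemma WD.smul {U : Set (Euc d)} {e : Euc d} {u v : Euc d → ℝ} (c : ℝ)
    (h : WD U e u v) : WD U e (fun x => c * u x) (fun x => c * v x) := by
  intro φ hφ
  simp only [mul_assoc]
  rw [integral_const_mul, integral_const_mul, h φ hφ]; ring

lemma WD.dadd {U : Set (Euc d)} (hU : MeasurableSet U) {e e' : Euc d} {u v v' : Euc d → ℝ}
    (hu : LpU p U u) (hv : LpU p U v) (hv' : LpU p U v')
    (h : WD U e u v) (h' : WD U e' u v') : WD U (e + e') u (fun x => v x + v' x) := by
  intro φ hφ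
  simp only [add_mul, map_add, mul_add]
  rw [integral_add (int_mul hU hu (hφ.ccd e) (hφ.zd e)) (int_mul hU hu (hφ.ccd e') (hφ.zd e')),
    integral_add (int_mul hU hv hφ.cc hφ.z) (int_mul hU hv' hφ.cc hφ.z), h φ hφ, h' φ hφ]
  ring

lemma WD.dsmul {U : Set (Euc d)} {e : Euc d} {u v : Euc d → ℝ} (c : ℝ)
    (h : WD U e u v) : WD U (c • e) u (fun x => c * v x) := by
  intro φ hφ
  have : ∀ x, u x * fderiv ℝ φ x (c • e) = c * (u x * fderiv ℝ φ x e) := fun x => by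
    simp; ring
  simp only [this, mul_assoc]
  rw [integral_const_mul, integral_const_mul, h φ hφ]; ring

lemma WD.zero (U : Set (Euc d)) (e : Euc d) : WD U e (fun _ => 0) (fun _ => 0) := by
  intro φ hφ; simp

lemma WD.dzero (U : Set (Euc d)) (u : Euc d → ℝ) : WD U 0 u (fun _ => 0) := by
  intro φ hφ; simp

lemma WD.dsum {U : Set (Euc d)} (hU : MeasurableSet U) {ι : Type*} (s : Finset ι) {e : ι → Euc d}
    {u : Euc d → ℝ} {v : ι → Euc d → ℝ} (hu : LpU p U u) (hv : ∀ i, LpU p U (v i))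
    (h : ∀ i, WD U (e i) u (v i)) : WD U (∑ i ∈ s, e i) u (fun x => ∑ i ∈ s, v i x) := by
  classical
  induction s using Finset.induction_on with
  | empty => simpa using WD.dzero U u
  | insert a s ha ih =>
    simp only [Finset.sum_insert ha]
    exact WD.dadd hU hu (hv a) (memLp_finsetSum _ fun i _ => hv i) (h a) ih

lemma T1.mul {U : Set (Euc d)} {φ a : Euc d → ℝ} (h : T1 U φ) (ha : ContDiff ℝ 1 a) :
    T1 U (fun x => a x * φ x) :=
  ⟨ha.mul h.1, h.2.1.mul_left, (tsupport_mul_subset_right (f := a) (g := φ)).trans h.2.2⟩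

lemma fderiv_mul_apply {a φ : Euc d → ℝ} (ha : ContDiff ℝ 1 a) (hφ : ContDiff ℝ 1 φ) (x e : Euc d) :
    fderiv ℝ (fun x => a x * φ x) x e = a x * fderiv ℝ φ x e + fderiv ℝ a x e * φ x := by
  have h := fderiv_mul (ha.differentiable (by norm_num) x) (hφ.differentiable (by norm_num) x)
  have h2 : fderiv ℝ (fun x => a x * φ x) x = a x • fderiv ℝ φ x + φ x • fderiv ℝ a x := h
  rw [h2]; simp [mul_comm]

lemma CC.cmul' {φ a : Euc d → ℝ} (h : CC φ) (ha : Continuous a) : CC (fun x => a x * φ x) :=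
  ⟨ha.mul h.1, h.2.mul_left⟩

lemma WD.mulC {U : Set (Euc d)} (hU : MeasurableSet U) {e : Euc d} {u v a : Euc d → ℝ}
    (hu : LpU p U u) (hv : LpU p U v) (ha : ContDiff ℝ 1 a) (h : WD U e u v) :
    WD U e (fun x => a x * u x) (fun x => a x * v x + fderiv ℝ a x e * u x) := by
  intro φ hφ
  have h1 := h _ (hφ.mul ha)
  have hda : Continuous (fun x => fderiv ℝ a x e) :=
    (ha.continuous_fderiv (by norm_num)).clm_apply continuous_const
  simp only [fderiv_mul_apply ha hφ.1] at h1
  have i1 : Integrable (fun x => u x * (a x * fderiv ℝ φ x e)) :=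
    int_mul hU hu ((hφ.ccd e).cmul' ha.continuous) (fun x hx => by simp [hφ.zd e x hx])
  have i2 : Integrable (fun x => u x * (fderiv ℝ a x e * φ x)) :=
    int_mul hU hu (hφ.cc.cmul' hda) (fun x hx => by simp [hφ.z x hx])
  have i3 : Integrable (fun x => v x * (a x * φ x)) :=
    int_mul hU hv (hφ.cc.cmul' ha.continuous) (fun x hx => by simp [hφ.z x hx])
  simp only [mul_add] at h1
  rw [integral_add i1 i2] at h1
  have e1 : ∀ x, a x * u x * fderiv ℝ φ x e = u x * (a x * fderiv ℝ φ x e) := fun x => by ring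
  have e2 : ∀ x, (a x * v x + fderiv ℝ a x e * u x) * φ x = v x * (a x * φ x) + u x * (fderiv ℝ a x e * φ x) :=
    fun x => by ring
  simp only [e1, e2]
  rw [integral_add i3 i2]; linarith

lemma T1.tr {U : Set (Euc d)} {φ : Euc d → ℝ} (h : T1 U φ) (a : Euc d) (hU : ∀ x, x ∈ U → x + a ∈ U) :
    T1 U (fun x => φ (x - a)) := by
  refine ⟨h.1.comp (by fun_prop), h.cc.trs a |>.2, ?_⟩
  have := tsupport_comp_eq_preimage φ (Homeomorph.subRight a)
  rw [show (fun x => φ (x - a)) = φ ∘ (Homeomorph.subRight a) from rfl, this]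
  intro x hx
  have := hU _ (h.2.2 hx)
  simpa using this

lemma fderiv_tr (φ : Euc d → ℝ) (a x : Euc d) : fderiv ℝ (fun x => φ (x - a)) x = fderiv ℝ φ (x - a) := by
  simpa [sub_eq_add_neg] using fderiv_comp_add_right (𝕜 := ℝ) (f := φ) (x := x) (-a)

lemma WD.tr {U : Set (Euc d)} {e : Euc d} {u v : Euc d → ℝ} (a : Euc d) (hU : ∀ x, x ∈ U → x + a ∈ U)
    (h : WD U e u v) : WD U e (fun x => u (x + a)) (fun x => v (x + a)) := by
  intro φ hφ
  have := h _ (hφ.tr a hU)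
  simp only [fderiv_tr] at this
  rw [← integral_add_right_eq_self _ a, ← integral_add_right_eq_self (fun x => v x * φ (x - a)) a] at this
  simpa using this

lemma WD.of_smooth {U : Set (Euc d)} (hU : IsOpen U) {e : Euc d} {u v : Euc d → ℝ}
    (hu : LpU p U u) (hv : LpU p U v)
    (h : ∀ φ, IsTestFun U φ → ∫ x, u x * fderiv ℝ φ x e = - ∫ x, v x * φ x) : WD U e u v := by
  intro φ hφ
  obtain ⟨δ, hδ, hsub⟩ := IsCompact.exists_cthickening_subset_open hφ.2.1 hU hφ.2.2
  set K := Metric.cthickening δ (tsupport φ) with hK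
  have hKc : IsCompact K := IsCompact.cthickening hφ.2.1
  let ρ : ℕ → ContDiffBump (0 : Euc d) := fun n =>
    ⟨δ / (n + 2) / 2, δ / (n + 2), by positivity, half_lt_self (by positivity)⟩
  have hρ0 : Tendsto (fun n => (ρ n).rOut) atTop (𝓝 0) := by
    show Tendsto (fun n : ℕ => δ / ((n:ℝ) + 2)) atTop (𝓝 0)
    exact tendsto_const_nhds.div_atTop (tendsto_atTop_add_const_right _ _ tendsto_natCast_atTop_atTop)
  let φn : ℕ → Euc d → ℝ := fun n =>
    convolution ((ρ n).normed volume) φ (ContinuousLinearMap.lsmul ℝ ℝ) volume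
  have hfd : ∀ n x, fderiv ℝ (φn n) x e =
      convolution ((ρ n).normed volume) (fun y => fderiv ℝ φ y e) (ContinuousLinearMap.lsmul ℝ ℝ) volume x := by
    intro n x
    have hl : LocallyIntegrable ((ρ n).normed (volume : Measure (Euc d))) volume :=
      (ρ n).continuous_normed.locallyIntegrable
    have h1 := HasCompactSupport.hasFDerivAt_convolution_right (ContinuousLinearMap.lsmul ℝ ℝ)
      hφ.2.1 hl hφ.1 x
    rw [h1.fderiv, convolution_precompR_apply _ hl (hφ.2.1.fderiv ℝ) (hφ.1.continuous_fderiv (by norm_num))]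
  have hsupp : ∀ n, tsupport (φn n) ⊆ K := by
    intro n
    apply closure_minimal _ Metric.isClosed_cthickening
    refine (support_convolution_subset _).trans ?_
    rw [ContDiffBump.support_normed_eq]
    rintro _ ⟨a, ha, b, hb, rfl⟩
    refine Metric.mem_cthickening_of_dist_le _ b _ _ (subset_tsupport _ hb) ?_
    simp only [Metric.mem_ball, dist_zero_right] at ha
    simp only [dist_add_self_left]
    refine ha.le.trans ?_
    show δ / ((n:ℝ) + 2) ≤ δ
    exact div_le_self hδ.le (by have : (0:ℝ) ≤ n := n.cast_nonneg; linarith)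
  have htest : ∀ n, IsTestFun U (φn n) := by
    intro n
    refine ⟨?_, ?_, (hsupp n).trans hsub⟩
    · exact HasCompactSupport.contDiff_convolution_left _ (ρ n).hasCompactSupport_normed
        (ρ n).contDiff_normed hφ.1.continuous.locallyIntegrable
    · exact HasCompactSupport.convolution _ (ρ n).hasCompactSupport_normed hφ.2.1
  have key : ∀ (g : Euc d → ℝ) (w : Euc d → ℝ) (gn : ℕ → Euc d → ℝ), CC g → LpU p U w →
      (∀ n x, gn n x = convolution ((ρ n).normed volume) g (ContinuousLinearMap.lsmul ℝ ℝ) volume x) →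
      (∀ n, CC (gn n)) →
      (∀ n, ∀ x ∉ K, gn n x = 0) →
      Tendsto (fun n => ∫ x, w x * gn n x) atTop (𝓝 (∫ x, w x * g x)) := by
    intro g w gn hg hw hgn hgc hz
    obtain ⟨M, hM⟩ := hg.2.exists_bound_of_continuous hg.1
    have hM0 : 0 ≤ M := (norm_nonneg _).trans (hM 0)
    have hwK : IntegrableOn w K := by
      haveI : IsFiniteMeasure ((volume : Measure (Euc d)).restrict K) := ⟨by simpa using hKc.measure_lt_top⟩
      exact (LpU.mono hw hsub).integrable hp.out
    apply tendsto_integral_of_dominated_convergence (K.indicator fun x => 3 * M * ‖w x‖)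
    · intro n
      exact (int_mul hU.measurableSet hw (hgc n) (fun x hx => hz n x fun h => hx (hsub h))).1
    · exact IntegrableOn.integrable_indicator (hwK.norm.const_mul _) hKc.measurableSet
    · intro n
      refine ae_of_all _ fun x => ?_
      by_cases hx : x ∈ K
      · rw [Set.indicator_of_mem hx, norm_mul, mul_comm]
        refine mul_le_mul_of_nonneg_right ?_ (norm_nonneg _)
        have := ContDiffBump.dist_normed_convolution_le (φ := ρ n) (x₀ := x) (ε := 2 * M)
          (μ := volume) hg.1.aestronglyMeasurable (fun y _ => by
            rw [dist_eq_norm]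
            exact (norm_sub_le _ _).trans (by linarith [hM x, hM y]))
        rw [← hgn, dist_eq_norm] at this
        have h3 := norm_sub_norm_le (gn n x) (g x)
        linarith [hM x]
      · rw [Set.indicator_of_notMem hx, hz n x hx]; simp
    · refine ae_of_all _ fun x => ?_
      simp only [hgn]
      exact (ContDiffBump.convolution_tendsto_right_of_continuous hρ0 hg.1 x).const_mul _
  have zK : ∀ n, ∀ x ∉ K, φn n x = 0 := fun n x hx =>
    image_eq_zero_of_notMem_tsupport fun h => hx (hsupp n h)
  have zK' : ∀ n, ∀ x ∉ K, fderiv ℝ (φn n) x e = 0 := fun n x hx =>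
    image_eq_zero_of_notMem_tsupport (f := fun x => fderiv ℝ (φn n) x e)
      fun h => hx (hsupp n (tsupport_fderiv_apply_subset ℝ e h))
  have t1 := key (fun x => fderiv ℝ φ x e) u (fun n x => fderiv ℝ (φn n) x e) (hφ.ccd e) hu hfd
    (fun n => (htest n).t1.ccd e) zK'
  have t2 := key φ v φn hφ.cc hv (fun n x => rfl) (fun n => (htest n).t1.cc) zK
  simp only [fun n => h (φn n) (htest n)] at t1
  exact tendsto_nhds_unique t1 t2.neg

lemma IsTestFun.pd {U : Set (Euc d)} {φ : Euc d → ℝ} (h : IsTestFun U φ) (e : Euc d) :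
    IsTestFun U (fun x => fderiv ℝ φ x e) := by
  refine ⟨?_, h.2.1.fderiv_apply ℝ e, (tsupport_fderiv_apply_subset ℝ e).trans h.2.2⟩
  have : ContDiff ℝ (⊤ : ℕ∞) (fderiv ℝ φ) := h.1.fderiv_right (by simp)
  exact this.clm_apply contDiff_const

lemma fderiv_fderiv_apply {φ : Euc d → ℝ} (h : ContDiff ℝ 2 φ) (e e' x : Euc d) :
    fderiv ℝ (fun x => fderiv ℝ φ x e) x e' = fderiv ℝ (fderiv ℝ φ) x e' e := by
  have hd : DifferentiableAt ℝ (fderiv ℝ φ) x :=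
    (h.fderiv_right (m := 1) (by norm_num)).differentiable (by norm_num) x
  have := fderiv_clm_apply hd (differentiableAt_const (𝕜 := ℝ) e (x := x))
  rw [this]; simp

lemma fderiv_comm {φ : Euc d → ℝ} (h : ContDiff ℝ 2 φ) (e e' x : Euc d) :
    fderiv ℝ (fun x => fderiv ℝ φ x e) x e' = fderiv ℝ (fun x => fderiv ℝ φ x e') x e := by
  rw [fderiv_fderiv_apply h, fderiv_fderiv_apply h]
  exact (h.contDiffAt.isSymmSndFDerivAt (by simp)) e' e

lemma WD.symm2 {U : Set (Euc d)} (hU : IsOpen U) {e e' : Euc d} {u v v' w : Euc d → ℝ}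
    (hv' : LpU p U v') (hw : LpU p U w)
    (h1 : WD U e u v) (h2 : WD U e' v w) (h3 : WD U e' u v') : WD U e v' w := by
  apply WD.of_smooth hU hv' hw
  intro φ hφ
  have a1 := h3 _ (hφ.pd e).t1
  have a2 := h1 _ (hφ.pd e').t1
  have a3 := h2 φ hφ.t1
  have hc : ∀ x, fderiv ℝ (fun x => fderiv ℝ φ x e) x e' = fderiv ℝ (fun x => fderiv ℝ φ x e') x e :=
    fun x => fderiv_comm (contDiff_infty.1 hφ.1 2) _ _ _
  simp only [hc] at a1
  linarith

end EllReg4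

noncomputable section EllReg5

variable {d : ℕ} {p : ℝ≥0∞} [hp : Fact (1 ≤ p)]

/-- translation curve in `L^p` -/
def GT {v : Euc d → ℝ} (hv : MemLp v p volume) (e : Euc d) (h : ℝ) : Lp ℝ p (volume : Measure (Euc d)) :=
  (MemLp.tr' hv (h • e)).toLp (fun x => v (x + h • e))

lemma GT_cont (hp2 : p ≠ ⊤) {v : Euc d → ℝ} (hv : MemLp v p volume) (e : Euc d) : Continuous (GT hv e) := by
  let g : ℝ → C(Euc d, Euc d) := fun h => ⟨fun x => x + h • e, by fun_prop⟩
  have hg : Continuous g := ContinuousMap.continuous_of_continuous_uncurry _ (by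
    show Continuous (fun q : ℝ × Euc d => q.2 + q.1 • e); fun_prop)
  have := Continuous.compMeasurePreservingLp (μ := (volume : Measure (Euc d))) (ν := volume) (p := p)
    (f := fun _ : ℝ => hv.toLp v) (g := g) continuous_const hg (fun h => mp_add (h • e)) hp2
  exact this

lemma GT_norm {v : Euc d → ℝ} (hv : MemLp v p volume) (e : Euc d) (h : ℝ) :
    ‖GT hv e h‖ = (eLpNorm v p volume).toReal := by
  rw [GT, Lp.norm_toLp, eLpNorm_tr hv.1]

/-- pairing with a test function -/
lemma exists_pair (p : ℝ≥0∞) [hp : Fact (1 ≤ p)] {φ : Euc d → ℝ} (hφ : CC φ) :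
    ∃ L : Lp ℝ p (volume : Measure (Euc d)) →L[ℝ] ℝ, ∀ v (hv : MemLp v p volume), L (hv.toLp v) = ∫ x, v x * φ x := by
  set q := ENNReal.conjExponent p
  haveI hpq : p.HolderConjugate q := ENNReal.HolderConjugate.conjExponent hp.out
  haveI : Fact (1 ≤ q) := ⟨ENNReal.HolderConjugate.one_le q p⟩
  have hφq := hφ.memLp q
  refine ⟨(ContinuousLinearMap.lpPairing volume p q (ContinuousLinearMap.mul ℝ ℝ)).flip (hφq.toLp φ), fun v hv => ?_⟩
  rw [ContinuousLinearMap.flip_apply, ContinuousLinearMap.lpPairing_eq_integral]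
  apply integral_congr_ae
  filter_upwards [hφq.coeFn_toLp, hv.coeFn_toLp] with x h1 h2
  simp [h1, h2]

lemma lp_ext {f g : Lp ℝ p (volume : Measure (Euc d))}
    (h : ∀ φ, IsTestFun Set.univ φ → ∫ x, f x * φ x = ∫ x, g x * φ x) : f = g := by
  apply Lp.ext
  have := ae_eq_of_test (p := p) isOpen_univ (by simpa [LpU] using Lp.memLp f) (by simpa [LpU] using Lp.memLp g) h
  simpa using this

lemma test_deriv {v w : Euc d → ℝ} {e : Euc d} (hv : MemLp v p volume) (hw : MemLp w p volume)
    (h : WD Set.univ e v w) {φ : Euc d → ℝ} (hφ : IsTestFun Set.univ φ) (t : ℝ) :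
    HasDerivAt (fun t : ℝ => ∫ x, v (x + t • e) * φ x) (∫ x, w (x + t • e) * φ x) t := by
  have sw : ∀ (u ψ : Euc d → ℝ) (t : ℝ), ∫ x, u (x + t • e) * ψ x = ∫ x, u x * ψ (x - t • e) := fun u ψ t => by
    rw [← integral_add_right_eq_self (fun x => u x * ψ (x - t • e)) (t • e)]; simp
  simp only [sw]
  let ψ : Euc d → ℝ := fun y => φ (-y)
  have hψ : ContDiff ℝ 1 ψ := hφ.t1.1.comp contDiff_neg
  have hψc : HasCompactSupport ψ := hφ.2.1.comp_homeomorph (Homeomorph.neg (Euc d))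
  have hl := hv.locallyIntegrable hp.out
  have h1 := HasCompactSupport.hasFDerivAt_convolution_right (μ := volume) (ContinuousLinearMap.lsmul ℝ ℝ)
      hψc hl hψ (t • e)
  have h2 : HasDerivAt (fun s : ℝ => s • e) e t := by simpa using (hasDerivAt_id t).smul_const e
  have h3 := h1.comp_hasDerivAt t h2
  rw [convolution_precompR_apply _ hl (hψc.fderiv ℝ) (hψ.continuous_fderiv (by norm_num))] at h3
  have e1 : ((convolution v ψ (ContinuousLinearMap.lsmul ℝ ℝ) volume) ∘ fun s : ℝ => s • e) =
      fun t : ℝ => ∫ x, v x * φ (x - t • e) := by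
    funext s; simp [convolution, ψ]
  have e2 : (convolution v (fun a => (fderiv ℝ ψ a) e) (ContinuousLinearMap.lsmul ℝ ℝ) volume (t • e))
     = ∫ x, w x * φ (x - t • e) := by
    have := h _ (hφ.t1.tr (t • e) (fun _ _ => trivial))
    simp only [fderiv_tr] at this
    rw [← neg_eq_iff_eq_neg] at this
    rw [← this, ← integral_neg]
    simp only [convolution]
    congr 1; funext x
    have : fderiv ℝ ψ (t • e - x) = - fderiv ℝ φ (x - t • e) := by
      have h5 := (hφ.t1.1.differentiable (by norm_num) (-(t • e - x))).hasFDerivAt.comp (t • e - x)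
        (hasFDerivAt_id (𝕜 := ℝ) (t • e - x)).neg
      have h6 : HasFDerivAt ψ ((fderiv ℝ φ (-(t • e - x))).comp (-ContinuousLinearMap.id ℝ (Euc d))) (t • e - x) := h5
      rw [h6.fderiv]; simp
    rw [this]; simp
  rw [e1, e2] at h3
  exact h3

lemma GT_hasDerivAt (hp2 : p ≠ ⊤) {v w : Euc d → ℝ} {e : Euc d} (hv : MemLp v p volume) (hw : MemLp w p volume)
    (h : WD Set.univ e v w) (t : ℝ) : HasDerivAt (GT hv e) (GT hw e t) t := by
  have hc := GT_cont hp2 hw e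
  have key : ∀ s, GT hv e s = GT hv e 0 + ∫ r in (0:ℝ)..s, GT hw e r := by
    intro s
    apply lp_ext
    intro φ hφ
    obtain ⟨L, hL⟩ := exists_pair p hφ.t1.cc
    have hL' : ∀ f : Lp ℝ p (volume : Measure (Euc d)), ∫ x, f x * φ x = L f := fun f => by
      rw [← hL f (Lp.memLp f), Lp.toLp_coeFn]
    rw [hL', hL', map_add, ← ContinuousLinearMap.intervalIntegral_comp_comm _ (hc.intervalIntegrable _ _)]
    have hd : ∀ t, HasDerivAt (fun t => L (GT hv e t)) (L (GT hw e t)) t := fun t => by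
      simp only [GT, hL]
      exact test_deriv hv hw h hφ t
    rw [intervalIntegral.integral_eq_sub_of_hasDerivAt (fun x _ => hd x)
      ((L.continuous.comp hc).intervalIntegrable _ _)]
    ring
  have h2 := ((hc.integral_hasStrictDerivAt 0 t).hasDerivAt).const_add (GT hv e 0)
  have h3 : GT hv e = fun s => GT hv e 0 + ∫ r in (0:ℝ)..s, GT hw e r := funext key
  rw [h3]; exact h2

section curve
variable {F : Type*} [NormedAddCommGroup F] [NormedSpace ℝ F]

lemma curve1 {G G1 : ℝ → F} (h1 : ∀ t, HasDerivAt G (G1 t) t) {C : ℝ} {h : ℝ}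
    (hC : ∀ t, |t| ≤ |h| → ‖G1 t‖ ≤ C) : ‖G h - G 0‖ ≤ C * |h| := by
  have := Convex.norm_image_sub_le_of_norm_hasDerivWithin_le (𝕜 := ℝ) (f := G) (f' := G1) (s := Set.Icc (-|h|) |h|) (C := C)
    (x := 0) (y := h) (fun x _ => (h1 x).hasDerivWithinAt) (fun x hx => hC x (abs_le.2 hx)) (convex_Icc _ _)
    (by simp) (abs_le.1 le_rfl)
  simpa using this

lemma curve2 {G G1 G2 : ℝ → F} (h1 : ∀ t, HasDerivAt G (G1 t) t) (h2 : ∀ t, HasDerivAt G1 (G2 t) t) {C : ℝ} (h : ℝ)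
    (hC : ∀ t, ‖G2 t‖ ≤ C) : ‖G h - G 0 - h • G1 0‖ ≤ C * |h| * |h| := by
  have := curve1 (G := fun t => G t - t • G1 0) (G1 := fun t => G1 t - G1 0) (C := C * |h|) (h := h)
    (fun t => ((h1 t).sub ((hasDerivAt_id t).smul_const (G1 0))).congr_deriv (by simp)) (fun t ht => by
      refine (curve1 h2 (C := C) (fun s _ => hC s)).trans ?_
      exact mul_le_mul_of_nonneg_left ht ((norm_nonneg _).trans (hC 0)))
  refine le_trans (le_of_eq ?_) this
  congr 1; simp; abel

lemma curve3 {G G1 G2 : ℝ → F} (h1 : ∀ t, HasDerivAt G (G1 t) t) (h2 : ∀ t, HasDerivAt G1 (G2 t) t)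
    (h3 : Continuous G2) : Tendsto (fun h : ℝ => (h ^ 2)⁻¹ • (G h - (2:ℝ) • G 0 + G (-h))) (𝓝[≠] 0) (𝓝 (G2 0)) := by
  rw [Metric.tendsto_nhds]
  intro ε hε
  have h3c : Continuous fun t => G2 t + G2 (-t) - (2:ℝ) • G2 0 := by fun_prop
  have h30 : (fun t => G2 t + G2 (-t) - (2:ℝ) • G2 0) 0 = 0 := by simp [two_smul]
  have h4 := Metric.tendsto_nhds.1 (h3c.tendsto 0) (ε / 2) (half_pos hε)
  obtain ⟨δ, hδ, h5⟩ := Metric.eventually_nhds_iff.1 h4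
  have h6 : ∀ᶠ h : ℝ in 𝓝[≠] 0, |h| < δ := by
    apply mem_nhdsWithin_of_mem_nhds
    simpa [Metric.ball, Real.dist_eq] using Metric.ball_mem_nhds (0:ℝ) hδ
  filter_upwards [h6, self_mem_nhdsWithin] with h hh hh0
  have hneg : ∀ {f f' : ℝ → F}, (∀ t, HasDerivAt f (f' t) t) → ∀ t, HasDerivAt (fun s => f (-s)) (- f' (-t)) t := by
    intro f f' hf t
    exact ((hf (-t)).scomp t (hasDerivAt_neg t)).congr_deriv (by simp)
  have k1 : ∀ t, HasDerivAt (fun t => G1 t - G1 (-t) - (2 * t) • G2 0) (G2 t + G2 (-t) - (2:ℝ) • G2 0) t := fun t => by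
    have := ((h2 t).sub (hneg h2 t)).sub (((hasDerivAt_id t).const_mul 2).smul_const (G2 0))
    exact this.congr_deriv (by simp)
  have k0 : ∀ t, HasDerivAt (fun t => G t + G (-t) - (t^2) • G2 0) (G1 t - G1 (-t) - (2 * t) • G2 0) t := fun t => by
    have := ((h1 t).add (hneg h1 t)).sub ((hasDerivAt_pow 2 t).smul_const (G2 0))
    exact this.congr_deriv (by simp [sub_eq_add_neg])
  have b1 : ∀ t, |t| ≤ |h| → ‖G1 t - G1 (-t) - (2 * t) • G2 0‖ ≤ ε / 2 * |h| := by
    intro t ht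
    have := curve1 k1 (h := t) (C := ε / 2) (fun s hs => by
      have := h5 (y := s) (by rw [Real.dist_eq, sub_zero]; linarith)
      have h31 : G2 0 + G2 (-0) - (2:ℝ) • G2 0 = 0 := h30
      rw [h31, dist_zero_right] at this
      exact this.le)
    simp at this
    refine this.trans (mul_le_mul_of_nonneg_left ht (by positivity))
  have b0 := curve1 k0 b1
  have hpos : 0 < |h| := abs_pos.2 hh0
  have e1 : (h ^ 2)⁻¹ • (G h - (2:ℝ) • G 0 + G (-h)) - G2 0 =
     (h ^ 2)⁻¹ • (G h + G (-h) - (h^2) • G2 0 - (G 0 + G (-0) - ((0:ℝ)^2) • G2 0)) := by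
    have : h ^ 2 ≠ 0 := pow_ne_zero _ hh0
    simp only [smul_sub, smul_add, smul_smul, inv_mul_cancel₀ this]
    simp only [neg_zero, ne_eq, OfNat.ofNat_ne_zero, not_false_eq_true, zero_pow, zero_smul, mul_zero, mul_two, add_smul]; simp only [smul_zero, sub_zero, one_smul]; abel
  rw [dist_eq_norm, e1, norm_smul, norm_inv, norm_pow, Real.norm_eq_abs]
  calc _ ≤ (|h|^2)⁻¹ * (ε / 2 * |h| * |h|) := mul_le_mul_of_nonneg_left b0 (by positivity)
    _ = ε / 2 := by field_simp
    _ < ε := half_lt_self hε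
end curve

lemma GT_sub_norm {v w : Euc d → ℝ} (hv : MemLp v p volume) (hw : MemLp w p volume) :
    eLpNorm (fun x => v x - w x) p volume = ENNReal.ofReal ‖hv.toLp v - hw.toLp w‖ := by
  rw [← MemLp.toLp_sub, Lp.norm_toLp, ENNReal.ofReal_toReal (hv.sub hw).2.ne]; rfl

/-- T2 -/
lemma tr_bound (hp2 : p ≠ ⊤) {v w : Euc d → ℝ} {e : Euc d} (hv : MemLp v p volume) (hw : MemLp w p volume)
    (h : WD Set.univ e v w) (t : ℝ) :
    eLpNorm (fun x => v (x + t • e) - v x) p volume ≤ ‖t‖ₑ * eLpNorm w p volume := by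
  have h1 := curve1 (GT_hasDerivAt hp2 hv hw h) (h := t) (fun s _ => (GT_norm hw e s).le)
  have h0 : GT hv e 0 = hv.toLp v := by simp [GT]
  rw [h0] at h1
  rw [GT_sub_norm (MemLp.tr' hv (t • e)) hv]
  refine (ENNReal.ofReal_le_ofReal h1).trans ?_
  rw [ENNReal.ofReal_mul ENNReal.toReal_nonneg, ENNReal.ofReal_toReal hw.2.ne, mul_comm, Real.enorm_eq_ofReal_abs]

lemma tendsto_toLp_iff {α : Type*} {l : Filter α} {vn : α → Euc d → ℝ} {w : Euc d → ℝ} (hv : ∀ a, MemLp (vn a) p volume)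
    (hw : MemLp w p volume) (h : Tendsto (fun a => (hv a).toLp (vn a)) l (𝓝 (hw.toLp w))) :
    Tendsto (fun a => eLpNorm (fun x => vn a x - w x) p volume) l (𝓝 0) := by
  simp only [fun a => GT_sub_norm (hv a) hw]
  have := tendsto_iff_norm_sub_tendsto_zero.1 h
  simpa using ENNReal.tendsto_ofReal this

/-- T3 -/
lemma tr_tendsto (hp2 : p ≠ ⊤) {v w : Euc d → ℝ} {e : Euc d} (hv : MemLp v p volume) (hw : MemLp w p volume)
    (h : WD Set.univ e v w) :
    Tendsto (fun t : ℝ => eLpNorm (fun x => t⁻¹ * (v (x + t • e) - v x) - w x) p volume) (𝓝[≠] 0) (𝓝 0) := by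
  have h1 := (GT_hasDerivAt hp2 hv hw h 0).tendsto_slope_zero
  have e0 : GT hw e 0 = hw.toLp w := by simp [GT]
  have e1 : GT hv e 0 = hv.toLp v := by simp [GT]
  rw [e0] at h1
  refine tendsto_toLp_iff (fun t => ((MemLp.tr' hv (t • e)).sub hv).const_mul _) hw ?_
  refine h1.congr fun t => ?_
  rw [zero_add, e1]
  rfl

/-- interpolation -/
lemma interp_bound (hp2 : p ≠ ⊤) {v w w2 : Euc d → ℝ} {e : Euc d} (hv : MemLp v p volume) (hw : MemLp w p volume)
    (hw2 : MemLp w2 p volume) (h : WD Set.univ e v w) (h2 : WD Set.univ e w w2) {t : ℝ} (ht : 0 < t) :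
    eLpNorm w p volume ≤ ENNReal.ofReal (2 / t) * eLpNorm v p volume + ENNReal.ofReal t * eLpNorm w2 p volume := by
  have h1 := curve2 (GT_hasDerivAt hp2 hv hw h) (GT_hasDerivAt hp2 hw hw2 h2) t (fun s => (GT_norm hw2 e s).le)
  have h3 : ‖t • GT hw e 0‖ ≤ ‖GT hv e t‖ + ‖GT hv e 0‖ + ‖GT hv e t - GT hv e 0 - t • GT hw e 0‖ := by
    have : t • GT hw e 0 = GT hv e t - GT hv e 0 - (GT hv e t - GT hv e 0 - t • GT hw e 0) := by abel
    calc _ = ‖GT hv e t - GT hv e 0 - (GT hv e t - GT hv e 0 - t • GT hw e 0)‖ := by rw [← this]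
      _ ≤ _ := (norm_sub_le _ _).trans (by gcongr; exact norm_sub_le _ _)
  rw [norm_smul, GT_norm, GT_norm, GT_norm, Real.norm_eq_abs, abs_of_pos ht] at h3
  rw [abs_of_pos ht] at h1
  have h4 : (eLpNorm w p volume).toReal ≤ 2 / t * (eLpNorm v p volume).toReal + t * (eLpNorm w2 p volume).toReal := by
    have := h3.trans (add_le_add le_rfl h1)
    have h5 : 0 < t⁻¹ := by positivity
    have := mul_le_mul_of_nonneg_left this h5.le
    have e1 : t⁻¹ * (t * (eLpNorm w p volume).toReal) = (eLpNorm w p volume).toReal := by field_simp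
    rw [e1] at this
    refine this.trans (le_of_eq ?_)
    field_simp
    ring
  have := ENNReal.ofReal_le_ofReal h4
  rwa [ENNReal.ofReal_toReal hw.2.ne, ENNReal.ofReal_add (by positivity) (by positivity),
    ENNReal.ofReal_mul (by positivity), ENNReal.ofReal_mul (by positivity), ENNReal.ofReal_toReal hv.2.ne,
    ENNReal.ofReal_toReal hw2.2.ne] at this

/-- second differences -/
lemma dd_tendsto (hp2 : p ≠ ⊤) {v w w2 : Euc d → ℝ} {e : Euc d} (hv : MemLp v p volume) (hw : MemLp w p volume)
    (hw2 : MemLp w2 p volume) (h : WD Set.univ e v w) (h2 : WD Set.univ e w w2) :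
    Tendsto (fun t : ℝ => eLpNorm (fun x => (t^2)⁻¹ * dd (t • e) v x - w2 x) p volume) (𝓝[≠] 0) (𝓝 0) := by
  have h1 := curve3 (GT_hasDerivAt hp2 hv hw h) (GT_hasDerivAt hp2 hw hw2 h2) (GT_cont hp2 hw2 e)
  have e0 : GT hw2 e 0 = hw2.toLp w2 := by simp [GT]
  have e1 : GT hv e 0 = hv.toLp v := by simp [GT]
  rw [e0] at h1
  refine tendsto_toLp_iff (fun t => (MemLp.dd hv (t • e)).const_mul _) hw2 ?_
  refine h1.congr fun t => ?_
  rw [e1, GT, GT, ← MemLp.toLp_const_smul, ← MemLp.toLp_sub, ← MemLp.toLp_add, ← MemLp.toLp_const_smul]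
  congr 1
  funext x
  simp [dd, sub_eq_add_neg]

end EllReg5

noncomputable section EllReg6

variable {d : ℕ} {p : ℝ≥0∞} [hp : Fact (1 ≤ p)]

lemma cz_dir (N : ℕ) (hp1 : 1 < p) (hp2 : p ≠ ⊤) : ∃ K : ℝ≥0, ∀ (ι : Type) [Fintype ι] [Nonempty ι],
    Fintype.card ι = N → ∀ (v : Euc d → ℝ) (w : ι → Euc d) (w1 w2 : ι → Euc d → ℝ), MemLp v p volume →
    (∀ i, MemLp (w1 i) p volume) → (∀ i, MemLp (w2 i) p volume) →
    (∀ i, WD Set.univ (w i) v (w1 i)) → (∀ i, WD Set.univ (w i) (w1 i) (w2 i)) → ∀ j,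
    eLpNorm (w2 j) p volume ≤ K * eLpNorm (fun x => ∑ i, w2 i x) p volume := by
  obtain ⟨K, hK⟩ := cz_Lp (d := d) N p hp1 hp2
  refine ⟨K, fun ι _ _ hN v w w1 w2 hv h1 h2 d1 d2 j => ?_⟩
  have hS : MemLp (fun x => ∑ i, w2 i x) p volume := memLp_finsetSum _ fun i _ => h2 i
  let A : ι → ℝ → ℝ≥0∞ := fun i t => eLpNorm (fun x => (t^2)⁻¹ * dd (t • w i) v x - w2 i x) p volume
  have hA : ∀ i, Tendsto (A i) (𝓝[≠] 0) (𝓝 0) := fun i => dd_tendsto hp2 hv (h1 i) (h2 i) (d1 i) (d2 i)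
  have h2t : Tendsto (fun t : ℝ => 2 * t) (𝓝[≠] 0) (𝓝[≠] 0) := by
    refine tendsto_nhdsWithin_iff.2 ⟨?_, ?_⟩
    · have : Tendsto (fun t : ℝ => 2 * t) (𝓝 0) (𝓝 (2 * 0)) := (continuous_const.mul continuous_id).tendsto 0
      rw [mul_zero] at this
      exact this.mono_left nhdsWithin_le_nhds
    · filter_upwards [self_mem_nhdsWithin] with t ht
      simpa using ht
  have hB : Tendsto (fun t => A j (2 * t) + K * (∑ i, A i t + eLpNorm (fun x => ∑ i, w2 i x) p volume)) (𝓝[≠] 0)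
      (𝓝 (0 + K * (∑ i : ι, 0 + eLpNorm (fun x => ∑ i, w2 i x) p volume))) := by
    refine Tendsto.add ((hA j).comp h2t) ?_
    refine ENNReal.Tendsto.const_mul ?_ (Or.inr ENNReal.coe_ne_top)
    exact Tendsto.add (tendsto_finsetSum _ fun i _ => hA i) tendsto_const_nhds
  simp only [Finset.sum_const_zero, zero_add] at hB
  refine ge_of_tendsto hB ?_
  filter_upwards [self_mem_nhdsWithin] with t ht
  have ht0 : t ≠ 0 := ht
  have b1 : eLpNorm (w2 j) p volume ≤ A j (2 * t) + eLpNorm (fun x => ((2*t)^2)⁻¹ * dd ((2*t) • w j) v x) p volume := by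
    have e : w2 j = fun x => ((2*t)^2)⁻¹ * dd ((2*t) • w j) v x - (((2*t)^2)⁻¹ * dd ((2*t) • w j) v x - w2 j x) := by
      funext x; ring
    have hm : MemLp (fun x => ((2*t)^2)⁻¹ * dd ((2*t) • w j) v x) p volume := (MemLp.dd hv _).const_mul _
    conv_lhs => rw [e]
    rw [add_comm]
    exact eLpNorm_sub_le hm.1 (hm.sub (h2 j)).1 hp.out
  have b2 : eLpNorm (fun x => ((2*t)^2)⁻¹ * dd ((2*t) • w j) v x) p volume ≤
      ‖(t^2)⁻¹‖ₑ * (K * eLpNorm (ddS (fun i => t • w i) v) p volume) := by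
    rw [eLpNorm_cmul]
    have := hK ι hN v hv (fun i => t • w i) j
    rw [smul_smul] at this
    refine mul_le_mul' ?_ this
    rw [Real.enorm_eq_ofReal_abs, Real.enorm_eq_ofReal_abs]
    apply ENNReal.ofReal_le_ofReal
    rw [abs_inv, abs_inv, abs_of_nonneg (by positivity), abs_of_nonneg (by positivity)]
    apply inv_anti₀ (by positivity)
    nlinarith [sq_nonneg t]
  have b3 : ‖(t^2)⁻¹‖ₑ * eLpNorm (ddS (fun i => t • w i) v) p volume ≤ ∑ i, A i t + eLpNorm (fun x => ∑ i, w2 i x) p volume := by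
    rw [← eLpNorm_cmul]
    have e : (fun x => (t^2)⁻¹ * ddS (fun i => t • w i) v x) =
        (∑ i, fun x => ((t^2)⁻¹ * dd (t • w i) v x - w2 i x)) + (fun x => ∑ i, w2 i x) := by
      funext x
      simp [ddS, Finset.mul_sum]
    have hm : ∀ i, MemLp (fun x => ((t^2)⁻¹ * dd (t • w i) v x - w2 i x)) p volume := fun i =>
      ((MemLp.dd hv _).const_mul _).sub (h2 i)
    rw [e]
    refine (eLpNorm_add_le (memLp_finsetSum' _ fun i _ => hm i).1 hS.1 hp.out).trans ?_
    gcongr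
    exact eLpNorm_sum_le (fun i _ => (hm i).1) hp.out
  refine b1.trans (add_le_add le_rfl (b2.trans ?_))
  rw [mul_left_comm]
  exact mul_le_mul' le_rfl b3

theorem cz_E (d : ℕ) (hp1 : 1 < p) (hp2 : p ≠ ⊤) : ∃ K : ℝ≥0, ∀ (b : Fin d → Euc d) (v : Euc d → ℝ)
    (vi : Fin d → Euc d → ℝ) (vij : Fin d → Fin d → Euc d → ℝ), MemLp v p volume →
    (∀ i, MemLp (vi i) p volume) → (∀ i j, MemLp (vij i j) p volume) →
    (∀ i, WD Set.univ (b i) v (vi i)) → (∀ i j, WD Set.univ (b j) (vi i) (vij i j)) → ∀ i j,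
    eLpNorm (vij i j) p volume ≤ K * eLpNorm (fun x => ∑ i, vij i i x) p volume := by
  obtain ⟨K, hK⟩ := cz_dir (d := d) (Fintype.card (Fin d × Fin d × Bool)) hp1 hp2
  refine ⟨2 * K * (4 * d), fun b v vi vij hv hvi hvij h1 h2 i j => ?_⟩
  have hv' : LpU p Set.univ v := by simpa [LpU] using hv
  have hvi' : ∀ i, LpU p Set.univ (vi i) := fun i => by simpa [LpU] using hvi i
  have hvij' : ∀ i j, LpU p Set.univ (vij i j) := fun i j => by simpa [LpU] using hvij i j
  have : Nonempty (Fin d × Fin d × Bool) := ⟨(i, j, true)⟩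
  let s : Bool → ℝ := fun c => if c then 1 else -1
  have hs : ∀ c, s c * s c = 1 := by intro c; cases c <;> simp [s]
  have key := hK (Fin d × Fin d × Bool) rfl v (fun q => b q.1 + s q.2.2 • b q.2.1)
    (fun q x => vi q.1 x + s q.2.2 * vi q.2.1 x)
    (fun q x => (vij q.1 q.1 x + s q.2.2 * vij q.2.1 q.1 x) + s q.2.2 * (vij q.1 q.2.1 x + s q.2.2 * vij q.2.1 q.2.1 x))
    hv (fun q => (hvi _).add ((hvi _).const_mul _))
    (fun q => ((hvij _ _).add ((hvij _ _).const_mul _)).add (((hvij _ _).add ((hvij _ _).const_mul _)).const_mul _))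
    (fun q => WD.dadd (p := p) MeasurableSet.univ hv' (hvi' _) ((hvi' _).const_mul _) (h1 _) ((h1 _).dsmul _))
    (fun q => WD.dadd (p := p) MeasurableSet.univ ((hvi' _).add ((hvi' _).const_mul _))
      ((hvij' _ _).add ((hvij' _ _).const_mul _)) (((hvij' _ _).add ((hvij' _ _).const_mul _)).const_mul _)
      (WD.add (p := p) MeasurableSet.univ (hvi' _) (hvij' _ _) ((hvi' _).const_mul _) ((hvij' _ _).const_mul _) (h2 _ _) ((h2 _ _).smul _))
      (WD.dsmul _ (WD.add (p := p) MeasurableSet.univ (hvi' _) (hvij' _ _) ((hvi' _).const_mul _) ((hvij' _ _).const_mul _) (h2 _ _) ((h2 _ _).smul _))))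
  have esum : (fun x => ∑ q : Fin d × Fin d × Bool, ((vij q.1 q.1 x + s q.2.2 * vij q.2.1 q.1 x) + s q.2.2 * (vij q.1 q.2.1 x + s q.2.2 * vij q.2.1 q.2.1 x)))
      = fun x => (4 * d : ℝ) * ∑ i, vij i i x := by
    funext x
    simp only [Fintype.sum_prod_type]
    have : ∀ a c : Fin d, ∑ σ : Bool, ((vij a a x + s σ * vij c a x) + s σ * (vij a c x + s σ * vij c c x))
        = 2 * vij a a x + 2 * vij c c x := fun a c => by simp [s]; ring
    simp only [this, Finset.sum_add_distrib, Finset.sum_const, ← Finset.mul_sum]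
    simp [← Finset.mul_sum]; ring
  rw [esum, eLpNorm_cmul] at key
  have hsym : vij j i =ᵐ[volume] vij i j := by
    have := WD.symm2 (p := p) isOpen_univ (hvi' j) (hvij' i j) (h1 i) (h2 i j) (h1 j)
    simpa using WD.unique (p := p) isOpen_univ (hvij' j i) (hvij' i j) (h2 j i) this
  have kt := key (i, j, true)
  have kf := key (i, j, false)
  simp only [s] at kt kf
  have e : vij i j =ᵐ[volume] (fun x => (1/4:ℝ) * (((vij i i x + (if true = true then (1:ℝ) else -1) * vij j i x) + (if true = true then (1:ℝ) else -1) * (vij i j x + (if true = true then (1:ℝ) else -1) * vij j j x)) -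
       ((vij i i x + (if false = true then (1:ℝ) else -1) * vij j i x) + (if false = true then (1:ℝ) else -1) * (vij i j x + (if false = true then (1:ℝ) else -1) * vij j j x)))) := by
    filter_upwards [hsym] with x hx
    simp [hx]; ring
  rw [eLpNorm_congr_ae e, eLpNorm_cmul]
  have hm : ∀ c : ℝ, MemLp (fun x => ((vij i i x + c * vij j i x) + c * (vij i j x + c * vij j j x))) p volume := fun c =>
    ((hvij _ _).add ((hvij _ _).const_mul _)).add (((hvij _ _).add ((hvij _ _).const_mul _)).const_mul _)
  have h14 : ‖(1/4:ℝ)‖ₑ ≤ 1 := by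
    rw [Real.enorm_eq_ofReal_abs, ← ENNReal.ofReal_one]
    apply ENNReal.ofReal_le_ofReal
    rw [abs_of_pos] <;> norm_num
  have h4d : ‖(4 * d:ℝ)‖ₑ = 4 * d := by
    rw [Real.enorm_eq_ofReal_abs, abs_of_nonneg (by positivity), ENNReal.ofReal_mul (by norm_num)]
    simp
  refine (mul_le_mul' h14 ((eLpNorm_sub_le (hm _).1 (hm _).1 hp.out).trans (add_le_add kt kf))).trans ?_
  rw [one_mul, h4d]
  push_cast
  apply le_of_eq; ring

end EllReg6

noncomputable section EllReg7

variable {d : ℕ} {p : ℝ≥0∞} [hp : Fact (1 ≤ p)]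

/-- half space with inner normal `n` -/
def HS (n : Euc d) : Set (Euc d) := {x | 0 < inner ℝ n x}

lemma HS_open (n : Euc d) : IsOpen (HS n) := isOpen_lt continuous_const (by fun_prop)
lemma HS_meas (n : Euc d) : MeasurableSet (HS n) := (HS_open n).measurableSet

lemma theta_deriv : ∃ M : ℝ, 0 ≤ M ∧ (∀ t, |deriv Real.smoothTransition t| ≤ M) ∧
    (∀ t, t < 0 → deriv Real.smoothTransition t = 0) ∧ (∀ t, 1 < t → deriv Real.smoothTransition t = 0) := by
  have hc : Continuous (deriv Real.smoothTransition) :=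
    (Real.smoothTransition.contDiff (n := 1)).continuous_deriv (by norm_num)
  have h0 : ∀ t, t < 0 → deriv Real.smoothTransition t = 0 := fun t ht => by
    have : Real.smoothTransition =ᶠ[𝓝 t] fun _ => 0 := by
      filter_upwards [eventually_lt_nhds ht] with s hs
      exact Real.smoothTransition.zero_of_nonpos hs.le
    rw [this.deriv_eq]; simp
  have h1 : ∀ t, 1 < t → deriv Real.smoothTransition t = 0 := fun t ht => by
    have : Real.smoothTransition =ᶠ[𝓝 t] fun _ => 1 := by
      filter_upwards [eventually_gt_nhds ht] with s hs
      exact Real.smoothTransition.one_of_one_le hs.le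
    rw [this.deriv_eq]; simp
  obtain ⟨M, hM⟩ := (isCompact_Icc (a := (0:ℝ)) (b := 1)).exists_bound_of_continuousOn hc.continuousOn
  refine ⟨max M 0, le_max_right _ _, fun t => ?_, h0, h1⟩
  by_cases a : t < 0
  · simp [h0 t a]
  by_cases b : 1 < t
  · simp [h1 t b]
  exact (hM t ⟨not_lt.1 a, not_lt.1 b⟩).trans (le_max_left _ _)

lemma CL {n e : Euc d} (hn : ‖n‖ = 1) {u w : Euc d → ℝ} (hu : LpU p (HS n) u) (hw : LpU p (HS n) w)
    (h : WD (HS n) e u w) {φ : Euc d → ℝ} (hφ : ContDiff ℝ 1 φ) (hc : HasCompactSupport φ)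
    (hz : inner ℝ n e = 0 ∨ ∀ x, inner ℝ n x = 0 → φ x = 0) :
    ∫ x in HS n, u x * fderiv ℝ φ x e = - ∫ x in HS n, w x * φ x := by
  obtain ⟨M, hM0, hM, hd0, hd1⟩ := theta_deriv
  let η : ℕ → Euc d → ℝ := fun m x => Real.smoothTransition (((m:ℝ)+1) * inner ℝ n x - 1)
  have hη : ∀ m, ContDiff ℝ 1 (η m) := fun m => by
    apply (Real.smoothTransition.contDiff (n := 1)).comp
    exact (contDiff_const.mul (contDiff_const.inner ℝ contDiff_id)).sub contDiff_const
  have hηd : ∀ m x, fderiv ℝ (η m) x e = deriv Real.smoothTransition (((m:ℝ)+1) * inner ℝ n x - 1) * (((m:ℝ)+1) * inner ℝ n e) := by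
    intro m x
    have h1 : HasFDerivAt (fun x : Euc d => ((m:ℝ)+1) * inner ℝ n x - 1) (((m:ℝ)+1) • innerSL ℝ n) x :=
      (((innerSL ℝ n).hasFDerivAt (x := x)).const_mul ((m:ℝ)+1)).sub_const 1
    have h2 := ((Real.smoothTransition.contDiff (n := 1)).differentiable (by norm_num) (((m:ℝ)+1) * inner ℝ n x - 1)).hasDerivAt.comp_hasFDerivAt x h1
    have h3 : HasFDerivAt (η m) _ x := h2
    rw [h3.fderiv]; simp
  have hT : ∀ m, T1 (HS n) (fun x => η m x * φ x) := by
    intro m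
    refine ⟨(hη m).mul hφ, hc.mul_left, ?_⟩
    have hcl : IsClosed {x : Euc d | 1 ≤ ((m:ℝ)+1) * inner ℝ n x} := isClosed_le continuous_const (by fun_prop)
    refine (closure_minimal ?_ hcl).trans ?_
    · intro x hx
      by_contra hx'
      apply hx
      have : η m x = 0 := Real.smoothTransition.zero_of_nonpos (by simp at hx'; linarith)
      simp [this]
    · intro x hx
      simp only [Set.mem_setOf_eq] at hx
      show 0 < inner ℝ n x
      by_contra h'
      have : ((m:ℝ)+1) * inner ℝ n x ≤ 0 := mul_nonpos_of_nonneg_of_nonpos (by positivity) (not_lt.1 h')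
      linarith
  have h01 : ∀ m x, ‖η m x‖ ≤ 1 := fun m x => by
    rw [Real.norm_eq_abs, abs_of_nonneg (Real.smoothTransition.nonneg _)]
    exact Real.smoothTransition.le_one _
  have hbig : ∀ x ∈ HS n, ∀ᶠ m : ℕ in atTop, 1 < ((m:ℝ)+1) * inner ℝ n x - 1 := by
    intro x hx
    have : Tendsto (fun m : ℕ => ((m:ℝ)+1) * inner ℝ n x - 1) atTop atTop := by
      apply tendsto_atTop_add_const_right
      exact Tendsto.atTop_mul_const hx (tendsto_atTop_add_const_right _ _ tendsto_natCast_atTop_atTop)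
    exact this.eventually_gt_atTop 1
  have key : ∀ (g ψ : Euc d → ℝ), LpU p (HS n) g → CC ψ →
      Tendsto (fun m => ∫ x in HS n, g x * (η m x * ψ x)) atTop (𝓝 (∫ x in HS n, g x * ψ x)) := by
    intro g ψ hg hψ
    apply tendsto_integral_of_dominated_convergence (fun x => ‖g x * ψ x‖)
    · intro m
      exact (int_mul' (HS_meas n) hg (hψ.cmul' (hη m).continuous)).1
    · exact (int_mul' (HS_meas n) hg hψ).norm
    · intro m
      refine ae_of_all _ fun x => ?_
      rw [mul_left_comm, norm_mul]
      exact mul_le_of_le_one_left (norm_nonneg _) (h01 m x)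
    · rw [ae_restrict_iff' (HS_meas n)]
      refine ae_of_all _ fun x hx => ?_
      apply tendsto_const_nhds.congr'
      filter_upwards [hbig x hx] with m hm
      have : η m x = 1 := Real.smoothTransition.one_of_one_le hm.le
      rw [this, one_mul]
  have hφc : CC φ := ⟨hφ.continuous, hc⟩
  have kd : Tendsto (fun m => ∫ x in HS n, u x * (fderiv ℝ (η m) x e * φ x)) atTop (𝓝 0) := by
    rcases hz with hz | hz
    · have : ∀ m x, u x * (fderiv ℝ (η m) x e * φ x) = 0 := fun m x => by rw [hηd, hz]; simp
      simp [this]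
    · obtain ⟨L, hL⟩ := hφ.lipschitzWith_of_hasCompactSupport hc (by norm_num)
      have hbd : ∀ m x, x ∈ HS n → |fderiv ℝ (η m) x e * φ x| ≤ 2 * M * L * |inner ℝ n e| := by
        intro m x hx
        have hx0 : 0 < inner ℝ n x := hx
        by_cases hb : 1 < ((m:ℝ)+1) * inner ℝ n x - 1
        · rw [hηd, hd1 _ hb]; simp; positivity
        have hb' : ((m:ℝ)+1) * inner ℝ n x ≤ 2 := by linarith
        have h1 : |φ x| ≤ L * inner ℝ n x := by
          have := hL.dist_le_mul x (x - (inner ℝ n x : ℝ) • n)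
          rw [hz (x - (inner ℝ n x : ℝ) • n) (by simp [inner_sub_right, inner_smul_right, real_inner_self_eq_norm_sq, hn])] at this
          simpa [dist_eq_norm, norm_smul, hn, abs_of_pos hx0] using this
        rw [hηd, abs_mul, abs_mul, abs_mul, abs_of_pos (by positivity : (0:ℝ) < (m:ℝ)+1)]
        calc |deriv Real.smoothTransition (((m:ℝ)+1) * inner ℝ n x - 1)| * (((m:ℝ)+1) * |inner ℝ n e|) * |φ x|
            ≤ M * (((m:ℝ)+1) * |inner ℝ n e|) * (L * inner ℝ n x) := by gcongr; exact hM _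
          _ = (((m:ℝ)+1) * inner ℝ n x) * (M * L * |inner ℝ n e|) := by ring
          _ ≤ 2 * (M * L * |inner ℝ n e|) := by gcongr
          _ = _ := by ring
      set K := tsupport φ
      have hKm : MeasurableSet K := (isClosed_tsupport φ).measurableSet
      have huK : IntegrableOn u K (volume.restrict (HS n)) := by
        have : IsFiniteMeasure (((volume : Measure (Euc d)).restrict (HS n)).restrict K) := ⟨by
          rw [Measure.restrict_restrict hKm]
          simpa using (measure_mono Set.inter_subset_left).trans_lt hc.measure_lt_top⟩
        exact (hu.restrict K).integrable hp.out
      have := tendsto_integral_of_dominated_convergence (μ := volume.restrict (HS n)) (F := fun m x => u x * (fderiv ℝ (η m) x e * φ x)) (f := fun _ => 0)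
        (K.indicator fun x => (2 * M * L * |inner ℝ n e|) * ‖u x‖) ?_ ?_ ?_ ?_
      · simpa using this
      · intro m
        exact (int_mul' (HS_meas n) hu (hφc.cmul' (((hη m).continuous_fderiv (by norm_num)).clm_apply continuous_const))).1
      · exact IntegrableOn.integrable_indicator (huK.norm.const_mul _) hKm
      · intro m
        rw [ae_restrict_iff' (HS_meas n)]
        refine ae_of_all _ fun x hx => ?_
        by_cases hxK : x ∈ K
        · rw [Set.indicator_of_mem hxK, norm_mul, mul_comm]
          exact mul_le_mul_of_nonneg_right (hbd m x hx) (norm_nonneg _)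
        · rw [Set.indicator_of_notMem hxK, image_eq_zero_of_notMem_tsupport hxK]; simp
      · rw [ae_restrict_iff' (HS_meas n)]
        refine ae_of_all _ fun x hx => ?_
        apply tendsto_const_nhds.congr'
        filter_upwards [hbig x hx] with m hm
        rw [hηd, hd1 _ hm]; simp
  have t1 := (key u _ hu (C1.ccd hφ hc e)).add kd
  have t2 := (key w _ hw hφc).neg
  have e1 : ∀ m, (∫ x in HS n, u x * (η m x * fderiv ℝ φ x e)) + ∫ x in HS n, u x * (fderiv ℝ (η m) x e * φ x)
      = - ∫ x in HS n, w x * (η m x * φ x) := by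
    intro m
    have := h _ (hT m)
    rw [← setInt_eq (HS_meas n) (hT m).z, ← setInt_eq (HS_meas n) ((hT m).zd e)] at this
    rw [← this, ← integral_add (int_mul' (HS_meas n) hu ((C1.ccd hφ hc e).cmul' (hη m).continuous))
      (int_mul' (HS_meas n) hu (hφc.cmul' (((hη m).continuous_fderiv (by norm_num)).clm_apply continuous_const)))]
    congr 1; funext x
    rw [fderiv_mul_apply (hη m) hφ]; ring
  simp only [e1] at t1
  rw [add_zero] at t1
  exact tendsto_nhds_unique t1 t2

lemma ind_int {U : Set (Euc d)} (hU : MeasurableSet U) (u ψ : Euc d → ℝ) :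
    ∫ x, U.indicator u x * ψ x = ∫ x in U, u x * ψ x := by
  rw [← integral_indicator hU]
  congr 1; funext x
  by_cases hx : x ∈ U <;> simp [hx]

lemma CL_tan {n e : Euc d} (hn : ‖n‖ = 1) {u w : Euc d → ℝ} (hu : LpU p (HS n) u) (hw : LpU p (HS n) w)
    (h : WD (HS n) e u w) (he : inner ℝ n e = 0) : WD Set.univ e ((HS n).indicator u) ((HS n).indicator w) := by
  intro φ hφ
  rw [ind_int (HS_meas n), ind_int (HS_meas n)]
  exact CL hn hu hw h hφ.1 hφ.2.1 (Or.inl he)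

/-- reflection -/
def RF (n : Euc d) : Euc d ≃ₗᵢ[ℝ] Euc d := (Submodule.orthogonal (Submodule.span ℝ {n})).reflection

lemma RF_n (n : Euc d) : RF n n = -n := Submodule.reflection_orthogonalComplement_singleton_eq_neg n
lemma RF_e {n e : Euc d} (he : inner ℝ n e = 0) : RF n e = e :=
  Submodule.reflection_mem_subspace_eq_self (Submodule.mem_orthogonal_singleton_iff_inner_right.2 he)
lemma RF_RF (n x : Euc d) : RF n (RF n x) = x := Submodule.reflection_reflection _ x
lemma RF_inner (n x : Euc d) : inner ℝ n (RF n x) = - inner ℝ n x := by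
  have := (RF n).inner_map_map n (RF n x)
  rw [RF_n, RF_RF, inner_neg_left] at this
  exact this.symm
lemma RF_mp (n : Euc d) : MeasurePreserving (RF n) volume volume := (RF n).measurePreserving
lemma RF_int (n : Euc d) (g : Euc d → ℝ) : ∫ x, g (RF n x) = ∫ x, g x :=
  (RF_mp n).integral_comp (RF n).toHomeomorph.measurableEmbedding g

/-- even/odd extension -/
def xt (n : Euc d) (σ : ℝ) (u : Euc d → ℝ) (x : Euc d) : ℝ :=
  (HS n).indicator u x + σ * (HS n).indicator u (RF n x)

lemma ind_memLp {U : Set (Euc d)} (hU : MeasurableSet U) {u : Euc d → ℝ} (hu : LpU p U u) :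
    MemLp (U.indicator u) p volume := (memLp_indicator_iff_restrict hU).2 hu

lemma xt_memLp {n : Euc d} (σ : ℝ) {u : Euc d → ℝ} (hu : LpU p (HS n) u) : MemLp (xt n σ u) p volume :=
  (ind_memLp (HS_meas n) hu).add (((ind_memLp (HS_meas n) hu).comp_measurePreserving (RF_mp n)).const_mul σ)

lemma xt_norm_le {n : Euc d} {σ : ℝ} (hσ : |σ| = 1) {u : Euc d → ℝ} (hu : LpU p (HS n) u) :
    eLpNorm (xt n σ u) p volume ≤ 2 * eLpNorm u p (volume.restrict (HS n)) := by
  have h1 := ind_memLp (HS_meas n) hu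
  have h2 := h1.comp_measurePreserving (RF_mp n)
  refine (eLpNorm_add_le h1.1 (h2.const_mul σ).1 hp.out).trans ?_
  rw [eLpNorm_cmul, Real.enorm_eq_ofReal_abs, hσ, ENNReal.ofReal_one, one_mul,
    eLpNorm_comp_measurePreserving h1.1 (RF_mp n), eLpNorm_indicator_eq_eLpNorm_restrict (HS_meas n), two_mul]

lemma xt_norm_ge {n : Euc d} (σ : ℝ) {u : Euc d → ℝ} :
    eLpNorm u p (volume.restrict (HS n)) ≤ eLpNorm (xt n σ u) p volume := by
  refine le_trans (le_of_eq ?_) (eLpNorm_restrict_le _ _ _ (HS n))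
  apply eLpNorm_congr_ae
  rw [EventuallyEq, ae_restrict_iff' (HS_meas n)]
  refine ae_of_all _ fun x hx => ?_
  have : RF n x ∉ HS n := by
    have hx' : 0 < inner ℝ n x := hx
    simp only [HS, Set.mem_setOf_eq, RF_inner]; linarith
  simp [xt, hx, this]

lemma xt_int {n : Euc d} (σ : ℝ) {u ψ : Euc d → ℝ} (hu : LpU p (HS n) u) (hψ : CC ψ) :
    ∫ x, xt n σ u x * ψ x = ∫ x in HS n, u x * (ψ x + σ * ψ (RF n x)) := by
  have hψR : CC (fun x => ψ (RF n x)) := ⟨hψ.1.comp (RF n).continuous, hψ.2.comp_homeomorph (RF n).toHomeomorph⟩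
  have h1 := ind_memLp (HS_meas n) hu
  have h2 := h1.comp_measurePreserving (RF_mp n)
  have i1 : Integrable (fun x => (HS n).indicator u x * ψ x) :=
    int_mul (p := p) MeasurableSet.univ (by simpa [LpU] using h1) hψ (by simp)
  have i2 : Integrable (fun x => (HS n).indicator u (RF n x) * ψ x) :=
    int_mul (p := p) (u := fun x => (HS n).indicator u (RF n x)) MeasurableSet.univ (by rw [LpU, Measure.restrict_univ]; exact h2) hψ (by simp)
  have e1 : ∀ x, xt n σ u x * ψ x = (HS n).indicator u x * ψ x + σ * ((HS n).indicator u (RF n x) * ψ x) := fun x => by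
    simp only [xt]; ring
  simp only [e1]
  rw [integral_add i1 (i2.const_mul σ), integral_const_mul]
  have e2 : ∫ x, (HS n).indicator u (RF n x) * ψ x = ∫ x, (HS n).indicator u x * ψ (RF n x) := by
    rw [← RF_int n (fun x => (HS n).indicator u x * ψ (RF n x))]
    simp only [RF_RF]
  rw [e2, ind_int (HS_meas n), ind_int (HS_meas n), ← integral_const_mul,
    ← integral_add (int_mul' (HS_meas n) hu hψ) ((int_mul' (HS_meas n) hu hψR).const_mul σ)]
  congr 1; funext x; ring

lemma xt_WD {n e : Euc d} {σ κ τ : ℝ} (hκ : κ * κ = 1) (hτ : τ = σ * κ) (he : RF n e = κ • e) {u w : Euc d → ℝ}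
    (hu : LpU p (HS n) u) (hw : LpU p (HS n) w)
    (h : ∀ φ, T1 Set.univ φ → (∀ x, φ (RF n x) = τ * φ x ∨ τ * τ ≠ 1) → ∫ x in HS n, u x * fderiv ℝ φ x e = - ∫ x in HS n, w x * φ x) :
    WD Set.univ e (xt n σ u) (xt n τ w) := by
  intro φ hφ
  rw [xt_int σ hu (hφ.ccd e), xt_int τ hw hφ.cc]
  have hRc : ContDiff ℝ 1 (fun x => φ (RF n x)) := hφ.1.comp (RF n).contDiff
  have h1 : T1 Set.univ (fun x => φ x + τ * φ (RF n x)) := by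
    refine ⟨hφ.1.add (contDiff_const.mul hRc), hφ.2.1.add (HasCompactSupport.mul_left ?_), Set.subset_univ _⟩
    exact hφ.2.1.comp_homeomorph (RF n).toHomeomorph
  rw [← h _ h1]
  · congr 1; funext x
    congr 1
    have hR : HasFDerivAt (fun x => φ (RF n x)) ((fderiv ℝ φ (RF n x)).comp (RF n).toContinuousLinearEquiv.toContinuousLinearMap) x :=
      (hφ.1.differentiable (by norm_num) (RF n x)).hasFDerivAt.comp x (RF n).toContinuousLinearEquiv.hasFDerivAt
    have := ((hφ.1.differentiable (by norm_num) x).hasFDerivAt.add (hR.const_mul τ))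
    have h2 : HasFDerivAt (fun x => φ x + τ * φ (RF n x)) _ x := this
    rw [h2.fderiv]
    simp [he, hτ]
    rw [← mul_assoc, mul_assoc σ, hκ, mul_one]
  · intro x
    by_cases ht : τ * τ = 1
    · left; rw [RF_RF]
      linear_combination (-φ (RF n x)) * ht
    · exact Or.inr ht

end EllReg7

noncomputable section EllReg8

variable {d : ℕ} {p : ℝ≥0∞} [hp : Fact (1 ≤ p)]

/-- Sobolev bounds of order `m` -/
def SB (p : ℝ≥0∞) (U : Set (Euc d)) : ℕ → ℝ≥0∞ → (Euc d → ℝ) → Prop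
  | 0, K, u => LpU p U u ∧ eLpNorm u p (volume.restrict U) ≤ K
  | m + 1, K, u => (LpU p U u ∧ eLpNorm u p (volume.restrict U) ≤ K) ∧
      ∀ e : Euc d, ‖e‖ ≤ 1 → ∃ v, WD U e u v ∧ SB p U m K v

variable {U : Set (Euc d)}

lemma SB.lp {m : ℕ} {K : ℝ≥0∞} {u : Euc d → ℝ} (h : SB p U m K u) : LpU p U u := by
  cases m with
  | zero => exact h.1
  | succ m => exact h.1.1

lemma SB.nm {m : ℕ} {K : ℝ≥0∞} {u : Euc d → ℝ} (h : SB p U m K u) : eLpNorm u p (volume.restrict U) ≤ K := by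
  cases m with
  | zero => exact h.2
  | succ m => exact h.1.2

lemma SB.monoK {m : ℕ} {K L : ℝ≥0∞} (hKL : K ≤ L) {u : Euc d → ℝ} (h : SB p U m K u) : SB p U m L u := by
  induction m generalizing u with
  | zero => exact ⟨h.1, h.2.trans hKL⟩
  | succ m ih =>
    refine ⟨⟨h.1.1, h.1.2.trans hKL⟩, fun e he => ?_⟩
    obtain ⟨v, h1, h2⟩ := h.2 e he
    exact ⟨v, h1, ih h2⟩

lemma SB.pred {m : ℕ} {K : ℝ≥0∞} {u : Euc d → ℝ} (h : SB p U (m + 1) K u) : SB p U m K u := by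
  induction m generalizing u with
  | zero => exact h.1
  | succ m ih =>
    refine ⟨h.1, fun e he => ?_⟩
    obtain ⟨v, h1, h2⟩ := h.2 e he
    exact ⟨v, h1, ih h2⟩

lemma SB.le {m k : ℕ} (hk : k ≤ m) {K : ℝ≥0∞} {u : Euc d → ℝ} (h : SB p U m K u) : SB p U k K u := by
  induction m, hk using Nat.le_induction with
  | base => exact h
  | succ m hm ih => exact ih h.pred

lemma SB.restrict {V : Set (Euc d)} (hV : V ⊆ U) {m : ℕ} {K : ℝ≥0∞} {u : Euc d → ℝ} (h : SB p U m K u) :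
    SB p V m K u := by
  have hn : ∀ u : Euc d → ℝ, eLpNorm u p (volume.restrict V) ≤ eLpNorm u p (volume.restrict U) := fun u =>
    eLpNorm_mono_measure _ (Measure.restrict_mono hV le_rfl)
  induction m generalizing u with
  | zero => exact ⟨LpU.mono h.1 hV, (hn u).trans h.2⟩
  | succ m ih =>
    refine ⟨⟨LpU.mono h.1.1 hV, (hn u).trans h.1.2⟩, fun e he => ?_⟩
    obtain ⟨v, h1, h2⟩ := h.2 e he
    exact ⟨v, h1.mono hV, ih h2⟩

lemma SB.congr (hU : MeasurableSet U) {m : ℕ} {K : ℝ≥0∞} {u u' : Euc d → ℝ} (h : SB p U m K u)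
    (hu : u =ᵐ[volume.restrict U] u') : SB p U m K u' := by
  have h0 : LpU p U u' ∧ eLpNorm u' p (volume.restrict U) ≤ K :=
    ⟨(memLp_congr_ae hu).1 h.lp, (eLpNorm_congr_ae hu) ▸ h.nm⟩
  cases m with
  | zero => exact h0
  | succ m =>
    refine ⟨h0, fun e he => ?_⟩
    obtain ⟨v, h1, h2⟩ := h.2 e he
    exact ⟨v, h1.congr hU hu (ae_eq_refl v), h2⟩

lemma SB.deriv (hU : IsOpen U) {m : ℕ} {K : ℝ≥0∞} {u v : Euc d → ℝ} {e : Euc d} (h : SB p U (m + 1) K u)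
    (he : ‖e‖ ≤ 1) (hv : LpU p U v) (hd : WD U e u v) : SB p U m K v := by
  obtain ⟨w, h1, h2⟩ := h.2 e he
  exact h2.congr hU.measurableSet (WD.unique hU h2.lp hv h1 hd)

lemma SB.zero (m : ℕ) (K : ℝ≥0∞) : SB p U m K (fun _ => 0) := by
  induction m with
  | zero => exact ⟨MemLp.zero', by simp⟩
  | succ m ih => exact ⟨⟨MemLp.zero', by simp⟩, fun e he => ⟨_, WD.zero U e, ih⟩⟩

lemma SB.add (hU : MeasurableSet U) {m : ℕ} {K L : ℝ≥0∞} {u u' : Euc d → ℝ} (h : SB p U m K u)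
    (h' : SB p U m L u') : SB p U m (K + L) (fun x => u x + u' x) := by
  have h0 : LpU p U (fun x => u x + u' x) ∧ eLpNorm (fun x => u x + u' x) p (volume.restrict U) ≤ K + L :=
    ⟨h.lp.add h'.lp, (eLpNorm_add_le h.lp.1 h'.lp.1 hp.out).trans (add_le_add h.nm h'.nm)⟩
  induction m generalizing u u' with
  | zero => exact h0
  | succ m ih =>
    refine ⟨h0, fun e he => ?_⟩
    obtain ⟨v, h1, h2⟩ := h.2 e he
    obtain ⟨v', h1', h2'⟩ := h'.2 e he
    exact ⟨_, WD.add hU h.lp h2.lp h'.lp h2'.lp h1 h1', ih h2 h2'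
      ⟨h2.lp.add h2'.lp, (eLpNorm_add_le h2.lp.1 h2'.lp.1 hp.out).trans (add_le_add h2.nm h2'.nm)⟩⟩

lemma SB.smul {m : ℕ} {K : ℝ≥0∞} {u : Euc d → ℝ} (c : ℝ) (h : SB p U m K u) :
    SB p U m (‖c‖ₑ * K) (fun x => c * u x) := by
  have h0 : LpU p U (fun x => c * u x) ∧ eLpNorm (fun x => c * u x) p (volume.restrict U) ≤ ‖c‖ₑ * K :=
    ⟨h.lp.const_mul c, by rw [eLpNorm_cmul]; gcongr; exact h.nm⟩
  induction m generalizing u with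
  | zero => exact h0
  | succ m ih =>
    refine ⟨h0, fun e he => ?_⟩
    obtain ⟨v, h1, h2⟩ := h.2 e he
    exact ⟨_, h1.smul c, ih h2 ⟨h2.lp.const_mul c, by rw [eLpNorm_cmul]; gcongr; exact h2.nm⟩⟩

lemma SB.neg {m : ℕ} {K : ℝ≥0∞} {u : Euc d → ℝ} (h : SB p U m K u) : SB p U m K (fun x => - u x) := by
  simpa using h.smul (-1)

lemma SB.sub (hU : MeasurableSet U) {m : ℕ} {K L : ℝ≥0∞} {u u' : Euc d → ℝ} (h : SB p U m K u)
    (h' : SB p U m L u') : SB p U m (K + L) (fun x => u x - u' x) := by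
  simpa [sub_eq_add_neg] using h.add hU h'.neg

lemma SB.sum (hU : MeasurableSet U) {ι : Type*} (s : Finset ι) {m : ℕ} {K : ι → ℝ≥0∞} {u : ι → Euc d → ℝ}
    (h : ∀ i ∈ s, SB p U m (K i) (u i)) : SB p U m (∑ i ∈ s, K i) (fun x => ∑ i ∈ s, u i x) := by
  classical
  induction s using Finset.induction_on with
  | empty => simpa using SB.zero m 0
  | insert a s ha ih =>
    simp only [Finset.sum_insert ha]
    exact (h a (by simp)).add hU (ih fun i hi => h i (by simp [hi]))

lemma SB.of_basis (hU : MeasurableSet U) (b : OrthonormalBasis (Fin d) ℝ (Euc d)) {m : ℕ} {K : ℝ≥0∞} {u : Euc d → ℝ}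
    (h0 : LpU p U u) (h1 : eLpNorm u p (volume.restrict U) ≤ K) (h : ∀ i, ∃ v, WD U (b i) u v ∧ SB p U m K v) :
    SB p U (m + 1) ((d + 1) * K) u := by
  choose v hv hs using h
  refine ⟨⟨h0, h1.trans ?_⟩, fun e he => ?_⟩
  · calc K = 1 * K := (one_mul K).symm
      _ ≤ _ := by gcongr; simp
  refine ⟨fun x => ∑ i, inner ℝ (b i) e * v i x, ?_, ?_⟩
  · have : ∑ i, (inner ℝ (b i) e : ℝ) • b i = e := b.sum_repr' e
    conv => arg 2; rw [← this]
    exact WD.dsum hU Finset.univ h0 (fun i => (hs i).lp.const_mul _) (fun i => (hv i).dsmul _)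
  · refine (SB.sum hU Finset.univ fun i _ => (hs i).smul (inner ℝ (b i) e)).monoK ?_
    calc ∑ i, ‖(inner ℝ (b i) e : ℝ)‖ₑ * K ≤ ∑ i : Fin d, 1 * K := by
          refine Finset.sum_le_sum fun i _ => mul_le_mul' ?_ le_rfl
          rw [← ofReal_norm, ← ENNReal.ofReal_one]
          apply ENNReal.ofReal_le_ofReal
          refine (norm_inner_le_norm _ _).trans ?_
          simpa using he
      _ ≤ _ := by
        simp only [one_mul, Finset.sum_const, Finset.card_univ, Fintype.card_fin, nsmul_eq_mul]
        gcongr; simp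

/-- coefficients bounded with `m` derivatives -/
def CB : ℕ → (Euc d → ℝ) → Prop
  | 0, a => Continuous a ∧ ∃ M : ℝ, ∀ x, |a x| ≤ M
  | m + 1, a => ContDiff ℝ 1 a ∧ (∃ M : ℝ, ∀ x, |a x| ≤ M) ∧ ∀ e : Euc d, CB m (fun x => fderiv ℝ a x e)

lemma CB.cont {m : ℕ} {a : Euc d → ℝ} (h : CB m a) : Continuous a := by
  cases m with
  | zero => exact h.1
  | succ m => exact h.1.continuous
lemma CB.bd {m : ℕ} {a : Euc d → ℝ} (h : CB m a) : ∃ M : ℝ, ∀ x, |a x| ≤ M := by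
  cases m with
  | zero => exact h.2
  | succ m => exact h.2.1
lemma CB.pred {m : ℕ} {a : Euc d → ℝ} (h : CB (m + 1) a) : CB m a := by
  induction m generalizing a with
  | zero => exact ⟨h.cont, h.bd⟩
  | succ m ih => exact ⟨h.1, h.2.1, fun e => ih (h.2.2 e)⟩
lemma CB.le {m k : ℕ} (hk : k ≤ m) {a : Euc d → ℝ} (h : CB m a) : CB k a := by
  induction m, hk using Nat.le_induction with
  | base => exact h
  | succ m hm ih => exact ih h.pred
lemma CB.const (m : ℕ) (c : ℝ) : CB m (fun _ : Euc d => c) := by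
  induction m generalizing c with
  | zero => exact ⟨continuous_const, |c|, fun x => le_rfl⟩
  | succ m ih => exact ⟨contDiff_const, ⟨|c|, fun x => le_rfl⟩, fun e => by simpa using ih 0⟩
lemma CB.add {m : ℕ} {a b : Euc d → ℝ} (h : CB m a) (h' : CB m b) : CB m (fun x => a x + b x) := by
  have hb : ∃ M : ℝ, ∀ x, |a x + b x| ≤ M := by
    obtain ⟨M, hM⟩ := h.bd; obtain ⟨N, hN⟩ := h'.bd
    exact ⟨M + N, fun x => (abs_add_le _ _).trans (add_le_add (hM x) (hN x))⟩
  induction m generalizing a b with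
  | zero => exact ⟨h.cont.add h'.cont, hb⟩
  | succ m ih =>
    refine ⟨h.1.add h'.1, hb, fun e => ?_⟩
    have : (fun x => fderiv ℝ (fun x => a x + b x) x e) = fun x => fderiv ℝ a x e + fderiv ℝ b x e := by
      funext x
      have := fderiv_add (h.1.differentiable (by norm_num) x) (h'.1.differentiable (by norm_num) x)
      have h2 : fderiv ℝ (fun x => a x + b x) x = fderiv ℝ a x + fderiv ℝ b x := this
      rw [h2]; simp
    rw [this]
    refine ih (h.2.2 e) (h'.2.2 e) ?_
    obtain ⟨M, hM⟩ := (h.2.2 e).bd; obtain ⟨N, hN⟩ := (h'.2.2 e).bd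
    exact ⟨M + N, fun x => (abs_add_le _ _).trans (add_le_add (hM x) (hN x))⟩
lemma CB.mul {m : ℕ} {a b : Euc d → ℝ} (h : CB m a) (h' : CB m b) : CB m (fun x => a x * b x) := by
  have hb : ∃ M : ℝ, ∀ x, |a x * b x| ≤ M := by
    obtain ⟨M, hM⟩ := h.bd; obtain ⟨N, hN⟩ := h'.bd
    exact ⟨M * N, fun x => by
      rw [abs_mul]; exact mul_le_mul (hM x) (hN x) (abs_nonneg _) ((abs_nonneg _).trans (hM x))⟩
  induction m generalizing a b with
  | zero => exact ⟨h.cont.mul h'.cont, hb⟩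
  | succ m ih =>
    refine ⟨h.1.mul h'.1, hb, fun e => ?_⟩
    have : (fun x => fderiv ℝ (fun x => a x * b x) x e) = fun x => a x * fderiv ℝ b x e + fderiv ℝ a x e * b x := by
      funext x; exact fderiv_mul_apply h.1 h'.1 x e
    rw [this]
    have bb : ∀ {f g : Euc d → ℝ}, CB m f → CB m g → ∃ M : ℝ, ∀ x, |f x * g x| ≤ M := by
      intro f g hf hg
      obtain ⟨M, hM⟩ := hf.bd; obtain ⟨N, hN⟩ := hg.bd
      exact ⟨M * N, fun x => by
        rw [abs_mul]; exact mul_le_mul (hM x) (hN x) (abs_nonneg _) ((abs_nonneg _).trans (hM x))⟩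
    exact (ih h.pred (h'.2.2 e) (bb h.pred (h'.2.2 e))).add (ih (h.2.2 e) h'.pred (bb (h.2.2 e) h'.pred))
lemma CB.smul {m : ℕ} {a : Euc d → ℝ} (c : ℝ) (h : CB m a) : CB m (fun x => c * a x) := (CB.const m c).mul h
lemma CB.neg {m : ℕ} {a : Euc d → ℝ} (h : CB m a) : CB m (fun x => - a x) := by simpa using h.smul (-1)
lemma CB.sum {ι : Type*} (s : Finset ι) {m : ℕ} {a : ι → Euc d → ℝ} (h : ∀ i ∈ s, CB m (a i)) :
    CB m (fun x => ∑ i ∈ s, a i x) := by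
  classical
  induction s using Finset.induction_on with
  | empty => simpa using CB.const m 0
  | insert i s hi ih =>
    simp only [Finset.sum_insert hi]
    exact (h i (by simp)).add (ih fun j hj => h j (by simp [hj]))
lemma CB.inv {m : ℕ} {a : Euc d → ℝ} {c : ℝ} (hc : 0 < c) (ha : ∀ x, c ≤ a x) (h : CB m a) : CB m (fun x => (a x)⁻¹) := by
  have hb : ∃ M : ℝ, ∀ x, |(a x)⁻¹| ≤ M := ⟨c⁻¹, fun x => by
    rw [abs_of_nonneg (inv_nonneg.2 (hc.le.trans (ha x)))]; exact inv_anti₀ hc (ha x)⟩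
  have hne : ∀ x, a x ≠ 0 := fun x => (hc.trans_le (ha x)).ne'
  induction m with
  | zero => exact ⟨h.cont.inv₀ hne, hb⟩
  | succ m ih =>
    refine ⟨h.1.inv hne, hb, fun e => ?_⟩
    have : (fun x => fderiv ℝ (fun x => (a x)⁻¹) x e) = fun x => (-1) * (((a x)⁻¹ * (a x)⁻¹) * fderiv ℝ a x e) := by
      funext x
      have h1 := (hasDerivAt_inv (hne x)).comp_hasFDerivAt x (h.1.differentiable (by norm_num) x).hasFDerivAt
      have h2 : HasFDerivAt (fun x => (a x)⁻¹) _ x := h1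
      rw [h2.fderiv]; simp; field_simp; exact Or.inl trivial
    rw [this]
    exact (((ih h.pred).mul (ih h.pred)).mul (h.2.2 e)).smul (-1)
lemma CB.comp_lin {m : ℕ} (π : Euc d →L[ℝ] Euc d) {g : Euc d → ℝ} (hg : ContDiff ℝ m g) (hc : HasCompactSupport g) :
    CB m (fun x => g (π x)) := by
  have hb : ∀ {g : Euc d → ℝ}, Continuous g → HasCompactSupport g → ∃ M : ℝ, ∀ x, |g (π x)| ≤ M := by
    intro g h1 h2
    obtain ⟨M, hM⟩ := h2.exists_bound_of_continuous h1
    exact ⟨M, fun x => hM _⟩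
  induction m generalizing g with
  | zero => exact ⟨hg.continuous.comp π.continuous, hb hg.continuous hc⟩
  | succ m ih =>
    have hg1 : ContDiff ℝ 1 g := hg.of_le (by exact_mod_cast Nat.le_add_left 1 m)
    refine ⟨hg1.comp π.contDiff, hb hg.continuous hc, fun e => ?_⟩
    have : (fun x => fderiv ℝ (fun x => g (π x)) x e) = fun x => (fun y => fderiv ℝ g y (π e)) (π x) := by
      funext x
      have h1 := (hg1.differentiable (by norm_num) (π x)).hasFDerivAt.comp x π.hasFDerivAt
      have h2 : HasFDerivAt (fun x => g (π x)) _ x := h1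
      rw [h2.fderiv]; simp
    rw [this]
    exact ih (g := fun y => fderiv ℝ g y (π e)) ((hg.fderiv_right (m := m) (by norm_cast)).clm_apply contDiff_const) (hc.fderiv_apply ℝ _)
lemma CB.of_cc {m : ℕ} {g : Euc d → ℝ} (hg : ContDiff ℝ m g) (hc : HasCompactSupport g) : CB m g := by
  simpa using CB.comp_lin (ContinuousLinearMap.id ℝ _) hg hc

lemma LpU.mulB (hU : MeasurableSet U) {a u : Euc d → ℝ} (ha : Continuous a) {M : ℝ} (hM : ∀ x, |a x| ≤ M) (hu : LpU p U u) :
    LpU p U (fun x => a x * u x) ∧ eLpNorm (fun x => a x * u x) p (volume.restrict U) ≤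
      ENNReal.ofReal M * eLpNorm u p (volume.restrict U) := by
  have h1 : ∀ᵐ x ∂(volume.restrict U), ‖a x * u x‖ ≤ M * ‖u x‖ := ae_of_all _ fun x => by
    rw [norm_mul]; exact mul_le_mul_of_nonneg_right (hM x) (norm_nonneg _)
  exact ⟨hu.of_le_mul (ha.aestronglyMeasurable.mul hu.1) h1, eLpNorm_le_mul_eLpNorm_of_ae_le_mul h1 p⟩

lemma SB.mulCB (p : ℝ≥0∞) [hp : Fact (1 ≤ p)] {m : ℕ} {a : Euc d → ℝ} (ha : CB m a) :
    ∃ C : ℝ≥0, ∀ (U : Set (Euc d)), MeasurableSet U → ∀ u K, SB p U m K u → SB p U m (C * K) (fun x => a x * u x) := by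
  induction m generalizing a with
  | zero =>
    obtain ⟨M, hM⟩ := ha.bd
    refine ⟨M.toNNReal, fun U hU u K h => ⟨(LpU.mulB hU ha.cont hM h.lp).1, (LpU.mulB hU ha.cont hM h.lp).2.trans ?_⟩⟩
    exact mul_le_mul' le_rfl h.nm
  | succ m ih =>
    obtain ⟨M, hM⟩ := ha.bd
    let b := EuclideanSpace.basisFun (Fin d) ℝ
    obtain ⟨C0, hC0⟩ := ih ha.pred
    choose C hC using fun i => ih (ha.2.2 (b i))
    refine ⟨(d + 1) * (M.toNNReal + C0 + ∑ i, C i), fun U hU u K h => ?_⟩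
    have h0 := LpU.mulB hU ha.cont hM h.lp
    set L : ℝ≥0 := M.toNNReal + C0 + ∑ i, C i
    have h1 := SB.of_basis (p := p) (m := m) (K := L * K) hU b h0.1 (h0.2.trans ?_) ?_
    · push_cast; rw [mul_assoc]; exact h1
    · refine mul_le_mul' ?_ h.nm
      rw [ENNReal.ofReal]
      norm_cast
      rw [show L = M.toNNReal + (C0 + ∑ i, C i) from add_assoc _ _ _]; exact le_self_add
    · intro i
      obtain ⟨v, h2, h3⟩ := h.2 (b i) (by simp)
      refine ⟨_, WD.mulC hU h.lp h3.lp ha.1 h2, ?_⟩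
      refine ((hC0 U hU v K h3).add hU (hC i U hU u K h.pred)).monoK ?_
      rw [← add_mul]
      refine mul_le_mul' ?_ le_rfl
      norm_cast
      calc C0 + C i ≤ C0 + ∑ i, C i := by gcongr; exact Finset.single_le_sum (fun _ _ => by positivity) (Finset.mem_univ i)
        _ ≤ M.toNNReal + (C0 + ∑ i, C i) := le_add_self
        _ = L := (add_assoc _ _ _).symm

end EllReg8

noncomputable section EllReg9

variable {d : ℕ} {p : ℝ≥0∞} [hp : Fact (1 ≤ p)]

/-- `W^{2,p}` functions on a half space with zero boundary values -/
structure W2H (p : ℝ≥0∞) (b : OrthonormalBasis (Fin d) ℝ (Euc d)) (i0 : Fin d) (v : Euc d → ℝ)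
    (vi : Fin d → Euc d → ℝ) (vij : Fin d → Fin d → Euc d → ℝ) : Prop where
  l0 : LpU p (HS (b i0)) v
  l1 : ∀ i, LpU p (HS (b i0)) (vi i)
  l2 : ∀ i j, LpU p (HS (b i0)) (vij i j)
  d1 : ∀ i, WD (HS (b i0)) (b i) v (vi i)
  d2 : ∀ i j, WD (HS (b i0)) (b j) (vi i) (vij i j)
  bc : WD Set.univ (b i0) ((HS (b i0)).indicator v) ((HS (b i0)).indicator (vi i0))

variable {b : OrthonormalBasis (Fin d) ℝ (Euc d)} {i0 : Fin d} {v : Euc d → ℝ}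
    {vi : Fin d → Euc d → ℝ} {vij : Fin d → Fin d → Euc d → ℝ}

lemma bnorm (b : OrthonormalBasis (Fin d) ℝ (Euc d)) (i : Fin d) : ‖b i‖ = 1 := b.orthonormal.1 i
lemma binner (b : OrthonormalBasis (Fin d) ℝ (Euc d)) {i j : Fin d} (h : j ≠ i) : inner ℝ (b i) (b j) = 0 :=
  b.orthonormal.2 h.symm

lemma W2H.sym (h : W2H p b i0 v vi vij) (i j : Fin d) :
    vij i j =ᵐ[volume.restrict (HS (b i0))] vij j i :=
  WD.unique (HS_open _) (h.l2 i j) (h.l2 j i) (h.d2 i j)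
    (WD.symm2 (HS_open _) (h.l1 i) (h.l2 j i) (h.d1 j) (h.d2 j i) (h.d1 i))

lemma restrict_univ_memLp {u : Euc d → ℝ} (h : MemLp u p volume) : LpU p Set.univ u := by simpa [LpU] using h

lemma indLp {n : Euc d} {u : Euc d → ℝ} (hu : LpU p (HS n) u) : LpU p Set.univ ((HS n).indicator u) :=
  restrict_univ_memLp (ind_memLp (HS_meas n) hu)

lemma ind_ae {U : Set (Euc d)} (hU : MeasurableSet U) {u v : Euc d → ℝ} (h : u =ᵐ[volume.restrict U] v) :
    U.indicator u =ᵐ[volume.restrict Set.univ] U.indicator v := by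
  rw [Measure.restrict_univ]
  rw [EventuallyEq, ae_restrict_iff' hU] at h
  filter_upwards [h] with x hx
  by_cases hxU : x ∈ U
  · simp [hxU, hx hxU]
  · simp [hxU]

/-- boundary values of tangential derivatives -/
lemma W2H.bct (h : W2H p b i0 v vi vij) {i : Fin d} (hi : i ≠ i0) :
    WD Set.univ (b i0) ((HS (b i0)).indicator (vi i)) ((HS (b i0)).indicator (vij i i0)) := by
  have h3 := CL_tan (bnorm b i0) h.l0 (h.l1 i) (h.d1 i) (binner b hi)
  have h2 := CL_tan (bnorm b i0) (h.l1 i0) (h.l2 i0 i) (h.d2 i0 i) (binner b hi)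
  exact (WD.symm2 isOpen_univ (indLp (h.l1 i)) (indLp (h.l2 i0 i)) h.bc h2 h3).congr MeasurableSet.univ
    (ae_eq_refl _) (ind_ae (HS_meas _) (h.sym i0 i))

/-- sign -/
def sg (i0 i : Fin d) : ℝ := if i = i0 then -1 else 1
lemma sg_sq (i0 i : Fin d) : sg i0 i * sg i0 i = 1 := by unfold sg; split_ifs <;> norm_num
lemma sg_abs (i0 i : Fin d) : |sg i0 i| = 1 := by unfold sg; split_ifs <;> norm_num
lemma RF_sg (b : OrthonormalBasis (Fin d) ℝ (Euc d)) (i0 i : Fin d) : RF (b i0) (b i) = sg i0 i • b i := by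
  unfold sg
  split_ifs with h
  · subst h; rw [RF_n]; simp
  · rw [RF_e (binner b h)]; simp

lemma W2H.e1 (h : W2H p b i0 v vi vij) (i : Fin d) :
    WD Set.univ (b i) (xt (b i0) (-1) v) (xt (b i0) (- sg i0 i) (vi i)) := by
  refine xt_WD (sg_sq i0 i) (by ring) (RF_sg b i0 i) h.l0 (h.l1 i) fun φ hφ _ => ?_
  by_cases hi : i = i0
  · subst hi
    have := h.bc φ hφ
    rwa [ind_int (HS_meas _), ind_int (HS_meas _)] at this
  · exact CL (bnorm b i0) h.l0 (h.l1 i) (h.d1 i) hφ.1 hφ.2.1 (Or.inl (binner b hi))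

lemma W2H.e2 (h : W2H p b i0 v vi vij) (i j : Fin d) :
    WD Set.univ (b j) (xt (b i0) (- sg i0 i) (vi i)) (xt (b i0) (- sg i0 i * sg i0 j) (vij i j)) := by
  refine xt_WD (sg_sq i0 j) rfl (RF_sg b i0 j) (h.l1 i) (h.l2 i j) fun φ hφ hr => ?_
  by_cases hj : j = i0
  · subst hj
    by_cases hi : i = j
    · subst hi
      refine CL (bnorm b i) (h.l1 i) (h.l2 i i) (h.d2 i i) hφ.1 hφ.2.1 (Or.inr fun x hx => ?_)
      have := hr x
      rw [RF_e hx] at this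
      simp [sg] at this
      linarith
    · have := h.bct hi φ hφ
      rwa [ind_int (HS_meas _), ind_int (HS_meas _)] at this
  · exact CL (bnorm b i0) (h.l1 i) (h.l2 i j) (h.d2 i j) hφ.1 hφ.2.1 (Or.inl (binner b hj))

theorem cz_H (d : ℕ) (hp1 : 1 < p) (hp2 : p ≠ ⊤) : ∃ K : ℝ≥0, ∀ (b : OrthonormalBasis (Fin d) ℝ (Euc d)) (i0 : Fin d) (v : Euc d → ℝ)
    (vi : Fin d → Euc d → ℝ) (vij : Fin d → Fin d → Euc d → ℝ), W2H p b i0 v vi vij → ∀ i j,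
    eLpNorm (vij i j) p (volume.restrict (HS (b i0))) ≤ K * eLpNorm (fun x => ∑ i, vij i i x) p (volume.restrict (HS (b i0))) := by
  obtain ⟨K, hK⟩ := cz_E (p := p) d hp1 hp2
  refine ⟨K * 2, fun b i0 v vi vij h i j => ?_⟩
  have h1 := hK b _ _ _ (xt_memLp _ h.l0) (fun i => xt_memLp _ (h.l1 i)) (fun i j => xt_memLp _ (h.l2 i j)) h.e1 h.e2 i j
  refine (xt_norm_ge (- sg i0 i * sg i0 j)).trans (h1.trans ?_)
  have h2 : (fun x => ∑ i, xt (b i0) (- sg i0 i * sg i0 i) (vij i i) x) = xt (b i0) (-1) (fun x => ∑ i, vij i i x) := by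
    funext x
    simp only [neg_mul, sg_sq, xt, one_mul]
    rw [Finset.sum_add_distrib, Finset.sum_neg_distrib]
    congr 1
    · by_cases hx : x ∈ HS (b i0) <;> simp [hx]
    · congr 1
      by_cases hx : RF (b i0) x ∈ HS (b i0) <;> simp [hx]
  rw [h2]
  push_cast
  rw [mul_assoc]
  gcongr
  exact xt_norm_le (by simp) (memLp_finsetSum _ fun i _ => h.l2 i i)

lemma W2H.interp (hp2 : p ≠ ⊤) (h : W2H p b i0 v vi vij) (i : Fin d) {t : ℝ} (ht : 0 < t) :
    eLpNorm (vi i) p (volume.restrict (HS (b i0))) ≤ ENNReal.ofReal (2 / t) * (2 * eLpNorm v p (volume.restrict (HS (b i0))))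
      + ENNReal.ofReal t * (2 * eLpNorm (vij i i) p (volume.restrict (HS (b i0)))) := by
  refine (xt_norm_ge (- sg i0 i)).trans ((interp_bound hp2 (xt_memLp _ h.l0) (xt_memLp _ (h.l1 i)) (xt_memLp _ (h.l2 i i)) (h.e1 i) (h.e2 i i) ht).trans ?_)
  gcongr
  · exact xt_norm_le (by simp) h.l0
  · exact xt_norm_le (by rw [neg_mul, sg_sq]; simp) (h.l2 i i)

lemma W2H.sub {v' : Euc d → ℝ} {vi' : Fin d → Euc d → ℝ} {vij' : Fin d → Fin d → Euc d → ℝ}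
    (h : W2H p b i0 v vi vij) (h' : W2H p b i0 v' vi' vij') :
    W2H p b i0 (fun x => v x - v' x) (fun i x => vi i x - vi' i x) (fun i j x => vij i j x - vij' i j x) := by
  have ws : ∀ {U : Set (Euc d)} (hU : MeasurableSet U) {e : Euc d} {u v u' v' : Euc d → ℝ}
    (hu : LpU p U u) (hv : LpU p U v) (hu' : LpU p U u') (hv' : LpU p U v')
    (h : WD U e u v) (h' : WD U e u' v'), WD U e (fun x => u x - u' x) (fun x => v x - v' x) := by
    intro U hU e u v u' v' hu hv hu' hv' h h'
    have := WD.add hU hu hv (hu'.const_mul (-1)) (hv'.const_mul (-1)) h (h'.smul (-1))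
    simpa [sub_eq_add_neg] using this
  refine ⟨h.l0.sub h'.l0, fun i => (h.l1 i).sub (h'.l1 i), fun i j => (h.l2 i j).sub (h'.l2 i j),
    fun i => ws (HS_meas _) h.l0 (h.l1 i) h'.l0 (h'.l1 i) (h.d1 i) (h'.d1 i),
    fun i j => ws (HS_meas _) (h.l1 i) (h.l2 i j) (h'.l1 i) (h'.l2 i j) (h.d2 i j) (h'.d2 i j), ?_⟩
  have := ws MeasurableSet.univ (indLp h.l0) (indLp (h.l1 i0)) (indLp h'.l0) (indLp (h'.l1 i0)) h.bc h'.bc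
  convert this using 1 <;> rw [← Set.indicator_sub]

lemma W2H.smul (c : ℝ) (h : W2H p b i0 v vi vij) :
    W2H p b i0 (fun x => c * v x) (fun i x => c * vi i x) (fun i j x => c * vij i j x) := by
  refine ⟨h.l0.const_mul c, fun i => (h.l1 i).const_mul c, fun i j => (h.l2 i j).const_mul c,
    fun i => (h.d1 i).smul c, fun i j => (h.d2 i j).smul c, ?_⟩
  have := h.bc.smul c
  convert this using 1 <;> exact funext fun x => Set.indicator_const_mul _ _ _ x

lemma HS_tr {n e : Euc d} (he : inner ℝ n e = 0) (x : Euc d) : x + e ∈ HS n ↔ x ∈ HS n := by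
  simp [HS, inner_add_right, he]

lemma HS_mp {n e : Euc d} (he : inner ℝ n e = 0) :
    MeasurePreserving (fun x => x + e) (volume.restrict (HS n)) (volume.restrict (HS n)) := by
  have := (mp_add e).restrict_preimage (HS_meas n)
  rwa [show (fun x => x + e) ⁻¹' HS n = HS n from Set.ext fun x => HS_tr he x] at this

lemma LpU.tr {n e : Euc d} (he : inner ℝ n e = 0) {u : Euc d → ℝ} (hu : LpU p (HS n) u) :
    LpU p (HS n) (fun x => u (x + e)) := hu.comp_measurePreserving (HS_mp he)

lemma ind_tr {n e : Euc d} (he : inner ℝ n e = 0) (u : Euc d → ℝ) (x : Euc d) :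
    (HS n).indicator u (x + e) = (HS n).indicator (fun x => u (x + e)) x := by
  by_cases hx : x ∈ HS n
  · simp [hx, (HS_tr he x).2 hx]
  · simp [hx, mt (HS_tr he x).1 hx]

lemma W2H.tr (h : W2H p b i0 v vi vij) {e : Euc d} (he : inner ℝ (b i0) e = 0) :
    W2H p b i0 (fun x => v (x + e)) (fun i x => vi i (x + e)) (fun i j x => vij i j (x + e)) := by
  refine ⟨h.l0.tr he, fun i => (h.l1 i).tr he, fun i j => (h.l2 i j).tr he,
    fun i => (h.d1 i).tr e fun x hx => (HS_tr he x).2 hx, fun i j => (h.d2 i j).tr e fun x hx => (HS_tr he x).2 hx, ?_⟩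
  have := h.bc.tr e fun x hx => Set.mem_univ _
  simpa only [ind_tr he] using this

lemma ind_norm {U : Set (Euc d)} (hU : MeasurableSet U) (u : Euc d → ℝ) :
    eLpNorm (U.indicator u) p (volume : Measure (Euc d)) = eLpNorm u p (volume.restrict U) :=
  eLpNorm_indicator_eq_eLpNorm_restrict hU

lemma W2H.lim {vn : ℕ → Euc d → ℝ} {vin : ℕ → Fin d → Euc d → ℝ} {vijn : ℕ → Fin d → Fin d → Euc d → ℝ}
    (h : ∀ m, W2H p b i0 (vn m) (vin m) (vijn m)) (h0 : LpU p (HS (b i0)) v) (h1 : ∀ i, LpU p (HS (b i0)) (vi i))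
    (h2 : ∀ i j, LpU p (HS (b i0)) (vij i j))
    (t0 : Tendsto (fun m => eLpNorm (fun x => vn m x - v x) p (volume.restrict (HS (b i0)))) atTop (𝓝 0))
    (t1 : ∀ i, Tendsto (fun m => eLpNorm (fun x => vin m i x - vi i x) p (volume.restrict (HS (b i0)))) atTop (𝓝 0))
    (t2 : ∀ i j, Tendsto (fun m => eLpNorm (fun x => vijn m i j x - vij i j x) p (volume.restrict (HS (b i0)))) atTop (𝓝 0)) :
    W2H p b i0 v vi vij := by
  refine ⟨h0, h1, h2, fun i => WD.lim (HS_meas _) (fun m => (h m).l0) h0 (fun m => (h m).l1 i) (h1 i) t0 (t1 i) fun m => (h m).d1 i,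
    fun i j => WD.lim (HS_meas _) (fun m => (h m).l1 i) (h1 i) (fun m => (h m).l2 i j) (h2 i j) (t1 i) (t2 i j) fun m => (h m).d2 i j, ?_⟩
  refine WD.lim MeasurableSet.univ (fun m => indLp (h m).l0) (indLp h0) (fun m => indLp ((h m).l1 i0)) (indLp (h1 i0)) ?_ ?_ fun m => (h m).bc
  · refine t0.congr fun m => ?_
    rw [← ind_norm (HS_meas _), Measure.restrict_univ]
    congr 1; funext x; by_cases hx : x ∈ HS (b i0) <;> simp [hx]
  · refine (t1 i0).congr fun m => ?_
    rw [← ind_norm (HS_meas _), Measure.restrict_univ]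
    congr 1; funext x; by_cases hx : x ∈ HS (b i0) <;> simp [hx]

lemma tr_tendsto_H (hp2 : p ≠ ⊤) {n e : Euc d} (hn : ‖n‖ = 1) (he : inner ℝ n e = 0) {u w : Euc d → ℝ} (hu : LpU p (HS n) u)
    (hw : LpU p (HS n) w) (h : WD (HS n) e u w) :
    Tendsto (fun t : ℝ => eLpNorm (fun x => t⁻¹ * (u (x + t • e) - u x) - w x) p (volume.restrict (HS n))) (𝓝[≠] 0) (𝓝 0) := by
  have h1 := tr_tendsto hp2 (ind_memLp (HS_meas n) hu) (ind_memLp (HS_meas n) hw) (CL_tan hn hu hw h he)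
  refine h1.congr fun t => ?_
  rw [← ind_norm (HS_meas n)]
  congr 1; funext x
  rw [ind_tr (by rw [inner_smul_right, he, mul_zero])]
  by_cases hx : x ∈ HS n <;> simp [hx]

lemma tr_cont_H (hp2 : p ≠ ⊤) {n e : Euc d} (he : inner ℝ n e = 0) {u : Euc d → ℝ} (hu : LpU p (HS n) u) :
    Tendsto (fun t : ℝ => eLpNorm (fun x => u (x + t • e) - u x) p (volume.restrict (HS n))) (𝓝 0) (𝓝 0) := by
  have h1 := (GT_cont hp2 (ind_memLp (HS_meas n) hu) e).tendsto 0
  have e0 : GT (ind_memLp (HS_meas n) hu) e 0 = (ind_memLp (HS_meas n) hu).toLp _ := by simp [GT]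
  rw [e0] at h1
  refine (tendsto_toLp_iff (fun t : ℝ => MemLp.tr' (ind_memLp (HS_meas n) hu) (t • e)) _ h1).congr fun t => ?_
  rw [← ind_norm (HS_meas n)]
  congr 1; funext x
  rw [ind_tr (by rw [inner_smul_right, he, mul_zero])]
  by_cases hx : x ∈ HS n <;> simp [hx]

/-- dominated convergence for multipliers -/
lemma mul_tendsto (hp2 : p ≠ ⊤) {μ : Measure (Euc d)} {c : ℕ → Euc d → ℝ} {g : Euc d → ℝ} (hg : MemLp g p μ)
    (hc : ∀ m, AEStronglyMeasurable (c m) μ) {M : ℝ} (hM : ∀ m x, |c m x| ≤ M) (h0 : ∀ x, Tendsto (fun m => c m x) atTop (𝓝 0)) :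
    Tendsto (fun m => eLpNorm (fun x => c m x * g x) p μ) atTop (𝓝 0) := by
  have hp0 : p ≠ 0 := (zero_lt_one.trans_le hp.out).ne'
  have hpr : 0 < p.toReal := ENNReal.toReal_pos hp0 hp2
  have h1 : Tendsto (fun m => ∫⁻ x, ‖c m x * g x‖ₑ ^ p.toReal ∂μ) atTop (𝓝 (∫⁻ x, 0 ∂μ)) := by
    refine tendsto_lintegral_of_dominated_convergence' (fun x => (ENNReal.ofReal M * ‖g x‖ₑ) ^ p.toReal)
      (fun m => ((hc m).mul hg.1).enorm.pow_const _) (fun m => ae_of_all _ fun x => ?_) ?_ (ae_of_all _ fun x => ?_)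
    · simp only [enorm_mul]
      gcongr
      rw [Real.enorm_eq_ofReal_abs]
      exact ENNReal.ofReal_le_ofReal (hM m x)
    · simp only [ENNReal.mul_rpow_of_nonneg _ _ hpr.le]
      rw [lintegral_const_mul' _ _ (by simp)]
      refine ENNReal.mul_ne_top (by simp) ?_
      have := lintegral_rpow_enorm_lt_top_of_eLpNorm_lt_top hp0 hp2 hg.2
      exact this.ne
    · have h2 : Tendsto (fun m => ‖c m x * g x‖ₑ) atTop (𝓝 0) := by
        have := ((h0 x).mul_const (g x)).enorm
        simpa using this
      have := (ENNReal.continuous_rpow_const (y := p.toReal)).tendsto 0 |>.comp h2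
      simpa [Function.comp_def, ENNReal.zero_rpow_of_pos hpr] using this
  have h2 : ∀ m, eLpNorm (fun x => c m x * g x) p μ = (∫⁻ x, ‖c m x * g x‖ₑ ^ p.toReal ∂μ) ^ (1 / p.toReal) := fun m =>
    eLpNorm_eq_lintegral_rpow_enorm_toReal hp0 hp2
  simp only [h2]
  have := (ENNReal.continuous_rpow_const (y := 1 / p.toReal)).tendsto _ |>.comp h1
  rw [lintegral_zero, ENNReal.zero_rpow_of_pos (by positivity)] at this
  exact this

end EllReg9

noncomputable section EllReg10

variable {d : ℕ} {p : ℝ≥0∞} [hp : Fact (1 ≤ p)]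

/-- `L^p` convergence of a sequence -/
def LpT (p : ℝ≥0∞) (μ : Measure (Euc d)) (un : ℕ → Euc d → ℝ) (u : Euc d → ℝ) : Prop :=
  Tendsto (fun m => eLpNorm (fun x => un m x - u x) p μ) atTop (𝓝 0)

section
variable {μ : Measure (Euc d)} {un un' : ℕ → Euc d → ℝ} {u u' : Euc d → ℝ}

lemma LpT.add (h : LpT p μ un u) (h' : LpT p μ un' u') (m1 : ∀ m, MemLp (un m) p μ) (m2 : MemLp u p μ)
    (m3 : ∀ m, MemLp (un' m) p μ) (m4 : MemLp u' p μ) : LpT p μ (fun m x => un m x + un' m x) (fun x => u x + u' x) := by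
  have h3 := Tendsto.add (show Tendsto _ _ _ from h) (show Tendsto _ _ _ from h')
  rw [add_zero] at h3
  refine tendsto_of_tendsto_of_tendsto_of_le_of_le tendsto_const_nhds h3 (fun _ => zero_le) fun m => ?_
  refine le_trans (le_of_eq ?_) (eLpNorm_add_le ((m1 m).sub m2).1 ((m3 m).sub m4).1 hp.out)
  congr 1; funext x; simp; ring

lemma LpT.cmulB {c : Euc d → ℝ} {M : ℝ} (hM : ∀ x, |c x| ≤ M) (h : LpT p μ un u) :
    LpT p μ (fun m x => c x * un m x) (fun x => c x * u x) := by
  have h3 := ENNReal.Tendsto.const_mul (a := ENNReal.ofReal M) (show Tendsto _ _ _ from h) (Or.inr (by simp))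
  rw [mul_zero] at h3
  refine tendsto_of_tendsto_of_tendsto_of_le_of_le tendsto_const_nhds h3 (fun _ => zero_le) fun m => ?_
  refine eLpNorm_le_mul_eLpNorm_of_ae_le_mul (ae_of_all _ fun x => ?_) p
  rw [← mul_sub, norm_mul]
  exact mul_le_mul_of_nonneg_right (hM x) (norm_nonneg _)

lemma LpT.sub (h : LpT p μ un u) (h' : LpT p μ un' u') (m1 : ∀ m, MemLp (un m) p μ) (m2 : MemLp u p μ)
    (m3 : ∀ m, MemLp (un' m) p μ) (m4 : MemLp u' p μ) : LpT p μ (fun m x => un m x - un' m x) (fun x => u x - u' x) := by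
  have := h.add (h'.cmulB (c := fun _ => -1) (M := 1) (by simp)) m1 m2 (fun m => (m3 m).const_mul (-1)) (m4.const_mul (-1))
  simpa [sub_eq_add_neg] using this

lemma LpT.sum {ι : Type*} (s : Finset ι) {un : ι → ℕ → Euc d → ℝ} {u : ι → Euc d → ℝ} (h : ∀ i, LpT p μ (un i) (u i))
    (m1 : ∀ i m, MemLp (un i m) p μ) (m2 : ∀ i, MemLp (u i) p μ) : LpT p μ (fun m x => ∑ i ∈ s, un i m x) (fun x => ∑ i ∈ s, u i x) := by
  classical
  induction s using Finset.induction_on with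
  | empty => simp [LpT]
  | insert a s ha ih =>
    simp only [Finset.sum_insert ha]
    exact (h a).add ih (m1 a) (m2 a) (fun m => memLp_finsetSum _ fun i _ => m1 i m) (memLp_finsetSum _ fun i _ => m2 i)

lemma LpT.unique (h : LpT p μ un u) (h' : LpT p μ un' u') (m1 : ∀ m, MemLp (un m) p μ) (m2 : MemLp u p μ)
    (m3 : ∀ m, MemLp (un' m) p μ) (m4 : MemLp u' p μ) (he : ∀ m, un m =ᵐ[μ] un' m) : u =ᵐ[μ] u' := by
  have h3 := h.sub h' m1 m2 m3 m4
  have h4 : ∀ m, eLpNorm (fun x => (un m x - un' m x) - (u x - u' x)) p μ = eLpNorm (fun x => u x - u' x) p μ := fun m => by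
    rw [← eLpNorm_neg]
    apply eLpNorm_congr_ae
    filter_upwards [he m] with x hx
    simp [hx]
  have h5 : eLpNorm (fun x => u x - u' x) p μ = 0 := by
    have : Tendsto (fun m : ℕ => eLpNorm (fun x => u x - u' x) p μ) atTop (𝓝 0) := Tendsto.congr h4 h3
    exact tendsto_nhds_unique tendsto_const_nhds this
  replace h5 := (eLpNorm_eq_zero_iff (m2.sub m4).1 (zero_lt_one.trans_le hp.out).ne').1 h5
  filter_upwards [h5] with x hx
  simpa [sub_eq_zero] using hx

lemma LpT.exists (m1 : ∀ m, MemLp (un m) p μ) {β : ℕ → ℝ≥0∞} (hβ : Tendsto β atTop (𝓝 0))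
    (h : ∀ m n, eLpNorm (fun x => un m x - un n x) p μ ≤ β m + β n) : ∃ w, MemLp w p μ ∧ LpT p μ un w := by
  have hc : CauchySeq (fun m => (m1 m).toLp (un m)) := by
    rw [EMetric.cauchySeq_iff]
    intro ε hε
    obtain ⟨N, hN⟩ := (ENNReal.tendsto_atTop_zero.1 hβ) (min ε 1 / 3) (ENNReal.div_pos (by simp [hε.ne']) (by norm_num))
    refine ⟨N, fun m hm n hn => ?_⟩
    rw [Lp.edist_toLp_toLp]
    refine lt_of_le_of_lt ((h m n).trans (add_le_add (hN m hm) (hN n hn))) ?_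
    refine lt_of_lt_of_le ?_ (min_le_left ε 1)
    have h1 : min ε 1 ≠ ⊤ := ne_top_of_le_ne_top ENNReal.one_ne_top (min_le_right _ _)
    have h2 : 0 < min ε 1 := by simp [hε]
    have h3 : min ε 1 / 3 ≠ ⊤ := ENNReal.div_ne_top h1 (by norm_num)
    rw [← ENNReal.toReal_lt_toReal (ENNReal.add_ne_top.2 ⟨h3, h3⟩) h1, ENNReal.toReal_add h3 h3, ENNReal.toReal_div]
    have := ENNReal.toReal_pos h2.ne' h1
    norm_num
    linarith
  obtain ⟨w, hw⟩ := cauchySeq_tendsto_of_complete hc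
  refine ⟨w, Lp.memLp w, ?_⟩
  rw [tendsto_iff_edist_tendsto_0] at hw
  refine hw.congr fun m => ?_
  conv_lhs => rw [← Lp.toLp_coeFn w (Lp.memLp w)]
  rw [Lp.edist_toLp_toLp]; rfl

lemma LpT.congr' (h : LpT p μ un u) (h1 : ∀ m x, un m x = un' m x) (h2 : ∀ x, u x = u' x) : LpT p μ un' u' := by
  have e1 : un = un' := funext fun m => funext fun x => h1 m x
  have e2 : u = u' := funext h2
  rwa [← e1, ← e2]
end

lemma absorb {X Y : ℝ≥0∞} (hX : X ≠ ⊤) (h : X ≤ 2⁻¹ * X + Y) : X ≤ 2 * Y := by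
  by_cases hY : Y = ⊤
  · simp [hY]
  lift X to ℝ≥0 using hX
  lift Y to ℝ≥0 using hY
  have : (2⁻¹ : ℝ≥0∞) = ((2⁻¹ : ℝ≥0) : ℝ≥0∞) := by simp
  rw [this] at h
  norm_cast at h ⊢
  rw [← NNReal.coe_le_coe] at h ⊢
  push_cast at h ⊢
  linarith

/-- perturbed Laplace equation on the half space -/
def Eqn (b : OrthonormalBasis (Fin d) ℝ (Euc d)) (i0 : Fin d) (a : Fin d → Fin d → Euc d → ℝ) (q : Fin d → Euc d → ℝ)
    (vi : Fin d → Euc d → ℝ) (vij : Fin d → Fin d → Euc d → ℝ) (F : Euc d → ℝ) : Prop :=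
  F =ᵐ[volume.restrict (HS (b i0))] fun x => (∑ j, vij j j x) + (∑ i, ∑ j, a i j x * vij i j x) + ∑ i, q i x * vi i x

lemma norm_sum_le' {ι : Type*} (s : Finset ι) {μ : Measure (Euc d)} {f : ι → Euc d → ℝ} (h : ∀ i ∈ s, MemLp (f i) p μ) :
    eLpNorm (fun x => ∑ i ∈ s, f i x) p μ ≤ ∑ i ∈ s, eLpNorm (f i) p μ := by
  refine le_trans (le_of_eq ?_) (eLpNorm_sum_le (fun i hi => (h i hi).1) hp.out)
  congr 1; funext x; simp

theorem est0 (d : ℕ) (hp1 : 1 < p) (hp2 : p ≠ ⊤) : ∃ ε : ℝ, 0 < ε ∧ ε ≤ 1/2 ∧ ∀ M : ℝ, ∃ C : ℝ≥0,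
    ∀ (b : OrthonormalBasis (Fin d) ℝ (Euc d)) (i0 : Fin d) (a : Fin d → Fin d → Euc d → ℝ) (q : Fin d → Euc d → ℝ),
    (∀ i j, Continuous (a i j)) → (∀ i, Continuous (q i)) → (∀ i j x, |a i j x| ≤ ε) → (∀ i x, |q i x| ≤ M) → ∀ v vi vij F,
    W2H p b i0 v vi vij → Eqn b i0 a q vi vij F → LpU p (HS (b i0)) F → ∀ i j,
    eLpNorm (vij i j) p (volume.restrict (HS (b i0))) ≤ C * (eLpNorm F p (volume.restrict (HS (b i0))) +
      ∑ i, eLpNorm (vi i) p (volume.restrict (HS (b i0)))) := by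
  obtain ⟨K, hK⟩ := cz_H (p := p) d hp1 hp2
  have hD : (0:ℝ) < 2 * ((d * d : ℝ) * K + 1) := by positivity
  refine ⟨1 / (2 * ((d * d : ℝ) * K + 1)), by positivity, ?_, fun M => ⟨2 * ((d * d) * K * (1 + M.toNNReal)), ?_⟩⟩
  · apply one_div_le_one_div_of_le (by norm_num)
    have : (0:ℝ) ≤ (d * d : ℝ) * K := by positivity
    linarith
  intro b i0 a q ca cq ha hq v vi vij F hW hE hF i j
  set μ := volume.restrict (HS (b i0))
  set ε := 1 / (2 * ((d * d : ℝ) * K + 1)) with hε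
  set X := ∑ i, ∑ j, eLpNorm (vij i j) p μ with hX
  set Y := ∑ i, eLpNorm (vi i) p μ
  have hXt : X ≠ ⊤ := ENNReal.sum_ne_top.2 fun i _ => ENNReal.sum_ne_top.2 fun j _ => (hW.l2 i j).2.ne
  have ma : ∀ i j, _ := fun i j => LpU.mulB (HS_meas _) (ca i j) (ha i j) (hW.l2 i j)
  have mq : ∀ i, _ := fun i => LpU.mulB (HS_meas _) (cq i) (hq i) (hW.l1 i)
  have h1 : eLpNorm (fun x => ∑ j, vij j j x) p μ ≤ eLpNorm F p μ + ENNReal.ofReal ε * X + ENNReal.ofReal M * Y := by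
    have e : (fun x => ∑ j, vij j j x) =ᵐ[μ] fun x => (F x - ∑ i, ∑ j, a i j x * vij i j x) - ∑ i, q i x * vi i x := by
      filter_upwards [hE] with x hx
      rw [hx]; ring
    rw [eLpNorm_congr_ae e]
    have m2 : MemLp (fun x => ∑ i, ∑ j, a i j x * vij i j x) p μ := memLp_finsetSum _ fun i _ => memLp_finsetSum _ fun j _ => (ma i j).1
    have m3 : MemLp (fun x => ∑ i, q i x * vi i x) p μ := memLp_finsetSum _ fun i _ => (mq i).1
    refine (eLpNorm_sub_le (hF.sub m2).1 m3.1 hp.out).trans (add_le_add ((eLpNorm_sub_le hF.1 m2.1 hp.out).trans (add_le_add le_rfl ?_)) ?_)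
    · refine (norm_sum_le' _ fun i _ => memLp_finsetSum _ fun j _ => (ma i j).1).trans ?_
      rw [hX, Finset.mul_sum]
      refine Finset.sum_le_sum fun i _ => (norm_sum_le' _ fun j _ => (ma i j).1).trans ?_
      rw [Finset.mul_sum]
      exact Finset.sum_le_sum fun j _ => (ma i j).2
    · refine (norm_sum_le' _ fun i _ => (mq i).1).trans ?_
      rw [Finset.mul_sum]
      exact Finset.sum_le_sum fun i _ => (mq i).2
  have h2 : X ≤ (d * d) * (K * (eLpNorm F p μ + ENNReal.ofReal ε * X + ENNReal.ofReal M * Y)) := by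
    calc X ≤ ∑ i : Fin d, ∑ j : Fin d, K * (eLpNorm F p μ + ENNReal.ofReal ε * X + ENNReal.ofReal M * Y) :=
          Finset.sum_le_sum fun i _ => Finset.sum_le_sum fun j _ => (hK b i0 v vi vij hW i j).trans (mul_le_mul' le_rfl h1)
      _ = _ := by simp [mul_assoc]
  have h3 : ((d * d : ℝ≥0∞) * K) * ENNReal.ofReal ε ≤ 2⁻¹ := by
    have e1 : ((d * d : ℝ≥0∞) * K) = ENNReal.ofReal ((d * d : ℝ) * K) := by
      rw [ENNReal.ofReal_mul (by positivity), ENNReal.ofReal_mul (by positivity)]; simp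
    rw [e1, ← ENNReal.ofReal_mul (by positivity)]
    have e2 : (2⁻¹ : ℝ≥0∞) = ENNReal.ofReal (1/2) := by simp
    rw [e2]
    apply ENNReal.ofReal_le_ofReal
    rw [hε, mul_one_div, div_le_div_iff₀ hD (by norm_num)]
    linarith
  have h4 : X ≤ 2⁻¹ * X + (d * d) * K * (1 + M.toNNReal) * (eLpNorm F p μ + Y) := by
    refine h2.trans ?_
    calc (d * d : ℝ≥0∞) * (K * (eLpNorm F p μ + ENNReal.ofReal ε * X + ENNReal.ofReal M * Y))
        = ((d * d : ℝ≥0∞) * K) * ENNReal.ofReal ε * X + (d * d) * K * (1 * eLpNorm F p μ + M.toNNReal * Y) := by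
          rw [show ENNReal.ofReal M = (M.toNNReal : ℝ≥0∞) from rfl]; ring
      _ ≤ 2⁻¹ * X + (d * d) * K * ((1 + M.toNNReal) * eLpNorm F p μ + (1 + M.toNNReal) * Y) := by
          gcongr
          · exact le_self_add
          · exact le_add_self
      _ = _ := by ring
  refine le_trans ?_ ((absorb hXt h4).trans (le_of_eq ?_))
  · exact (Finset.single_le_sum (f := fun j => eLpNorm (vij i j) p μ) (fun _ _ => zero_le) (Finset.mem_univ j)).trans
      (Finset.single_le_sum (f := fun i => ∑ j, eLpNorm (vij i j) p μ) (fun _ _ => zero_le) (Finset.mem_univ i))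
  · push_cast; ring

end EllReg10

noncomputable section EllReg11

variable {d : ℕ} {p : ℝ≥0∞} [hp : Fact (1 ≤ p)]

/-- difference quotient -/
def dq (t : ℝ) (e : Euc d) (g : Euc d → ℝ) (x : Euc d) : ℝ := t⁻¹ * (g (x + t • e) - g x)
/-- step sizes -/
def hs (m : ℕ) : ℝ := 1 / ((m : ℝ) + 1)
lemma hs_pos (m : ℕ) : 0 < hs m := by unfold hs; positivity
lemma hs_lim : Tendsto hs atTop (𝓝[≠] 0) :=
  tendsto_nhdsWithin_iff.2 ⟨tendsto_one_div_add_atTop_nhds_zero_nat, Eventually.of_forall fun m => (hs_pos m).ne'⟩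
lemma hs_lim0 : Tendsto hs atTop (𝓝 0) := tendsto_one_div_add_atTop_nhds_zero_nat

lemma line_deriv {a : Euc d → ℝ} (ha : ContDiff ℝ 1 a) (x e : Euc d) (t : ℝ) :
    HasDerivAt (fun t : ℝ => a (x + t • e)) (fderiv ℝ a (x + t • e) e) t := by
  have h1 : HasDerivAt (fun t : ℝ => x + t • e) e t := by
    simpa using ((hasDerivAt_id t).smul_const e).const_add x
  exact (ha.differentiable (by norm_num) (x + t • e)).hasFDerivAt.comp_hasDerivAt t h1

lemma dq_bound {a : Euc d → ℝ} (ha : ContDiff ℝ 1 a) {e : Euc d} {M : ℝ} (hM : ∀ x, |fderiv ℝ a x e| ≤ M) {t : ℝ} (ht : 0 < t) (x : Euc d) :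
    |dq t e a x| ≤ M := by
  have := curve1 (line_deriv ha x e) (h := t) (C := M) (fun s _ => hM _)
  simp only [zero_smul, add_zero, Real.norm_eq_abs] at this
  rw [dq, abs_mul, abs_inv, inv_mul_le_iff₀ (abs_pos.2 ht.ne')]
  linarith

lemma dq_pt {a : Euc d → ℝ} (ha : ContDiff ℝ 1 a) (e x : Euc d) :
    Tendsto (fun m => dq (hs m) e a x) atTop (𝓝 (fderiv ℝ a x e)) := by
  have := (line_deriv ha x e 0).tendsto_slope_zero
  simp only [zero_smul, add_zero, zero_add, smul_eq_mul] at this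
  exact this.comp hs_lim

lemma dq_cont {a : Euc d → ℝ} (ha : Continuous a) (t : ℝ) (e : Euc d) : Continuous (dq t e a) := by
  unfold dq; fun_prop

lemma dq_mul (hp2 : p ≠ ⊤) {n e : Euc d} (he : inner ℝ n e = 0) {a g : Euc d → ℝ} (ha : CB 1 a) (hg : LpU p (HS n) g) :
    LpT p (volume.restrict (HS n)) (fun m x => dq (hs m) e a x * g (x + hs m • e)) (fun x => fderiv ℝ a x e * g x) := by
  obtain ⟨M, hM⟩ := (ha.2.2 e).bd
  have hM0 : 0 ≤ M := (abs_nonneg _).trans (hM 0)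
  have hd : Continuous (fun x => fderiv ℝ a x e) := (ha.2.2 e).cont
  have het : ∀ t : ℝ, inner ℝ n (t • e) = 0 := fun t => by rw [inner_smul_right, he, mul_zero]
  have h1 : Tendsto (fun m => ENNReal.ofReal M * eLpNorm (fun x => g (x + hs m • e) - g x) p (volume.restrict (HS n))) atTop (𝓝 0) := by
    have := ENNReal.Tendsto.const_mul (a := ENNReal.ofReal M) ((tr_cont_H hp2 he hg).comp hs_lim0) (Or.inr (by simp))
    simpa using this
  have h2 : Tendsto (fun m => eLpNorm (fun x => (dq (hs m) e a x - fderiv ℝ a x e) * g x) p (volume.restrict (HS n))) atTop (𝓝 0) := by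
    refine mul_tendsto hp2 hg (fun m => ((dq_cont ha.cont _ _).sub hd).aestronglyMeasurable) (M := M + M) (fun m x => ?_) fun x => ?_
    · exact (abs_sub _ _).trans (add_le_add (dq_bound ha.1 hM (hs_pos m) x) (hM x))
    · simpa using (dq_pt ha.1 e x).sub_const (fderiv ℝ a x e)
  have h3 := h1.add h2
  rw [add_zero] at h3
  refine tendsto_of_tendsto_of_tendsto_of_le_of_le tendsto_const_nhds h3 (fun _ => zero_le) fun m => ?_
  have m1 := LpU.mulB (HS_meas n) (dq_cont ha.cont (hs m) e) (dq_bound ha.1 hM (hs_pos m)) ((hg.tr (het (hs m))).sub hg)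
  have m2 := LpU.mulB (HS_meas n) ((dq_cont ha.cont (hs m) e).sub hd) (M := M + M) (fun x => (abs_sub _ _).trans (add_le_add (dq_bound ha.1 hM (hs_pos m) x) (hM x))) hg
  refine le_trans (le_of_eq ?_) ((eLpNorm_add_le m1.1.1 m2.1.1 hp.out).trans (add_le_add m1.2 le_rfl))
  congr 1; funext x; simp; ring

lemma dq_lp {n e : Euc d} (he : inner ℝ n e = 0) {g : Euc d → ℝ} (hg : LpU p (HS n) g) (t : ℝ) : LpU p (HS n) (dq t e g) :=
  ((hg.tr (by rw [inner_smul_right, he, mul_zero])).sub hg).const_mul _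

theorem tang (d : ℕ) (hp1 : 1 < p) (hp2 : p ≠ ⊤) {ε : ℝ} (hε : ∀ M : ℝ, ∃ C : ℝ≥0,
    ∀ (b : OrthonormalBasis (Fin d) ℝ (Euc d)) (i0 : Fin d) (a : Fin d → Fin d → Euc d → ℝ) (q : Fin d → Euc d → ℝ),
    (∀ i j, Continuous (a i j)) → (∀ i, Continuous (q i)) → (∀ i j x, |a i j x| ≤ ε) → (∀ i x, |q i x| ≤ M) → ∀ v vi vij F,
    W2H p b i0 v vi vij → Eqn b i0 a q vi vij F → LpU p (HS (b i0)) F → ∀ i j,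
    eLpNorm (vij i j) p (volume.restrict (HS (b i0))) ≤ C * (eLpNorm F p (volume.restrict (HS (b i0))) +
      ∑ i, eLpNorm (vi i) p (volume.restrict (HS (b i0)))))
    (b : OrthonormalBasis (Fin d) ℝ (Euc d)) (i0 : Fin d) (a : Fin d → Fin d → Euc d → ℝ) (q : Fin d → Euc d → ℝ)
    (ha : ∀ i j, CB 1 (a i j)) (hq : ∀ i, CB 1 (q i)) (hae : ∀ i j x, |a i j x| ≤ ε)
    {v : Euc d → ℝ} {vi : Fin d → Euc d → ℝ} {vij : Fin d → Fin d → Euc d → ℝ} {F Fl : Euc d → ℝ}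
    (hW : W2H p b i0 v vi vij) (hE : Eqn b i0 a q vi vij F) (hF : LpU p (HS (b i0)) F) {l : Fin d} (hl : l ≠ i0)
    (hFl : LpU p (HS (b i0)) Fl) (hFd : WD (HS (b i0)) (b l) F Fl) :
    ∃ w : Fin d → Fin d → Euc d → ℝ, W2H p b i0 (vi l) (fun i => vij i l) w ∧
      Eqn b i0 a q (fun i => vij i l) w (fun x => (Fl x - ∑ i, ∑ j, fderiv ℝ (a i j) x (b l) * vij i j x) -
        ∑ i, fderiv ℝ (q i) x (b l) * vi i x) := by
  set e := b l
  have he : inner ℝ (b i0) e = 0 := binner b hl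
  have het : ∀ t : ℝ, inner ℝ (b i0) (t • e) = 0 := fun t => by rw [inner_smul_right, he, mul_zero]
  obtain ⟨M, hM⟩ : ∃ M, ∀ i x, |q i x| ≤ M := by
    choose M hM using fun i => (hq i).bd
    exact ⟨∑ i, |M i|, fun i x => (hM i x).trans ((le_abs_self _).trans
      (Finset.single_le_sum (f := fun i => |M i|) (fun _ _ => abs_nonneg _) (Finset.mem_univ i)))⟩
  obtain ⟨C, hC⟩ := hε M
  set μ := volume.restrict (HS (b i0)) with hμ
  -- difference quotients of v
  have W : ∀ m, W2H p b i0 (dq (hs m) e v) (fun i => dq (hs m) e (vi i)) (fun i j => dq (hs m) e (vij i j)) := fun m =>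
    ((hW.tr (het (hs m))).sub hW).smul (hs m)⁻¹
  let Fm : ℕ → Euc d → ℝ := fun m x => (dq (hs m) e F x - ∑ i, ∑ j, dq (hs m) e (a i j) x * vij i j (x + hs m • e)) -
    ∑ i, dq (hs m) e (q i) x * vi i (x + hs m • e)
  have mda : ∀ {a g : Euc d → ℝ}, CB 1 a → LpU p (HS (b i0)) g → ∀ m, LpU p (HS (b i0)) (fun x => dq (hs m) e a x * g (x + hs m • e)) := by
    intro a g ha hg m
    obtain ⟨M, hM⟩ := (ha.2.2 e).bd
    exact (LpU.mulB (HS_meas _) (dq_cont ha.cont _ _) (dq_bound ha.1 hM (hs_pos m)) (hg.tr (het (hs m)))).1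
  have mfa : ∀ {a g : Euc d → ℝ}, CB 1 a → LpU p (HS (b i0)) g → LpU p (HS (b i0)) (fun x => fderiv ℝ a x e * g x) := by
    intro a g ha hg
    obtain ⟨M, hM⟩ := (ha.2.2 e).bd
    exact (LpU.mulB (HS_meas _) (ha.2.2 e).cont hM hg).1
  have mS : ∀ m, MemLp (fun x => ∑ i, ∑ j, dq (hs m) e (a i j) x * vij i j (x + hs m • e)) p μ := fun m =>
    memLp_finsetSum _ fun i _ => memLp_finsetSum _ fun j _ => mda (ha i j) (hW.l2 i j) m
  have mS0 : MemLp (fun x => ∑ i, ∑ j, fderiv ℝ (a i j) x e * vij i j x) p μ :=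
    memLp_finsetSum _ fun i _ => memLp_finsetSum _ fun j _ => mfa (ha i j) (hW.l2 i j)
  have mQ : ∀ m, MemLp (fun x => ∑ i, dq (hs m) e (q i) x * vi i (x + hs m • e)) p μ := fun m =>
    memLp_finsetSum _ fun i _ => mda (hq i) (hW.l1 i) m
  have mQ0 : MemLp (fun x => ∑ i, fderiv ℝ (q i) x e * vi i x) p μ :=
    memLp_finsetSum _ fun i _ => mfa (hq i) (hW.l1 i)
  set G : Euc d → ℝ := fun x => (Fl x - ∑ i, ∑ j, fderiv ℝ (a i j) x e * vij i j x) - ∑ i, fderiv ℝ (q i) x e * vi i x with hG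
  have mF : ∀ m, MemLp (Fm m) p μ := fun m => ((dq_lp he hF _).sub (mS m)).sub (mQ m)
  have mG : MemLp G p μ := (hFl.sub mS0).sub mQ0
  have tdq : ∀ {g w : Euc d → ℝ}, LpU p (HS (b i0)) g → LpU p (HS (b i0)) w → WD (HS (b i0)) e g w →
      LpT p μ (fun m => dq (hs m) e g) w := fun hg hw h =>
    (tr_tendsto_H hp2 (bnorm b i0) he hg hw h).comp hs_lim
  have tF : LpT p μ Fm G := by
    refine (LpT.sub ((tdq hF hFl hFd).sub (LpT.sum _ (fun i => LpT.sum _ (fun j => dq_mul hp2 he (ha i j) (hW.l2 i j)) ?_ ?_) ?_ ?_)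
      (fun m => dq_lp he hF _) hFl mS mS0) (LpT.sum _ (fun i => dq_mul hp2 he (hq i) (hW.l1 i)) ?_ ?_) (fun m => (dq_lp he hF _).sub (mS m)) (hFl.sub mS0) mQ mQ0)
    · exact fun j m => mda (ha i j) (hW.l2 i j) m
    · exact fun j => mfa (ha i j) (hW.l2 i j)
    · exact fun i m => memLp_finsetSum _ fun j _ => mda (ha i j) (hW.l2 i j) m
    · exact fun i => memLp_finsetSum _ fun j _ => mfa (ha i j) (hW.l2 i j)
    · exact fun i m => mda (hq i) (hW.l1 i) m
    · exact fun i => mfa (hq i) (hW.l1 i)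
  have Em : ∀ m, Eqn b i0 a q (fun i => dq (hs m) e (vi i)) (fun i j => dq (hs m) e (vij i j)) (Fm m) := by
    intro m
    have hE' := (HS_mp (het (hs m))).quasiMeasurePreserving.ae hE
    filter_upwards [hE, hE'] with x h1 h2
    have hne := (hs_pos m).ne'
    simp only [Fm]
    rw [show dq (hs m) e F x = (hs m)⁻¹ * (F (x + hs m • e) - F x) from rfl, h1, h2]
    have k1 : ∀ i j, dq (hs m) e (a i j) x * vij i j (x + hs m • e) = (hs m)⁻¹ * (a i j (x + hs m • e) * vij i j (x + hs m • e))
        - (hs m)⁻¹ * (a i j x * vij i j (x + hs m • e)) := fun i j => by unfold dq; ring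
    have k2 : ∀ i, dq (hs m) e (q i) x * vi i (x + hs m • e) = (hs m)⁻¹ * (q i (x + hs m • e) * vi i (x + hs m • e))
        - (hs m)⁻¹ * (q i x * vi i (x + hs m • e)) := fun i => by unfold dq; ring
    have k3 : ∀ i j, a i j x * dq (hs m) e (vij i j) x = (hs m)⁻¹ * (a i j x * vij i j (x + hs m • e))
        - (hs m)⁻¹ * (a i j x * vij i j x) := fun i j => by unfold dq; ring
    have k4 : ∀ i, q i x * dq (hs m) e (vi i) x = (hs m)⁻¹ * (q i x * vi i (x + hs m • e))
        - (hs m)⁻¹ * (q i x * vi i x) := fun i => by unfold dq; ring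
    have k5 : ∀ j, dq (hs m) e (vij j j) x = (hs m)⁻¹ * vij j j (x + hs m • e) - (hs m)⁻¹ * vij j j x := fun j => by unfold dq; ring
    simp only [k1, k2, k3, k4, k5, Finset.sum_sub_distrib, ← Finset.mul_sum]
    ring
  -- Cauchy
  let β : ℕ → ℝ≥0∞ := fun m => C * (eLpNorm (fun x => Fm m x - G x) p μ + ∑ i, eLpNorm (fun x => dq (hs m) e (vi i) x - vij i l x) p μ)
  have hβ : Tendsto β atTop (𝓝 0) := by
    have h1 : Tendsto (fun m => ∑ i, eLpNorm (fun x => dq (hs m) e (vi i) x - vij i l x) p μ) atTop (𝓝 (∑ i : Fin d, 0)) :=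
      tendsto_finsetSum _ fun i _ => tdq (hW.l1 i) (hW.l2 i l) (hW.d2 i l)
    have h2 := ENNReal.Tendsto.const_mul (a := (C : ℝ≥0∞)) (Tendsto.add tF h1) (Or.inr (by simp))
    simpa using h2
  have tri : ∀ {f g h : Euc d → ℝ}, MemLp f p μ → MemLp g p μ → MemLp h p μ →
      eLpNorm (fun x => f x - g x) p μ ≤ eLpNorm (fun x => f x - h x) p μ + eLpNorm (fun x => g x - h x) p μ := by
    intro f g h hf hg hh
    refine le_trans (le_of_eq ?_) (eLpNorm_sub_le (hf.sub hh).1 (hg.sub hh).1 hp.out)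
    congr 1; funext x; simp
  have hcau : ∀ i j m n, eLpNorm (fun x => dq (hs m) e (vij i j) x - dq (hs n) e (vij i j) x) p μ ≤ β m + β n := by
    intro i j m n
    have hEd : Eqn b i0 a q (fun i x => dq (hs m) e (vi i) x - dq (hs n) e (vi i) x)
        (fun i j x => dq (hs m) e (vij i j) x - dq (hs n) e (vij i j) x) (fun x => Fm m x - Fm n x) := by
      filter_upwards [Em m, Em n] with x h1 h2
      rw [h1, h2]
      simp only [mul_sub, Finset.sum_sub_distrib]
      ring
    refine (hC b i0 a q (fun i j => (ha i j).cont) (fun i => (hq i).cont) hae hM _ _ _ _ ((W m).sub (W n)) hEd ((mF m).sub (mF n)) i j).trans ?_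
    simp only [β]
    rw [← mul_add]
    refine mul_le_mul' le_rfl ?_
    calc _ ≤ (eLpNorm (fun x => Fm m x - G x) p μ + eLpNorm (fun x => Fm n x - G x) p μ) +
          ∑ i, (eLpNorm (fun x => dq (hs m) e (vi i) x - vij i l x) p μ + eLpNorm (fun x => dq (hs n) e (vi i) x - vij i l x) p μ) :=
          add_le_add (tri (mF m) (mF n) mG) (Finset.sum_le_sum fun i _ => tri ((W m).l1 i) ((W n).l1 i) (hW.l2 i l))
      _ = _ := by rw [Finset.sum_add_distrib]; ring
  choose w hw1 hw2 using fun i j => LpT.exists (fun m => (W m).l2 i j) hβ (hcau i j)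
  refine ⟨w, W2H.lim W (hW.l1 l) (fun i => hW.l2 i l) hw1 (tdq hW.l0 (hW.l1 l) (hW.d1 l)) (fun i => tdq (hW.l1 i) (hW.l2 i l) (hW.d2 i l)) hw2, ?_⟩
  have lB : ∀ {c g : Euc d → ℝ}, CB 1 c → MemLp g p μ → MemLp (fun x => c x * g x) p μ := by
    intro c g hc hg
    obtain ⟨M, hM⟩ := hc.bd
    exact (LpU.mulB (HS_meas _) hc.cont hM hg).1
  have tB : ∀ {c g : Euc d → ℝ} {gn : ℕ → Euc d → ℝ}, CB 1 c → LpT p μ gn g → LpT p μ (fun m x => c x * gn m x) (fun x => c x * g x) := by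
    intro c g gn hc hg
    obtain ⟨M, hM⟩ := hc.bd
    exact hg.cmulB hM
  have T1' := LpT.sum (p := p) (μ := μ) Finset.univ (fun j => hw2 j j) (fun j m => (W m).l2 j j) (fun j => hw1 j j)
  have T2' := LpT.sum (p := p) (μ := μ) Finset.univ (fun i => LpT.sum (p := p) (μ := μ) Finset.univ (fun j => tB (ha i j) (hw2 i j))
    (fun j m => lB (ha i j) ((W m).l2 i j)) (fun j => lB (ha i j) (hw1 i j)))
    (fun i m => memLp_finsetSum _ fun j _ => lB (ha i j) ((W m).l2 i j)) (fun i => memLp_finsetSum _ fun j _ => lB (ha i j) (hw1 i j))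
  have T3' := LpT.sum (p := p) (μ := μ) Finset.univ (fun i => tB (hq i) (tdq (hW.l1 i) (hW.l2 i l) (hW.d2 i l)))
    (fun i m => lB (hq i) ((W m).l1 i)) (fun i => lB (hq i) (hW.l2 i l))
  have M1 : ∀ m, MemLp (fun x => ∑ j, dq (hs m) e (vij j j) x) p μ := fun m => memLp_finsetSum _ fun j _ => (W m).l2 j j
  have M1' : MemLp (fun x => ∑ j, w j j x) p μ := memLp_finsetSum _ fun j _ => hw1 j j
  have M2 : ∀ m, MemLp (fun x => ∑ i, ∑ j, a i j x * dq (hs m) e (vij i j) x) p μ := fun m =>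
    memLp_finsetSum _ fun i _ => memLp_finsetSum _ fun j _ => lB (ha i j) ((W m).l2 i j)
  have M2' : MemLp (fun x => ∑ i, ∑ j, a i j x * w i j x) p μ :=
    memLp_finsetSum _ fun i _ => memLp_finsetSum _ fun j _ => lB (ha i j) (hw1 i j)
  have M3 : ∀ m, MemLp (fun x => ∑ i, q i x * dq (hs m) e (vi i) x) p μ := fun m => memLp_finsetSum _ fun i _ => lB (hq i) ((W m).l1 i)
  have M3' : MemLp (fun x => ∑ i, q i x * vij i l x) p μ := memLp_finsetSum _ fun i _ => lB (hq i) (hW.l2 i l)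
  exact LpT.unique tF ((T1'.add T2' M1 M1' M2 M2').add T3' (fun m => (M1 m).add (M2 m)) (M1'.add M2') M3 M3') mF mG
    (fun m => ((M1 m).add (M2 m)).add (M3 m)) ((M1'.add M2').add M3') Em

end EllReg11

noncomputable section EllReg12

variable {d : ℕ} {p : ℝ≥0∞} [hp : Fact (1 ≤ p)]

/-- uniform Sobolev bounds for a family -/
def UB (p : ℝ≥0∞) (U : Set (Euc d)) {ι : Type} (m : ℕ) (K : ι → ℝ≥0∞) (g : ι → Euc d → ℝ) : Prop :=
  ∃ C : ℝ≥0, ∀ x, SB p U m (C * K x) (g x)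

variable {U : Set (Euc d)} {ι : Type} {m : ℕ} {K : ι → ℝ≥0∞} {g g' : ι → Euc d → ℝ}

lemma UB.lp (h : UB p U m K g) (x : ι) : LpU p U (g x) := by obtain ⟨C, h⟩ := h; exact (h x).lp
lemma UB.nm (h : UB p U m K g) : ∃ C : ℝ≥0, ∀ x, eLpNorm (g x) p (volume.restrict U) ≤ C * K x := by
  obtain ⟨C, h⟩ := h; exact ⟨C, fun x => (h x).nm⟩
lemma UB.le {k : ℕ} (hk : k ≤ m) (h : UB p U m K g) : UB p U k K g := by
  obtain ⟨C, h⟩ := h; exact ⟨C, fun x => (h x).le hk⟩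
lemma UB.pred (h : UB p U (m + 1) K g) : UB p U m K g := h.le (Nat.le_succ m)
lemma UB.monoK {K' : ι → ℝ≥0∞} (C : ℝ≥0) (hK : ∀ x, K x ≤ C * K' x) (h : UB p U m K g) : UB p U m K' g := by
  obtain ⟨D, h⟩ := h
  refine ⟨D * C, fun x => (h x).monoK ?_⟩
  push_cast; rw [mul_assoc]; gcongr; exact hK x
lemma UB.restrict {V : Set (Euc d)} (hV : V ⊆ U) (h : UB p U m K g) : UB p V m K g := by
  obtain ⟨C, h⟩ := h; exact ⟨C, fun x => (h x).restrict hV⟩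
lemma UB.congr (hU : MeasurableSet U) (h : UB p U m K g) (hg : ∀ x, g x =ᵐ[volume.restrict U] g' x) : UB p U m K g' := by
  obtain ⟨C, h⟩ := h; exact ⟨C, fun x => (h x).congr hU (hg x)⟩
lemma UB.congr' (h : UB p U m K g) (hg : ∀ x y, g x y = g' x y) : UB p U m K g' := by
  have : g = g' := funext fun x => funext fun y => hg x y
  rwa [← this]
lemma UB.zero : UB p U m K (fun _ _ => 0) := ⟨0, fun x => SB.zero _ _⟩
lemma UB.deriv (hU : IsOpen U) {e : Euc d} (he : ‖e‖ ≤ 1) (h : UB p U (m + 1) K g)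
    (hv : ∀ x, LpU p U (g' x)) (hd : ∀ x, WD U e (g x) (g' x)) : UB p U m K g' := by
  obtain ⟨C, h⟩ := h; exact ⟨C, fun x => (h x).deriv hU he (hv x) (hd x)⟩
lemma UB.add (hU : MeasurableSet U) (h : UB p U m K g) (h' : UB p U m K g') : UB p U m K (fun x y => g x y + g' x y) := by
  obtain ⟨C, h⟩ := h; obtain ⟨D, h'⟩ := h'
  exact ⟨C + D, fun x => by push_cast; rw [add_mul]; exact (h x).add hU (h' x)⟩
lemma UB.neg (h : UB p U m K g) : UB p U m K (fun x y => - g x y) := by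
  obtain ⟨C, h⟩ := h; exact ⟨C, fun x => (h x).neg⟩
lemma UB.sub (hU : MeasurableSet U) (h : UB p U m K g) (h' : UB p U m K g') : UB p U m K (fun x y => g x y - g' x y) :=
  (h.add hU h'.neg).congr' (fun x y => by ring)
lemma UB.sum (hU : MeasurableSet U) {κ : Type*} (s : Finset κ) {g : κ → ι → Euc d → ℝ} (h : ∀ i ∈ s, UB p U m K (g i)) :
    UB p U m K (fun x y => ∑ i ∈ s, g i x y) := by
  classical
  induction s using Finset.induction_on with
  | empty => simpa using UB.zero
  | insert i s hi ih =>
    have := (h i (Finset.mem_insert_self _ _)).add hU (ih fun j hj => h j (Finset.mem_insert_of_mem hj))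
    exact this.congr' (fun x y => by rw [Finset.sum_insert hi])
lemma UB.mulCB (hU : MeasurableSet U) {a : Euc d → ℝ} (ha : CB m a) (h : UB p U m K g) : UB p U m K (fun x y => a y * g x y) := by
  obtain ⟨C, h⟩ := h; obtain ⟨D, hD⟩ := SB.mulCB p ha
  exact ⟨D * C, fun x => by push_cast; rw [mul_assoc]; exact hD U hU _ _ (h x)⟩
lemma UB.exD (h : UB p U (m + 1) K g) {e : Euc d} (he : ‖e‖ ≤ 1) : ∃ g' : ι → Euc d → ℝ, (∀ x, WD U e (g x) (g' x)) ∧ UB p U m K g' := by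
  obtain ⟨C, h⟩ := h
  choose g' h1 h2 using fun x => (h x).2 e he
  exact ⟨g', h1, C, h2⟩
lemma UB.of_basis (hU : MeasurableSet U) (b : OrthonormalBasis (Fin d) ℝ (Euc d)) {gi : Fin d → ι → Euc d → ℝ} (h0 : UB p U 0 K g)
    (h1 : ∀ i x, WD U (b i) (g x) (gi i x)) (h2 : ∀ i, UB p U m K (gi i)) : UB p U (m + 1) K g := by
  obtain ⟨C0, h0⟩ := h0
  choose C h2 using h2
  refine ⟨(d + 1) * (C0 + ∑ i, C i), fun x => ?_⟩
  have h3 : C0 * K x ≤ ((C0 + ∑ i, C i : ℝ≥0) : ℝ≥0∞) * K x := by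
    gcongr; exact le_self_add
  have := SB.of_basis (K := ((C0 + ∑ i, C i : ℝ≥0) : ℝ≥0∞) * K x) hU b (h0 x).lp ((h0 x).nm.trans h3) (fun i => ⟨gi i x, h1 i x, (h2 i x).monoK (by
    gcongr; exact (Finset.single_le_sum (f := C) (fun _ _ => zero_le) (Finset.mem_univ i)).trans le_add_self)⟩)
  refine this.monoK (le_of_eq ?_)
  push_cast; rw [mul_assoc]

theorem reg_H (d : ℕ) (hp1 : 1 < p) (hp2 : p ≠ ⊤) : ∃ ε : ℝ, 0 < ε ∧ ε ≤ 1/2 ∧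
    ∀ (b : OrthonormalBasis (Fin d) ℝ (Euc d)) (i0 : Fin d) (k : ℕ) (a : Fin d → Fin d → Euc d → ℝ) (q : Fin d → Euc d → ℝ),
    (∀ i j, CB (k + 1) (a i j)) → (∀ i, CB k (q i)) → (∀ i j x, |a i j x| ≤ ε) →
    ∀ (ι : Type) (K : ι → ℝ≥0∞) (v : ι → Euc d → ℝ) (vi : ι → Fin d → Euc d → ℝ) (vij : ι → Fin d → Fin d → Euc d → ℝ) (F : ι → Euc d → ℝ),
    (∀ x, W2H p b i0 (v x) (vi x) (vij x)) → (∀ x, Eqn b i0 a q (vi x) (vij x) (F x)) →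
    UB p (HS (b i0)) (k + 1) K v → UB p (HS (b i0)) k K F → UB p (HS (b i0)) (k + 2) K v := by
  obtain ⟨ε, hε0, hε1, hε⟩ := est0 (p := p) d hp1 hp2
  refine ⟨ε, hε0, hε1, fun b i0 k => ?_⟩
  have hO := HS_open (b i0)
  have hM := HS_meas (b i0)
  induction k with
  | zero =>
    intro a q ha hq hae ι K v vi vij F hW hE hv hF
    have hvi : ∀ i, UB p (HS (b i0)) 0 K (fun x => vi x i) := fun i =>
      UB.deriv hO (bnorm b i).le hv (fun x => (hW x).l1 i) (fun x => (hW x).d1 i)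
    obtain ⟨M, hMq⟩ : ∃ M, ∀ i x, |q i x| ≤ M := by
      choose M hM using fun i => (hq i).bd
      exact ⟨∑ i, |M i|, fun i x => (hM i x).trans ((le_abs_self _).trans
        (Finset.single_le_sum (f := fun i => |M i|) (fun _ _ => abs_nonneg _) (Finset.mem_univ i)))⟩
    obtain ⟨C, hC⟩ := hε M
    have hvij : ∀ i j, UB p (HS (b i0)) 0 K (fun x => vij x i j) := by
      intro i j
      obtain ⟨CF, hCF⟩ := hF.nm
      choose Ci hCi using fun i => (hvi i).nm
      refine ⟨C * (CF + ∑ i, Ci i), fun x => ⟨(hW x).l2 i j, ?_⟩⟩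
      refine (hC b i0 a q (fun i j => (ha i j).cont) (fun i => (hq i).cont) hae hMq _ _ _ _ (hW x) (hE x) (hF.lp x) i j).trans ?_
      push_cast
      rw [mul_assoc, add_mul, Finset.sum_mul]
      gcongr with i
      · exact hCF x
      · exact hCi i x
    exact UB.of_basis hM b (gi := fun i x => vi x i) (hv.le (Nat.zero_le _)) (fun i x => (hW x).d1 i)
      (fun i => UB.of_basis hM b (gi := fun j x => vij x i j) (hvi i) (fun j x => (hW x).d2 i j) (fun j => hvij i j))
  | succ k ih =>
    intro a q ha hq hae ι K v vi vij F hW hE hv hF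
    have hvi : ∀ i, UB p (HS (b i0)) (k + 1) K (fun x => vi x i) := fun i =>
      UB.deriv hO (bnorm b i).le hv (fun x => (hW x).l1 i) (fun x => (hW x).d1 i)
    have hvij0 : ∀ i j, UB p (HS (b i0)) k K (fun x => vij x i j) := fun i j =>
      UB.deriv hO (bnorm b j).le (hvi i) (fun x => (hW x).l2 i j) (fun x => (hW x).d2 i j)
    have hT : ∀ l, l ≠ i0 → UB p (HS (b i0)) (k + 2) K (fun x => vi x l) := by
      intro l hl
      obtain ⟨Fl, hFl, hFlu⟩ := hF.exD (bnorm b l).le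
      choose w hw1 hw2 using fun x => tang d hp1 hp2 hε b i0 a q (fun i j => (ha i j).le (by omega)) (fun i => (hq i).le (by omega)) hae
        (hW x) (hE x) (hF.lp x) hl (hFlu.lp x) (hFl x)
      refine ih a q (fun i j => (ha i j).pred) (fun i => (hq i).pred) hae ι K (fun x => vi x l) (fun x i => vij x i l) w _ hw1 hw2 (hvi l) ?_
      refine (hFlu.sub hM (UB.sum hM _ fun i _ => UB.sum hM _ fun j _ => ?_)).sub hM (UB.sum hM _ fun i _ => ?_)
      · exact UB.mulCB hM ((ha i j).pred.2.2 (b l)) (hvij0 i j)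
      · exact UB.mulCB hM ((hq i).2.2 (b l)) (hvi i).pred
    have hD1 : ∀ i j, i ≠ i0 → UB p (HS (b i0)) (k + 1) K (fun x => vij x i j) := fun i j hi =>
      UB.deriv hO (bnorm b j).le (hT i hi) (fun x => (hW x).l2 i j) (fun x => (hW x).d2 i j)
    have hD2 : ∀ i j, ¬ (i = i0 ∧ j = i0) → UB p (HS (b i0)) (k + 1) K (fun x => vij x i j) := by
      intro i j hij
      by_cases hi : i = i0
      · exact (hD1 j i (fun h => hij ⟨hi, h⟩)).congr hM (fun x => (hW x).sym j i)
      · exact hD1 i j hi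
    have hD3 : UB p (HS (b i0)) (k + 1) K (fun x => vij x i0 i0) := by
      have hc : ∀ y, (1/2 : ℝ) ≤ 1 + a i0 i0 y := fun y => by
        have := (abs_le.1 (hae i0 i0 y)).1; linarith
      have hR : UB p (HS (b i0)) (k + 1) K (fun x y => (1 + a i0 i0 y)⁻¹ * (((F x y - ∑ j ∈ Finset.univ.erase i0, vij x j j y) -
          ∑ z ∈ (Finset.univ : Finset (Fin d × Fin d)).erase (i0, i0), a z.1 z.2 y * vij x z.1 z.2 y) - ∑ i, q i y * vi x i y)) := by
        refine UB.mulCB hM (CB.inv (c := 1/2) (by norm_num) hc ((CB.const _ 1).add (ha i0 i0).pred)) ?_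
        refine ((hF.sub hM (UB.sum hM _ fun j hj => ?_)).sub hM (UB.sum hM _ fun z hz => ?_)).sub hM (UB.sum hM _ fun i _ => ?_)
        · exact hD1 j j (Finset.ne_of_mem_erase hj)
        · refine UB.mulCB hM (ha z.1 z.2).pred (hD2 z.1 z.2 fun h => ?_)
          exact Finset.ne_of_mem_erase hz (Prod.ext h.1 h.2)
        · exact UB.mulCB hM (hq i) (hvi i)
      refine hR.congr hM (fun x => ?_)
      filter_upwards [hE x] with y hy
      have hy0 : 1 + a i0 i0 y ≠ 0 := by have := hc y; intro h; linarith
      rw [hy, ← Finset.sum_product' (Finset.univ) (Finset.univ) (fun i j => a i j y * vij x i j y), Finset.univ_product_univ,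
        ← Finset.add_sum_erase Finset.univ (fun j => vij x j j y) (Finset.mem_univ i0),
        ← Finset.add_sum_erase (Finset.univ : Finset (Fin d × Fin d)) (fun z => a z.1 z.2 y * vij x z.1 z.2 y) (Finset.mem_univ (i0, i0))]
      field_simp
      ring
    have hD : ∀ i j, UB p (HS (b i0)) (k + 1) K (fun x => vij x i j) := by
      intro i j
      by_cases h : i = i0 ∧ j = i0
      · rw [h.1, h.2]; exact hD3
      · exact hD2 i j h
    exact UB.of_basis hM b (gi := fun i x => vi x i) (hv.le (Nat.zero_le _)) (fun i x => (hW x).d1 i)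
      (fun i => UB.of_basis hM b (gi := fun j x => vij x i j) ((hvi i).le (Nat.zero_le _)) (fun j x => (hW x).d2 i j) (fun j => hD i j))

end EllReg12

noncomputable section EllReg13

variable {d : ℕ} {p : ℝ≥0∞} [hp : Fact (1 ≤ p)]

/-- the shear along `n` -/
def sh (γ : Euc d → ℝ) (n : Euc d) (y : Euc d) : Euc d := y + γ y • n

/-- invariance along `n` -/
def Iv (γ : Euc d → ℝ) (n : Euc d) : Prop := ∀ y (t : ℝ), γ (y + t • n) = γ y

variable {γ : Euc d → ℝ} {n : Euc d}

lemma Iv.neg (h : Iv γ n) : Iv (fun y => - γ y) n := fun y t => by simp [h y t]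
lemma Iv.sh (h : Iv γ n) (y : Euc d) {γ' : Euc d → ℝ} : γ (sh γ' n y) = γ y := h y _
lemma sh_sh (h : Iv γ n) (y : Euc d) : sh (fun y => - γ y) n (sh γ n y) = y := by
  have := h.sh y (γ' := γ)
  unfold _root_.sh at *
  simp [this]
lemma sh_sh' (h : Iv γ n) (y : Euc d) : sh γ n (sh (fun y => - γ y) n y) = y := by
  have := h.neg.sh y (γ' := fun y => - γ y)
  have h2 := sh_sh h.neg y
  simpa using h2
lemma sh_cd {k : WithTop ℕ∞} (h : ContDiff ℝ k γ) : ContDiff ℝ k (sh γ n) := contDiff_id.add (h.smul contDiff_const)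

/-- the shear as a homeomorphism -/
def shH (hc : Continuous γ) (h : Iv γ n) : Euc d ≃ₜ Euc d where
  toFun := sh γ n
  invFun := sh (fun y => - γ y) n
  left_inv := sh_sh h
  right_inv := sh_sh' h
  continuous_toFun := by unfold sh; fun_prop
  continuous_invFun := by unfold sh; fun_prop

lemma Iv.fd (h : Iv γ n) (y : Euc d) (t : ℝ) : fderiv ℝ γ (y + t • n) = fderiv ℝ γ y := by
  have h1 := fderiv_comp_add_right (𝕜 := ℝ) (f := γ) (x := y) (t • n)
  rw [← h1]; congr 1; funext z; exact h z t
lemma Iv.fdi (h : Iv γ n) (e : Euc d) : Iv (fun y => fderiv ℝ γ y e) n := fun y t => by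
  simp only [h.fd y t]
lemma Iv.fdn (h : Iv γ n) (hd : Differentiable ℝ γ) (y : Euc d) : fderiv ℝ γ y n = 0 := by
  have h1 : HasDerivAt (fun t : ℝ => γ (y + t • n)) (fderiv ℝ γ (y + (0:ℝ) • n) n) 0 := by
    have h2 : HasFDerivAt γ (fderiv ℝ γ (y + (0:ℝ) • n)) (y + (0:ℝ) • n) := (hd _).hasFDerivAt
    refine h2.comp_hasDerivAt (0:ℝ) ?_
    simpa using ((hasDerivAt_id (0:ℝ)).smul_const n).const_add y
  simp only [h y] at h1
  have := h1.unique (hasDerivAt_const 0 (γ y))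
  simpa using this

lemma sh_fd (hd : Differentiable ℝ γ) (y : Euc d) :
    HasFDerivAt (sh γ n) (ContinuousLinearMap.id ℝ (Euc d) + (fderiv ℝ γ y).smulRight n) y :=
  (hasFDerivAt_id y).add ((hd y).hasFDerivAt.smul_const n)

lemma sh_mp (hd : ContDiff ℝ 1 γ) (h : Iv γ n) : MeasurePreserving (sh γ n) volume volume := by
  have key : ∀ γ : Euc d → ℝ, ContDiff ℝ 1 γ → Iv γ n → ∀ s, MeasurableSet s → volume (sh γ n '' s) = volume s := by
    intro γ hd h s hs
    have hdd := hd.differentiable (by norm_num)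
    rw [← lintegral_abs_det_fderiv_eq_addHaar_image volume hs (fun x _ => (sh_fd (n := n) hdd x).hasFDerivWithinAt)
      ((shH hd.continuous h).injective.injOn)]
    have : ∀ x, (ContinuousLinearMap.id ℝ (Euc d) + (fderiv ℝ γ x).smulRight n).det = 1 := by
      intro x
      have h1 := LinearMap.transvection.det (fderiv ℝ γ x).toLinearMap n
      have h2 : (fderiv ℝ γ x).toLinearMap n = 0 := h.fdn hdd x
      rw [h2, add_zero] at h1
      rw [← h1]; rfl
    simp [this]
  refine ⟨(sh_cd hd).continuous.measurable, ?_⟩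
  ext s hs
  rw [Measure.map_apply (sh_cd hd).continuous.measurable hs, ← key _ hd.neg h.neg s hs]
  congr 1
  exact ((shH hd.continuous h).symm.image_eq_preimage_symm s).symm

lemma T1.sh {U : Set (Euc d)} (hd : ContDiff ℝ 1 γ) (h : Iv γ n) {φ : Euc d → ℝ} (hφ : T1 U φ) :
    T1 ((sh γ n) ⁻¹' U) (fun y => φ (sh γ n y)) := by
  refine ⟨hφ.1.comp (sh_cd hd), hφ.2.1.comp_homeomorph (shH hd.continuous h), ?_⟩
  have := tsupport_comp_eq_preimage φ (shH hd.continuous h)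
  rw [show (fun x => φ (_root_.sh γ n x)) = φ ∘ (shH hd.continuous h) from rfl, this]
  exact Set.preimage_mono hφ.2.2

lemma sh_int (hd : ContDiff ℝ 1 γ) (h : Iv γ n) (g : Euc d → ℝ) : ∫ x, g (sh γ n x) = ∫ x, g x :=
  (sh_mp hd h).integral_comp (shH hd.continuous h).measurableEmbedding g

lemma sh_lp (hd : ContDiff ℝ 1 γ) (h : Iv γ n) {U : Set (Euc d)} (hU : MeasurableSet U) {u : Euc d → ℝ} (hu : LpU p U u) :
    LpU p (sh γ n ⁻¹' U) (fun y => u (sh γ n y)) ∧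
    eLpNorm (fun y => u (sh γ n y)) p (volume.restrict (sh γ n ⁻¹' U)) = eLpNorm u p (volume.restrict U) := by
  have := (sh_mp hd h).restrict_preimage hU
  exact ⟨hu.comp_measurePreserving this, eLpNorm_comp_measurePreserving hu.1 this⟩

lemma WD.sh {U : Set (Euc d)} (hU : MeasurableSet U) (hd : ContDiff ℝ 1 γ) (hd2 : ∀ e, ContDiff ℝ 1 (fun y => fderiv ℝ γ y e)) (h : Iv γ n)
    {e : Euc d} {u v w : Euc d → ℝ} (hu : LpU p U u) (hv : LpU p U v) (hw : LpU p U w) (h1 : WD U e u v) (h2 : WD U n u w) :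
    WD (sh γ n ⁻¹' U) e (fun y => u (sh γ n y)) (fun y => v (sh γ n y) + fderiv ℝ γ y e * w (sh γ n y)) := by
  intro φ hφ
  set ψ : Euc d → ℝ := fun y => φ (_root_.sh (fun y => - γ y) n y) with hψd
  have hψ : T1 U ψ := by
    have := hφ.sh hd.neg h.neg
    convert this using 1
    ext x; simp only [Set.mem_preimage]; rw [sh_sh' h]
  have hφψ : ∀ y, φ y = ψ (_root_.sh γ n y) := fun y => by simp only [hψd]; rw [sh_sh h]
  have hfd : ∀ y, fderiv ℝ φ y e = fderiv ℝ ψ (_root_.sh γ n y) e + fderiv ℝ γ (_root_.sh γ n y) e * fderiv ℝ ψ (_root_.sh γ n y) n := by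
    intro y
    have a1 := by
      have := ((hψ.1.differentiable (by norm_num)) (_root_.sh γ n y)).hasFDerivAt.comp y (sh_fd (n := n) (hd.differentiable (by norm_num)) y)
      exact HasFDerivAt.congr_of_eventuallyEq (f₁ := φ) this (Eventually.of_forall hφψ)
    rw [a1.fderiv]
    have a2 := (h.fdi e).sh y (γ' := γ)
    rw [a2]
    simp
  have e1 : ∀ y, u (_root_.sh γ n y) * fderiv ℝ φ y e =
    (fun x => u x * (fderiv ℝ ψ x e) + u x * (fderiv ℝ γ x e * fderiv ℝ ψ x n)) (_root_.sh γ n y) := fun y => by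
      simp only [hfd y]; ring
  have e2 : ∀ y, (v (_root_.sh γ n y) + fderiv ℝ γ y e * w (_root_.sh γ n y)) * φ y =
      (fun x => v x * ψ x + w x * (fderiv ℝ γ x e * ψ x)) (_root_.sh γ n y) := fun y => by
    have a2 := (h.fdi e).sh y (γ' := γ)
    beta_reduce
    rw [a2, hφψ]; ring
  simp only [e1, e2]
  have i1 := sh_int hd h (fun x => u x * (fderiv ℝ ψ x e) + u x * (fderiv ℝ γ x e * fderiv ℝ ψ x n))
  have i2 := sh_int hd h (fun x => v x * ψ x + w x * (fderiv ℝ γ x e * ψ x))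
  refine i1.trans (Eq.trans ?_ (congrArg Neg.neg i2.symm))
  rw [integral_add (int_mul hU hu (hψ.ccd e) (hψ.zd e)) (int_mul hU hu ((hψ.ccd n).cmul' (hd2 e).continuous) (fun x hx => by simp [hψ.zd n x hx])),
    integral_add (int_mul hU hv hψ.cc hψ.z) (int_mul hU hw (hψ.cc.cmul' (hd2 e).continuous) (fun x hx => by simp [hψ.z x hx])), h1 ψ hψ]
  have h3 := h2 _ (hψ.mul (hd2 e))
  have h4 : ∀ x, fderiv ℝ (fun x => fderiv ℝ γ x e * ψ x) x n = fderiv ℝ γ x e * fderiv ℝ ψ x n := fun x => by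
    rw [fderiv_mul_apply (hd2 e) hψ.1, (h.fdi e).fdn ((hd2 e).differentiable (by norm_num)) x]; ring
  simp only [h4] at h3
  rw [h3]; ring

lemma UB.sh {U : Set (Euc d)} (hU : MeasurableSet U) (hd : CB 2 γ) (h : Iv γ n) (hn : ‖n‖ = 1) {m : ℕ} (hm : CB m γ) {ι : Type} {K : ι → ℝ≥0∞} {g : ι → Euc d → ℝ}
    (hg : UB p U m K g) : UB p (sh γ n ⁻¹' U) m K (fun x y => g x (sh γ n y)) := by
  have hd1 : ContDiff ℝ 1 γ := hd.1
  have hd2 : ∀ e, ContDiff ℝ 1 (fun y => fderiv ℝ γ y e) := fun e => (hd.2.2 e).1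
  have hU' : MeasurableSet (_root_.sh γ n ⁻¹' U) := (sh_cd hd1).continuous.measurable hU
  have h0 : ∀ {g : ι → Euc d → ℝ}, UB p U 0 K g → UB p (_root_.sh γ n ⁻¹' U) 0 K (fun x y => g x (_root_.sh γ n y)) := by
    rintro g ⟨C, hC⟩
    exact ⟨C, fun x => ⟨(sh_lp hd1 h hU (hC x).1).1, (sh_lp hd1 h hU (hC x).1).2.le.trans (hC x).2⟩⟩
  induction m generalizing g with
  | zero => exact h0 hg
  | succ m ih =>
    let b := EuclideanSpace.basisFun (Fin d) ℝ
    choose v hv1 hv2 using fun i => hg.exD (bnorm b i).le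
    obtain ⟨w, hw1, hw2⟩ := hg.exD hn.le
    refine UB.of_basis hU' b (h0 (hg.le (Nat.zero_le _))) (fun i x => WD.sh hU hd1 hd2 h (hg.lp x) ((hv2 i).lp x) (hw2.lp x) (hv1 i x) (hw1 x)) (fun i => ?_)
    exact (ih hm.pred (hv2 i)).add hU' ((ih hm.pred hw2).mulCB hU' (hm.2.2 (b i)))

/-! cutting off -/

lemma IsTestFun.cb {V : Set (Euc d)} {ζ : Euc d → ℝ} (h : IsTestFun V ζ) (m : ℕ) : CB m ζ :=
  CB.of_cc (h.1.of_le (by exact_mod_cast le_top)) h.2.1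

variable {Ω V G : Set (Euc d)} {ζ : Euc d → ℝ}

lemma IsTestFun.z (h : IsTestFun V ζ) : ∀ x ∉ V, ζ x = 0 := h.t1.z

lemma cut_lp (hV : MeasurableSet V) (hG : MeasurableSet G) (hΩ : MeasurableSet Ω) (hE : Ω ∩ V = G ∩ V) (hζ : IsTestFun V ζ) {M : ℝ} (hM : ∀ x, |ζ x| ≤ M)
    {u : Euc d → ℝ} (hu : LpU p Ω u) : LpU p G (fun x => ζ x * u x) ∧
    eLpNorm (fun x => ζ x * u x) p (volume.restrict G) ≤ ENNReal.ofReal M * eLpNorm u p (volume.restrict Ω) := by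
  have h1 := LpU.mulB (hΩ.inter hV) hζ.1.continuous hM (hu.mono Set.inter_subset_left)
  have h2 : (fun x => ζ x * u x) = V.indicator (fun x => ζ x * u x) := by
    funext x
    by_cases hx : x ∈ V
    · simp [hx]
    · simp [hx, hζ.z x hx]
  have h3 : volume.restrict (Ω ∩ V) = (volume.restrict G).restrict V := by
    rw [hE, Measure.restrict_restrict hV, Set.inter_comm]
  have h1a : MemLp (fun x => ζ x * u x) p ((volume.restrict G).restrict V) := h3 ▸ h1.1
  rw [h2]
  refine ⟨(memLp_indicator_iff_restrict hV).2 h1a, ?_⟩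
  rw [eLpNorm_indicator_eq_eLpNorm_restrict hV, ← h3]
  refine h1.2.trans ?_
  gcongr
  exact Set.inter_subset_left

lemma T1.cut (hE : Ω ∩ V = G ∩ V) (hζ : IsTestFun V ζ) {φ : Euc d → ℝ} (hφ : T1 G φ) : T1 Ω (fun x => ζ x * φ x) := by
  refine ⟨hζ.t1.1.mul hφ.1, hφ.2.1.mul_left, fun x hx => ?_⟩
  have h1 := hφ.2.2 ((tsupport_mul_subset_right (f := ζ) (g := φ)) hx)
  have h2 := hζ.2.2 ((tsupport_mul_subset_left (f := ζ) (g := φ)) hx)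
  have : x ∈ Ω ∩ V := hE ▸ ⟨h1, h2⟩
  exact this.1

lemma WD.cut (hV : MeasurableSet V) (hG : MeasurableSet G) (hΩ : MeasurableSet Ω) (hE : Ω ∩ V = G ∩ V) (hζ : IsTestFun V ζ) {e : Euc d}
    {u v : Euc d → ℝ} (hu : LpU p Ω u) (hv : LpU p Ω v) (h : WD Ω e u v) :
    WD G e (fun x => ζ x * u x) (fun x => ζ x * v x + fderiv ℝ ζ x e * u x) := by
  intro φ hφ
  have h0 := hφ.cut hE hζ
  have h1 := h _ h0
  have ha := hζ.t1.1
  have hda := hζ.t1.ccd e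
  simp only [fderiv_mul_apply ha hφ.1] at h1
  have hz : ∀ x ∉ Ω, ζ x * φ x = 0 := h0.z
  have hor : ∀ x ∉ Ω, x ∉ V ∨ x ∉ G := fun x hx => by
    by_contra! hc
    exact hx (show x ∈ Ω ∩ V from hE ▸ ⟨hc.2, hc.1⟩).1
  have i1 : Integrable (fun x => u x * (ζ x * fderiv ℝ φ x e)) :=
    int_mul hΩ hu ((hφ.ccd e).cmul' ha.continuous) (fun x hx => by
      rcases hor x hx with h | h
      · simp [hζ.z x h]
      · simp [hφ.zd e x h])
  have i2 : Integrable (fun x => u x * (fderiv ℝ ζ x e * φ x)) :=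
    int_mul hΩ hu (hφ.cc.cmul' hda.1) (fun x hx => by
      rcases hor x hx with h | h
      · simp [hζ.t1.zd e x h]
      · simp [hφ.z x h])
  have i3 : Integrable (fun x => v x * (ζ x * φ x)) :=
    int_mul hΩ hv (hφ.cc.cmul' ha.continuous) hz
  simp only [mul_add] at h1
  rw [integral_add i1 i2] at h1
  have e1 : ∀ x, ζ x * u x * fderiv ℝ φ x e = u x * (ζ x * fderiv ℝ φ x e) := fun x => by ring
  have e2 : ∀ x, (ζ x * v x + fderiv ℝ ζ x e * u x) * φ x = v x * (ζ x * φ x) + u x * (fderiv ℝ ζ x e * φ x) :=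
    fun x => by ring
  simp only [e1, e2]
  rw [integral_add i3 i2]; linarith

lemma UB.cut (hV : MeasurableSet V) (hG : MeasurableSet G) (hΩ : MeasurableSet Ω) (hE : Ω ∩ V = G ∩ V) (hζ : IsTestFun V ζ) {m : ℕ} {ι : Type} {K : ι → ℝ≥0∞} {g : ι → Euc d → ℝ}
    (hg : UB p Ω m K g) : UB p G m K (fun x y => ζ y * g x y) := by
  have h0 : ∀ {g : ι → Euc d → ℝ} {ζ : Euc d → ℝ}, IsTestFun V ζ → UB p Ω 0 K g → UB p G 0 K (fun x y => ζ y * g x y) := by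
    rintro g ζ hζ ⟨C, hC⟩
    obtain ⟨M, hM⟩ := (hζ.cb 0).bd
    refine ⟨M.toNNReal * C, fun x => ⟨(cut_lp hV hG hΩ hE hζ hM (hC x).1).1, (cut_lp hV hG hΩ hE hζ hM (hC x).1).2.trans ?_⟩⟩
    push_cast
    rw [mul_assoc]
    exact mul_le_mul' le_rfl (hC x).2
  induction m generalizing g ζ with
  | zero => exact h0 hζ hg
  | succ m ih =>
    let b := EuclideanSpace.basisFun (Fin d) ℝ
    choose v hv1 hv2 using fun i => hg.exD (bnorm b i).le
    refine UB.of_basis hG b (h0 hζ (hg.le (Nat.zero_le _))) (fun i x => WD.cut hV hG hΩ hE hζ (hg.lp x) ((hv2 i).lp x) (hv1 i x)) (fun i => ?_)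
    exact (ih hζ (hv2 i)).add hG (ih (hζ.pd (b i)) hg.pred)

end EllReg13

noncomputable section EllReg14

variable {d : ℕ} {p : ℝ≥0∞} [hp : Fact (1 ≤ p)]

/-- `W^{2,p}` functions with zero boundary values -/
structure W2 (p : ℝ≥0∞) (U : Set (Euc d)) (b : OrthonormalBasis (Fin d) ℝ (Euc d)) (v : Euc d → ℝ)
    (vi : Fin d → Euc d → ℝ) (vij : Fin d → Fin d → Euc d → ℝ) : Prop where
  l0 : LpU p U v
  l1 : ∀ i, LpU p U (vi i)
  l2 : ∀ i j, LpU p U (vij i j)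
  d1 : ∀ i, WD U (b i) v (vi i)
  d2 : ∀ i j, WD U (b j) (vi i) (vij i j)
  bc : ∀ i, WD Set.univ (b i) (U.indicator v) (U.indicator (vi i))

variable {b : OrthonormalBasis (Fin d) ℝ (Euc d)} {i0 : Fin d} {u : Euc d → ℝ} {Ω V G : Set (Euc d)} {ζ γ : Euc d → ℝ}
    {ui : Fin d → Euc d → ℝ} {uij : Fin d → Fin d → Euc d → ℝ}

lemma W2.toH (h : W2 p (HS (b i0)) b u ui uij) : W2H p b i0 u ui uij := ⟨h.l0, h.l1, h.l2, h.d1, h.d2, h.bc i0⟩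

lemma W2.sym (hU : IsOpen Ω) (h : W2 p Ω b u ui uij) (i j : Fin d) :
    uij i j =ᵐ[volume.restrict Ω] uij j i :=
  WD.unique hU (h.l2 i j) (h.l2 j i) (h.d2 i j)
    (WD.symm2 hU (h.l1 i) (h.l2 j i) (h.d1 j) (h.d2 j i) (h.d1 i))

lemma indLp' (hU : MeasurableSet Ω) {u : Euc d → ℝ} (hu : LpU p Ω u) : LpU p Set.univ (Ω.indicator u) :=
  restrict_univ_memLp (ind_memLp hU hu)

lemma W2.cut (hV : MeasurableSet V) (hG : MeasurableSet G) (hΩ : MeasurableSet Ω) (hE : Ω ∩ V = G ∩ V) (hζ : IsTestFun V ζ)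
    (h : W2 p Ω b u ui uij) : W2 p G b (fun x => ζ x * u x) (fun i x => ζ x * ui i x + fderiv ℝ ζ x (b i) * u x)
      (fun i j x => (ζ x * uij i j x + fderiv ℝ ζ x (b j) * ui i x) +
        (fderiv ℝ ζ x (b i) * ui j x + fderiv ℝ (fun x => fderiv ℝ ζ x (b i)) x (b j) * u x)) := by
  have hc : ∀ {ζ}, IsTestFun V ζ → ∀ {u}, LpU p Ω u → LpU p G (fun x => ζ x * u x) := fun hζ u hu => by
    obtain ⟨M, hM⟩ := (hζ.cb 0).bd
    exact (cut_lp hV hG hΩ hE hζ hM hu).1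
  have hζ1 := fun i => hζ.pd (b i)
  have hζ2 := fun i j => (hζ1 i).pd (b j)
  have hi : ∀ {ζ}, IsTestFun V ζ → ∀ u : Euc d → ℝ, ∀ x, ζ x * Ω.indicator u x = G.indicator (fun x => ζ x * u x) x := fun {ζ} hζ u x => by
    by_cases hx : x ∈ V
    · by_cases hx' : x ∈ Ω
      · have : x ∈ G := (show x ∈ G ∩ V from hE ▸ ⟨hx', hx⟩).1
        simp [hx', this]
      · have : x ∉ G := fun h => hx' (show x ∈ Ω ∩ V from hE ▸ ⟨h, hx⟩).1
        simp [hx', this]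
    · by_cases hx' : x ∈ G <;> simp [hζ.z x hx, hx']
  refine ⟨hc hζ h.l0, fun i => (hc hζ (h.l1 i)).add (hc (hζ1 i) h.l0), fun i j => ?_, fun i => WD.cut hV hG hΩ hE hζ h.l0 (h.l1 i) (h.d1 i), fun i j => ?_, fun i => ?_⟩
  · exact ((hc hζ (h.l2 i j)).add (hc (hζ1 j) (h.l1 i))).add ((hc (hζ1 i) (h.l1 j)).add (hc (hζ2 i j) h.l0))
  · exact WD.add hG (hc hζ (h.l1 i)) ((hc hζ (h.l2 i j)).add (hc (hζ1 j) (h.l1 i))) (hc (hζ1 i) h.l0) ((hc (hζ1 i) (h.l1 j)).add (hc (hζ2 i j) h.l0))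
      (WD.cut hV hG hΩ hE hζ (h.l1 i) (h.l2 i j) (h.d2 i j)) (WD.cut hV hG hΩ hE (hζ1 i) h.l0 (h.l1 j) (h.d1 j))
  · have := WD.mulC MeasurableSet.univ (indLp' hΩ h.l0) (indLp' hΩ (h.l1 i)) hζ.t1.1 (h.bc i)
    convert this using 1
    · funext x; exact (hi hζ u x).symm
    · funext x; rw [hi hζ, hi (hζ1 i)]
      by_cases hx : x ∈ G <;> simp [hx]

lemma W2.sh (hG : MeasurableSet G) (hd : CB 2 γ) (hI : Iv γ (b i0)) (h : W2 p G b u ui uij) :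
    W2 p (sh γ (b i0) ⁻¹' G) b (fun y => u (sh γ (b i0) y)) (fun i y => ui i (sh γ (b i0) y) + fderiv ℝ γ y (b i) * ui i0 (sh γ (b i0) y))
      (fun i j y => (uij i j (sh γ (b i0) y) + fderiv ℝ γ y (b j) * uij i i0 (sh γ (b i0) y)) +
        (fderiv ℝ γ y (b i) * (uij i0 j (sh γ (b i0) y) + fderiv ℝ γ y (b j) * uij i0 i0 (sh γ (b i0) y)) +
          fderiv ℝ (fun y => fderiv ℝ γ y (b i)) y (b j) * ui i0 (sh γ (b i0) y))) := by
  have hd1 : ContDiff ℝ 1 γ := hd.1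
  have hd2 : ∀ e, ContDiff ℝ 1 (fun y => fderiv ℝ γ y e) := fun e => (hd.2.2 e).1
  have hc1 := fun e => (hd.2.2 e).le (Nat.zero_le 1)
  have hc2 := fun e e' => (hd.2.2 e).2.2 e'
  have hU' : MeasurableSet (_root_.sh γ (b i0) ⁻¹' G) := (sh_cd hd1).continuous.measurable hG
  have hl : ∀ {u}, LpU p G u → LpU p (_root_.sh γ (b i0) ⁻¹' G) (fun y => u (_root_.sh γ (b i0) y)) := fun hu => (sh_lp hd1 hI hG hu).1
  have hm : ∀ {a}, CB 0 a → ∀ {u}, LpU p (_root_.sh γ (b i0) ⁻¹' G) u → LpU p (_root_.sh γ (b i0) ⁻¹' G) (fun y => a y * u y) := fun {a} ha u hu => by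
    obtain ⟨M, hM⟩ := ha.bd
    exact (LpU.mulB hU' ha.cont hM hu).1
  have hD : ∀ i j, LpU p (_root_.sh γ (b i0) ⁻¹' G) (fun y => (uij i j (_root_.sh γ (b i0) y) + fderiv ℝ γ y (b j) * uij i i0 (_root_.sh γ (b i0) y))) := fun i j =>
    (hl (h.l2 i j)).add (hm (hc1 (b j)) (hl (h.l2 i i0)))
  have hE : ∀ i j, LpU p (_root_.sh γ (b i0) ⁻¹' G) (fun y => (fderiv ℝ γ y (b i) * (uij i0 j (_root_.sh γ (b i0) y) + fderiv ℝ γ y (b j) * uij i0 i0 (_root_.sh γ (b i0) y)) +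
          fderiv ℝ (fun y => fderiv ℝ γ y (b i)) y (b j) * ui i0 (_root_.sh γ (b i0) y))) := fun i j =>
    (hm (hc1 (b i)) (hD i0 j)).add (hm (hc2 _ _) (hl (h.l1 i0)))
  refine ⟨hl h.l0, fun i => (hl (h.l1 i)).add (hm (hc1 _) (hl (h.l1 i0))), fun i j => (hD i j).add (hE i j), fun i => ?_, fun i j => ?_, fun i => ?_⟩
  · exact WD.sh hG hd1 hd2 hI h.l0 (h.l1 i) (h.l1 i0) (h.d1 i) (h.d1 i0)
  · refine WD.add hU' (hl (h.l1 i)) (hD i j) (hm (hc1 _) (hl (h.l1 i0))) (hE i j) (WD.sh hG hd1 hd2 hI (h.l1 i) (h.l2 i j) (h.l2 i i0) (h.d2 i j) (h.d2 i i0)) ?_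
    exact WD.mulC hU' (hl (h.l1 i0)) (hD i0 j) (hd2 _) (WD.sh hG hd1 hd2 hI (h.l1 i0) (h.l2 i0 j) (h.l2 i0 i0) (h.d2 i0 j) (h.d2 i0 i0))
  · have := WD.sh MeasurableSet.univ hd1 hd2 hI (indLp' hG h.l0) (indLp' hG (h.l1 i)) (indLp' hG (h.l1 i0)) (h.bc i) (h.bc i0)
    convert this using 1
    all_goals
      funext y
      by_cases hy : _root_.sh γ (b i0) y ∈ G <;> simp [hy, Set.indicator]

/-- flattened coefficients -/
def aco (b : OrthonormalBasis (Fin d) ℝ (Euc d)) (i0 : Fin d) (γ : Euc d → ℝ) (i j : Fin d) (y : Euc d) : ℝ :=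
  if j = i0 then -2 * fderiv ℝ γ y (b i) + (if i = i0 then ∑ l, fderiv ℝ γ y (b l) * fderiv ℝ γ y (b l) else 0) else 0

/-- flattened lower order coefficients -/
def qco (b : OrthonormalBasis (Fin d) ℝ (Euc d)) (i0 : Fin d) (γ : Euc d → ℝ) (i : Fin d) (y : Euc d) : ℝ :=
  if i = i0 then - ∑ l, fderiv ℝ (fun y => fderiv ℝ γ y (b l)) y (b l) else 0

lemma aco_CB {m : ℕ} (h : CB (m + 1) γ) (i j : Fin d) : CB m (aco b i0 γ i j) := by
  unfold aco
  by_cases hj : j = i0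
  · by_cases hi : i = i0
    · simp only [hj, hi, if_true]
      exact ((h.2.2 _).smul _).add (CB.sum _ fun l _ => (h.2.2 _).mul (h.2.2 _))
    · simp only [hj, hi, if_true, if_false]
      exact ((h.2.2 _).smul _).add (CB.const _ _)
  · simp only [hj, if_false]; exact CB.const _ _

lemma qco_CB {m : ℕ} (h : CB (m + 2) γ) (i : Fin d) : CB m (qco b i0 γ i) := by
  unfold qco
  by_cases hi : i = i0
  · simp only [hi, if_true]
    exact (CB.sum _ fun l _ => (h.2.2 _).2.2 _).neg
  · simp only [hi, if_false]; exact CB.const _ _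

lemma W2.eqn (hG : IsOpen G) (hd : CB 2 γ) (hI : Iv γ (b i0)) (hH : _root_.sh γ (b i0) ⁻¹' G = HS (b i0)) (h : W2 p G b u ui uij) :
    Eqn b i0 (aco b i0 γ) (qco b i0 γ) (fun i y => ui i (_root_.sh γ (b i0) y) + fderiv ℝ γ y (b i) * ui i0 (_root_.sh γ (b i0) y))
      (fun i j y => (uij i j (_root_.sh γ (b i0) y) + fderiv ℝ γ y (b j) * uij i i0 (_root_.sh γ (b i0) y)) +
        (fderiv ℝ γ y (b i) * (uij i0 j (_root_.sh γ (b i0) y) + fderiv ℝ γ y (b j) * uij i0 i0 (_root_.sh γ (b i0) y)) +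
          fderiv ℝ (fun y => fderiv ℝ γ y (b i)) y (b j) * ui i0 (_root_.sh γ (b i0) y)))
      (fun y => ∑ j, uij j j (_root_.sh γ (b i0) y)) := by
  have hq := ((sh_mp hd.1 hI).restrict_preimage hG.measurableSet).quasiMeasurePreserving
  have hs : ∀ᵐ y ∂(volume.restrict (HS (b i0))), ∀ j, uij i0 j (_root_.sh γ (b i0) y) = uij j i0 (_root_.sh γ (b i0) y) := by
    rw [← hH, ae_all_iff]
    intro j
    exact hq.ae_eq_comp (h.sym hG i0 j)
  unfold Eqn
  filter_upwards [hs] with y hy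
  have hn : fderiv ℝ γ y (b i0) = 0 := hI.fdn (hd.1.differentiable (by norm_num)) y
  have hnn : ∀ i, fderiv ℝ (fun y => fderiv ℝ γ y (b i)) y (b i0) = 0 := fun i => (hI.fdi (b i)).fdn ((hd.2.2 _).1.differentiable (by norm_num)) y
  simp only [aco, qco, ite_mul, zero_mul, Finset.sum_ite_eq', Finset.mem_univ, if_true, add_mul, Finset.sum_add_distrib, hn, hnn, hy]
  simp only [zero_mul, add_zero, mul_zero, neg_mul, Finset.sum_neg_distrib, Finset.sum_mul, mul_add, Finset.sum_add_distrib]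
  have e1 : ∀ x, 2 * fderiv ℝ γ y (b x) * uij x i0 (_root_.sh γ (b i0) y) = fderiv ℝ γ y (b x) * uij x i0 (_root_.sh γ (b i0) y) + fderiv ℝ γ y (b x) * uij x i0 (_root_.sh γ (b i0) y) := fun x => by ring
  have e2 : ∀ x, 2 * fderiv ℝ γ y (b x) * (fderiv ℝ γ y (b x) * uij i0 i0 (_root_.sh γ (b i0) y)) = fderiv ℝ γ y (b x) * (fderiv ℝ γ y (b x) * uij i0 i0 (_root_.sh γ (b i0) y)) + fderiv ℝ γ y (b x) * (fderiv ℝ γ y (b x) * uij i0 i0 (_root_.sh γ (b i0) y)) := fun x => by ring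
  simp only [e1, e2, mul_assoc, Finset.sum_add_distrib]
  ring

/-- boundary charts -/
structure Cht (Ω : Set (Euc d)) (k : ℕ) (ε : ℝ) (V : Set (Euc d)) (b : OrthonormalBasis (Fin d) ℝ (Euc d)) (i0 : Fin d) (γ : Euc d → ℝ) : Prop where
  hV : IsOpen V
  bd : Bornology.IsBounded V
  cb : CB (k + 2) γ
  iv : Iv γ (b i0)
  sm : ∀ i j x, |aco b i0 γ i j x| ≤ ε
  hE : Ω ∩ V = {x | γ x < inner ℝ (b i0) x} ∩ V

variable {k : ℕ} {ε : ℝ}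

lemma Cht.open (h : Cht Ω k ε V b i0 γ) : IsOpen {x | γ x < inner ℝ (b i0) x} :=
  isOpen_lt h.cb.cont (by fun_prop)

lemma Cht.pre (h : Cht Ω k ε V b i0 γ) : sh γ (b i0) ⁻¹' {x | γ x < inner ℝ (b i0) x} = HS (b i0) := by
  ext y
  simp only [Set.mem_preimage, Set.mem_setOf_eq, HS, h.iv.sh y]
  unfold sh
  rw [inner_add_right, inner_smul_right, real_inner_self_eq_norm_sq, bnorm]
  constructor <;> intro h <;> linarith

lemma Cht.pre' (h : Cht Ω k ε V b i0 γ) : sh (fun y => - γ y) (b i0) ⁻¹' (HS (b i0)) = {x | γ x < inner ℝ (b i0) x} := by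
  rw [← h.pre, ← Set.preimage_comp]
  ext x; simp [sh_sh' h.iv]

lemma Cht.push (h : Cht Ω k ε V b i0 γ) (hΩ : IsOpen Ω) (hζ : IsTestFun V ζ) {m : ℕ} (hm : m ≤ k + 2) {ι : Type} {K : ι → ℝ≥0∞} {g : ι → Euc d → ℝ}
    (hg : UB p Ω m K g) : UB p (HS (b i0)) m K (fun x y => ζ (sh γ (b i0) y) * g x (sh γ (b i0) y)) := by
  have h1 := hg.cut h.hV.measurableSet h.open.measurableSet hΩ.measurableSet h.hE hζ
  have h2 := h1.sh h.open.measurableSet (h.cb.le (by omega)) h.iv (bnorm b i0) (h.cb.le hm)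
  rw [h.pre] at h2
  exact h2

lemma test_cut (hV : IsOpen V) (hb : Bornology.IsBounded V) (hζ : IsTestFun V ζ) : ∃ χ, IsTestFun V χ ∧ ∀ x, χ x * ζ x = ζ x := by
  obtain ⟨f, hf⟩ := SmoothPartitionOfUnity.exists_isSubordinate (modelWithCornersSelf ℝ (Euc d)) (isClosed_tsupport ζ) (fun _ : Unit => V) (fun _ => hV) (fun x hx => Set.mem_iUnion.2 ⟨(), hζ.2.2 hx⟩)
  refine ⟨f (), ⟨(f ()).contMDiff.contDiff, ?_, hf ()⟩, fun x => ?_⟩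
  · exact Metric.isCompact_of_isClosed_isBounded (isClosed_tsupport _) (hb.subset (hf ()))
  · by_cases hx : x ∈ tsupport ζ
    · have := f.sum_eq_one hx
      rw [finsum_eq_sum_of_fintype] at this
      simp at this
      rw [this, one_mul]
    · rw [image_eq_zero_of_notMem_tsupport hx, mul_zero]

lemma Cht.pull (h : Cht Ω k ε V b i0 γ) (hΩ : IsOpen Ω) (hζ : IsTestFun V ζ) {m : ℕ} (hm : m ≤ k + 2) {ι : Type} {K : ι → ℝ≥0∞} {g : ι → Euc d → ℝ}
    (hg : UB p (HS (b i0)) m K (fun x y => ζ (sh γ (b i0) y) * g x (sh γ (b i0) y))) : UB p Ω m K (fun x y => ζ y * g x y) := by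
  obtain ⟨χ, hχ, hχζ⟩ := test_cut h.hV h.bd hζ
  have h2 := hg.sh (HS_meas _) (h.cb.le (by omega)).neg h.iv.neg (bnorm b i0) (h.cb.le hm).neg
  rw [h.pre'] at h2
  simp only [sh_sh' h.iv] at h2
  have h3 := h2.cut h.hV.measurableSet hΩ.measurableSet h.open.measurableSet h.hE.symm hχ
  exact h3.congr' (fun x y => by rw [← mul_assoc, hχζ])

/-- the Laplacian of a product -/
def LF (b : OrthonormalBasis (Fin d) ℝ (Euc d)) (ζ f : Euc d → ℝ) (ui : Fin d → Euc d → ℝ) (u : Euc d → ℝ) (x : Euc d) : ℝ :=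
  ζ x * f x + ∑ i, (2 * (fderiv ℝ ζ x (b i) * ui i x) + fderiv ℝ (fun x => fderiv ℝ ζ x (b i)) x (b i) * u x)

lemma Cht.main (h : Cht Ω k ε V b i0 γ) (hΩ : IsOpen Ω) (hζ : IsTestFun V ζ) {f : Euc d → ℝ} (hu : W2 p Ω b u ui uij)
    (hf : f =ᵐ[volume.restrict Ω] fun x => ∑ j, uij j j x) : ∃ vi vij, W2H p b i0 (fun y => ζ (sh γ (b i0) y) * u (sh γ (b i0) y)) vi vij ∧
      Eqn b i0 (aco b i0 γ) (qco b i0 γ) vi vij (fun y => LF b ζ f ui u (sh γ (b i0) y)) := by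
  have h1 := hu.cut h.hV.measurableSet h.open.measurableSet hΩ.measurableSet h.hE hζ
  have hd : CB 2 γ := h.cb.le (by omega)
  have h2 := h1.sh h.open.measurableSet hd h.iv
  rw [h.pre] at h2
  refine ⟨_, _, h2.toH, ?_⟩
  have h3 := h1.eqn h.open hd h.iv h.pre
  refine EventuallyEq.trans ?_ h3
  have hq := ((sh_mp hd.1 h.iv).restrict_preimage h.open.measurableSet).quasiMeasurePreserving
  rw [h.pre] at hq
  have hG : ∀ᵐ x ∂(volume.restrict {x | γ x < inner ℝ (b i0) x}), LF b ζ f ui u x = ∑ j, ((ζ x * uij j j x + fderiv ℝ ζ x (b j) * ui j x) +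
        (fderiv ℝ ζ x (b j) * ui j x + fderiv ℝ (fun x => fderiv ℝ ζ x (b j)) x (b j) * u x)) := by
    rw [EventuallyEq, ae_restrict_iff' hΩ.measurableSet] at hf
    rw [ae_restrict_iff' h.open.measurableSet]
    filter_upwards [hf] with x hx hxG
    have : ζ x * f x = ζ x * ∑ j, uij j j x := by
      by_cases hV : x ∈ V
      · rw [hx (show x ∈ Ω ∩ V from h.hE ▸ ⟨hxG, hV⟩).1]
      · simp [hζ.z x hV]
    unfold LF
    rw [this, Finset.mul_sum, ← Finset.sum_add_distrib]
    exact Finset.sum_congr rfl fun j _ => by ring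
  exact hq.ae_eq_comp hG

end EllReg14

noncomputable section EllReg15

variable {d : ℕ} {p : ℝ≥0∞} [hp : Fact (1 ≤ p)]

/-- strong solutions with zero boundary values -/
structure Sol (p : ℝ≥0∞) (Ω : Set (Euc d)) (u f : Euc d → ℝ) : Prop where
  s2 : ∃ K, SB p Ω 2 K u
  bc : ∀ e, ∃ v, LpU p Ω v ∧ WD Set.univ e (Ω.indicator u) (Ω.indicator v)
  fl : LpU p Ω f
  eq : ∀ φ, IsTestFun Ω φ → ∫ x, u x * lap φ x = ∫ x, f x * φ x

variable {u f : Euc d → ℝ} {Ω V G : Set (Euc d)} {ζ γ : Euc d → ℝ} {b : OrthonormalBasis (Fin d) ℝ (Euc d)} {i0 : Fin d}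

lemma lap_basis (b : OrthonormalBasis (Fin d) ℝ (Euc d)) {φ : Euc d → ℝ} (hφ : ContDiff ℝ 2 φ) (x : Euc d) :
    lap φ x = ∑ j, fderiv ℝ (fun x => fderiv ℝ φ x (b j)) x (b j) := by
  have key : ∀ b : OrthonormalBasis (Fin d) ℝ (Euc d), ∑ j, fderiv ℝ (fun x => fderiv ℝ φ x (b j)) x (b j) = Laplacian.laplacian φ x := by
    intro b
    rw [InnerProductSpace.laplacian_eq_iteratedFDeriv_orthonormalBasis φ b]
    refine Finset.sum_congr rfl fun j _ => ?_
    rw [fderiv_fderiv_apply hφ, iteratedFDeriv_two_apply]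
    simp
  rw [key b, ← key (EuclideanSpace.basisFun (Fin d) ℝ)]
  simp only [lap, EuclideanSpace.basisFun_apply]
  rfl

lemma Sol.w2 (h : Sol p Ω u f) (hΩ : IsOpen Ω) (b : OrthonormalBasis (Fin d) ℝ (Euc d)) :
    ∃ ui uij, W2 p Ω b u ui uij ∧ f =ᵐ[volume.restrict Ω] fun x => ∑ j, uij j j x := by
  obtain ⟨K, hK⟩ := h.s2
  have hm := hΩ.measurableSet
  choose ui h1 h2 using fun i => h.bc (b i)
  have h3 : ∀ i, WD Ω (b i) u (ui i) := fun i =>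
    ((h2 i).mono (Set.subset_univ Ω)).congr hm (indicator_ae_eq_restrict hm) (indicator_ae_eq_restrict hm)
  have h4 : ∀ i, SB p Ω 1 K (ui i) := fun i => hK.deriv hΩ (bnorm b i).le (h1 i) (h3 i)
  choose uij h5 h6 using fun i j => (h4 i).2 (b j) (bnorm b j).le
  refine ⟨ui, uij, ⟨hK.lp, h1, fun i j => (h6 i j).lp, h3, h5, h2⟩, ?_⟩
  refine ae_eq_of_test hΩ h.fl (memLp_finsetSum _ fun j _ => (h6 j j).lp) (fun φ hφ => ?_)
  rw [← h.eq φ hφ]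
  have hφ2 : ContDiff ℝ 2 φ := contDiff_infty.1 hφ.1 2
  simp only [lap_basis b hφ2, Finset.mul_sum, Finset.sum_mul]
  rw [integral_finsetSum _ (fun j _ => int_mul hm hK.lp (((hφ.pd (b j)).pd (b j)).t1.cc) ((hφ.pd (b j)).pd (b j)).z),
    integral_finsetSum _ (fun j _ => int_mul hm (h6 j j).lp hφ.t1.cc hφ.z)]
  refine Finset.sum_congr rfl fun j _ => ?_
  rw [h3 j _ (hφ.pd (b j)).t1, h5 j j φ hφ.t1, neg_neg]

variable {ι : Type} {k : ℕ} {ε : ℝ} {K : ι → ℝ≥0∞}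

/-- the half-space regularity property -/
def RegP (p : ℝ≥0∞) (d : ℕ) (ε : ℝ) : Prop := ∀ (b : OrthonormalBasis (Fin d) ℝ (Euc d)) (i0 : Fin d) (k : ℕ) (a : Fin d → Fin d → Euc d → ℝ) (q : Fin d → Euc d → ℝ),
    (∀ i j, CB (k + 1) (a i j)) → (∀ i, CB k (q i)) → (∀ i j x, |a i j x| ≤ ε) →
    ∀ (ι : Type) (K : ι → ℝ≥0∞) (v : ι → Euc d → ℝ) (vi : ι → Fin d → Euc d → ℝ) (vij : ι → Fin d → Fin d → Euc d → ℝ) (F : ι → Euc d → ℝ),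
    (∀ x, W2H p b i0 (v x) (vi x) (vij x)) → (∀ x, Eqn b i0 a q (vi x) (vij x) (F x)) →
    UB p (HS (b i0)) (k + 1) K v → UB p (HS (b i0)) k K F → UB p (HS (b i0)) (k + 2) K v

lemma Cht.reg (hR : RegP p d ε) (h : Cht Ω k ε V b i0 γ) (hΩ : IsOpen Ω) (hζ : IsTestFun V ζ) {u f : ι → Euc d → ℝ}
    (hS : ∀ x, Sol p Ω (u x) (f x)) {j : ℕ} (hj : j ≤ k) (hu : UB p Ω (j + 1) K u) (hf : UB p Ω j K f) :
    UB p Ω (j + 2) K (fun x y => ζ y * u x y) := by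
  have hM := HS_meas (b i0)
  choose ui uij hw hff using fun x => (hS x).w2 hΩ b
  choose vi vij hv he using fun x => h.main hΩ hζ (hw x) (hff x)
  refine h.pull hΩ hζ (by omega) (hR b i0 j (aco b i0 γ) (qco b i0 γ) (fun i l => aco_CB (h.cb.le (by omega)) i l) (fun i => qco_CB (h.cb.le (by omega)) i)
    h.sm ι K _ vi vij _ hv he (h.push hΩ hζ (by omega) hu) ?_)
  refine (h.push hΩ hζ (by omega) hf).add hM (UB.sum hM _ fun i _ => UB.add hM (UB.mulCB hM (CB.const _ 2) ?_) ?_)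
  · exact h.push hΩ (hζ.pd (b i)) (by omega) (hu.deriv hΩ (bnorm b i).le (fun x => (hw x).l1 i) (fun x => (hw x).d1 i))
  · exact h.push hΩ ((hζ.pd (b i)).pd (b i)) (by omega) hu.pred

/-- interpolation weights -/
def KI (p : ℝ≥0∞) (Ω : Set (Euc d)) (K : ι → ℝ≥0∞) (u : ι → Euc d → ℝ) (z : ι × {t : ℝ // 0 < t ∧ t ≤ 1}) : ℝ≥0∞ :=
  ENNReal.ofReal z.2 * K z.1 + ENNReal.ofReal (1 / z.2) * eLpNorm (u z.1) p (volume.restrict Ω)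

lemma Cht.itp (hp2 : p ≠ ⊤) (h : Cht Ω k ε V b i0 γ) (hΩ : IsOpen Ω) (hζ : IsTestFun V ζ) {u f : ι → Euc d → ℝ}
    (hS : ∀ x, Sol p Ω (u x) (f x)) (hu : UB p Ω 2 K u) :
    UB p Ω 1 (KI p Ω K u) (fun z y => ζ y * u z.1 y) := by
  have hM := HS_meas (b i0)
  have hO := HS_open (b i0)
  choose ui uij hw hff using fun x => (hS x).w2 hΩ b
  choose vi vij hv he using fun x => h.main hΩ hζ (hw x) (hff x)
  refine h.pull hΩ hζ (by omega) ?_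
  have h0 : UB p Ω 0 (fun x => eLpNorm (u x) p (volume.restrict Ω)) u := ⟨1, fun x => ⟨hu.lp x, by simp⟩⟩
  obtain ⟨C0, hC0⟩ := (h.push hΩ hζ (by omega) h0).nm
  have h2 := h.push hΩ hζ (by omega) hu
  have h1 := fun i => h2.deriv hO (bnorm b i).le (fun x => (hv x).l1 i) (fun x => (hv x).d1 i)
  choose C2 hC2 using fun i => ((h1 i).deriv hO (bnorm b i).le (fun x => (hv x).l2 i i) (fun x => (hv x).d2 i i)).nm
  refine UB.of_basis hM b (gi := fun i z => vi z.1 i) ⟨C0, fun z => ⟨h2.lp z.1, (hC0 z.1).trans ?_⟩⟩ (fun i z => (hv z.1).d1 i) (fun i => ⟨4 * C0 + 2 * C2 i, fun z => ⟨(hv z.1).l1 i, ?_⟩⟩)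
  · gcongr
    unfold KI
    refine le_trans ?_ le_add_self
    have : (1 : ℝ≥0∞) ≤ ENNReal.ofReal (1 / z.2) := by
      rw [← ENNReal.ofReal_one]
      exact ENNReal.ofReal_le_ofReal (by rw [le_div_iff₀ z.2.2.1]; linarith [z.2.2.2])
    calc _ = 1 * eLpNorm (u z.1) p (volume.restrict Ω) := (one_mul _).symm
      _ ≤ _ := by gcongr
  · refine ((hv z.1).interp hp2 i z.2.2.1).trans ?_
    unfold KI
    set t := z.2.1
    have e1 : ENNReal.ofReal (2 / t) = 2 * ENNReal.ofReal (1 / t) := by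
      rw [show (2 : ℝ≥0∞) = ENNReal.ofReal 2 by simp, ← ENNReal.ofReal_mul (by norm_num)]
      congr 1; ring
    rw [e1]
    set A := ENNReal.ofReal (1 / t)
    set B := ENNReal.ofReal t
    set N := eLpNorm (u z.1) p (volume.restrict Ω)
    calc _ ≤ 2 * A * (2 * (C0 * N)) + B * (2 * (C2 i * K z.1)) := by
          gcongr
          · exact hC0 z.1
          · exact hC2 i z.1
      _ = (4 * C0) * (A * N) + (2 * C2 i) * (B * K z.1) := by
        rw [show (4 : ℝ≥0∞) = 2 * 2 by norm_num]; ring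
      _ ≤ (4 * C0 + 2 * C2 i) * (A * N) + (4 * C0 + 2 * C2 i) * (B * K z.1) := by
        gcongr
        · exact le_self_add
        · exact le_add_self
      _ = _ := by push_cast; ring

lemma atlas_fin (hΩb : Bornology.IsBounded Ω) (hA : ∀ x ∈ closure Ω, ∃ V b i0 γ, x ∈ V ∧ Cht Ω k ε V b i0 γ) :
    ∃ (T : Type) (_ : Fintype T) (ζ : T → Euc d → ℝ), (∀ t, ∃ V b i0 γ, IsTestFun V (ζ t) ∧ Cht Ω k ε V b i0 γ) ∧ ∀ x ∈ Ω, ∑ t, ζ t x = 1 := by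
  choose! V b i0 γ hx hc using hA
  have hcp : IsCompact (closure Ω) := Metric.isCompact_of_isClosed_isBounded isClosed_closure hΩb.closure
  obtain ⟨hs1, hs⟩ := hcp.elim_nhds_subcover' (fun x hx' => V x) (fun x hx' => (hc x hx').hV.mem_nhds (hx x hx'))
  obtain ⟨φ, hφ⟩ := SmoothPartitionOfUnity.exists_isSubordinate (modelWithCornersSelf ℝ (Euc d)) (isClosed_closure (s := Ω)) (fun t : {t // t ∈ hs1} => V t.1.1)
    (fun t => (hc _ t.1.2).hV) (fun x hx => by
      obtain ⟨t, ht, hxt⟩ := Set.mem_iUnion₂.1 (hs hx)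
      exact Set.mem_iUnion.2 ⟨⟨t, ht⟩, hxt⟩)
  refine ⟨{t // t ∈ hs1}, inferInstance, fun t => φ t, fun t => ⟨V t.1.1, b t.1.1, i0 t.1.1 t.1.2, γ t.1.1, ⟨(φ t).contMDiff.contDiff, ?_, hφ t⟩, hc _ t.1.2⟩, fun x hx => ?_⟩
  · exact Metric.isCompact_of_isClosed_isBounded (isClosed_tsupport _) ((hc _ t.1.2).bd.subset (hφ t))
  · have := φ.sum_eq_one (subset_closure hx)
    rwa [finsum_eq_sum_of_fintype] at this

theorem reg_dom (hp2 : p ≠ ⊤) (hR : RegP p d ε) (hΩ : IsOpen Ω) (hΩb : Bornology.IsBounded Ω)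
    (hA : ∀ x ∈ closure Ω, ∃ V b i0 γ, x ∈ V ∧ Cht Ω k ε V b i0 γ) {u f : ι → Euc d → ℝ}
    (hS : ∀ x, Sol p Ω (u x) (f x)) (hu : ∀ x, eLpNorm (u x) p (volume.restrict Ω) ≤ K x) (hf : UB p Ω k K f) : UB p Ω (k + 2) K u := by
  obtain ⟨T, _, ζ, hζ, hsum⟩ := atlas_fin hΩb hA
  have hm := hΩ.measurableSet
  have glue : ∀ {ι : Type} {K : ι → ℝ≥0∞} {u : ι → Euc d → ℝ} {m : ℕ}, (∀ t, UB p Ω m K (fun x y => ζ t y * u x y)) → UB p Ω m K u := by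
    intro ι K u m h
    refine (UB.sum hm Finset.univ fun t _ => h t).congr hm (fun x => ?_)
    rw [EventuallyEq, ae_restrict_iff' hm]
    refine ae_of_all _ fun y hy => ?_
    rw [← Finset.sum_mul, hsum y hy, one_mul]
  have step : ∀ {K : ι → ℝ≥0∞} {j : ℕ}, j ≤ k → UB p Ω (j + 1) K u → UB p Ω j K f → UB p Ω (j + 2) K u := fun hj h1 h2 =>
    glue fun t => by
      obtain ⟨V, b, i0, γ, h3, h4⟩ := hζ t
      exact h4.reg hR hΩ h3 hS hj h1 h2
  have hul : ∀ x, LpU p Ω (u x) := fun x => (hS x).s2.choose_spec.lp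
  -- first order bound
  have first : UB p Ω 1 K u := by
    let b := EuclideanSpace.basisFun (Fin d) ℝ
    choose ui uij hw hff using fun x => (hS x).w2 hΩ b
    let N : ι → ℝ≥0∞ := fun x => ∑ i, eLpNorm (ui x i) p (volume.restrict Ω)
    have hN : ∀ x, N x ≠ ⊤ := fun x => ENNReal.sum_ne_top.2 fun i _ => ((hw x).l1 i).eLpNorm_ne_top
    have hNi : ∀ i x, eLpNorm (ui x i) p (volume.restrict Ω) ≤ N x := fun i x =>
      Finset.single_le_sum (f := fun i => eLpNorm (ui x i) p (volume.restrict Ω)) (fun _ _ => zero_le) (Finset.mem_univ i)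
    have h1 : UB p Ω 1 (fun x => K x + N x) u := by
      refine UB.of_basis hm b (gi := fun i x => ui x i) ⟨1, fun x => ⟨hul x, ?_⟩⟩ (fun i x => (hw x).d1 i) (fun i => ⟨1, fun x => ⟨(hw x).l1 i, ?_⟩⟩)
      · rw [ENNReal.coe_one, one_mul]; exact (hu x).trans le_self_add
      · rw [ENNReal.coe_one, one_mul]; exact (hNi i x).trans le_add_self
    have h2 : UB p Ω 2 (fun x => K x + N x) u := step (Nat.zero_le k) h1
      ((hf.le (Nat.zero_le k)).monoK 1 (fun x => by rw [ENNReal.coe_one, one_mul]; exact le_self_add))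
    have h3 : UB p Ω 1 (KI p Ω (fun x => K x + N x) u) (fun z => u z.1) := glue fun t => by
      obtain ⟨V, b, i0, γ, h3, h4⟩ := hζ t
      exact h4.itp hp2 hΩ h3 hS h2
    choose C hC using fun i => (h3.deriv hΩ (bnorm b i).le (fun z => (hw z.1).l1 i) (fun z => (hw z.1).d1 i)).nm
    set D : ℝ≥0 := ∑ i, C i with hD
    have h4 : ∀ z, N z.1 ≤ D * KI p Ω (fun x => K x + N x) u z := fun z => by
      rw [hD]; push_cast; rw [Finset.sum_mul]
      exact Finset.sum_le_sum fun i _ => hC i z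
    let t : ℝ := 1 / (2 * (D + 1))
    have ht0 : 0 < t := by positivity
    have hD0 : (0:ℝ) ≤ D := D.2
    have ht1 : t ≤ 1 := by
      rw [div_le_one (by positivity)]; linarith
    have hDt : (D : ℝ≥0∞) * ENNReal.ofReal t ≤ 2⁻¹ := by
      rw [show (D : ℝ≥0∞) = ENNReal.ofReal D by simp, ← ENNReal.ofReal_mul hD0, show (2⁻¹ : ℝ≥0∞) = ENNReal.ofReal (1/2) by
        rw [one_div, ENNReal.ofReal_inv_of_pos (by norm_num)]; simp]
      refine ENNReal.ofReal_le_ofReal ?_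
      simp only [t]
      rw [mul_one_div, div_le_div_iff₀ (by positivity) (by norm_num)]; linarith
    have h5 : ∀ x, N x ≤ 2 * ((1 + D * (1 / t).toNNReal : ℝ≥0) * K x) := fun x => by
      refine absorb (hN x) ((h4 (x, ⟨t, ht0, ht1⟩)).trans ?_)
      unfold KI
      simp only
      rw [mul_add, ← mul_assoc, ← mul_assoc]
      calc _ ≤ 2⁻¹ * (K x + N x) + D * ENNReal.ofReal (1 / t) * K x := by gcongr; exact hu x
        _ ≤ 2⁻¹ * N x + (1 * K x + D * ENNReal.ofReal (1 / t) * K x) := by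
          rw [mul_add, add_comm (2⁻¹ * K x), add_assoc]
          gcongr
          exact ENNReal.inv_le_one.2 (by norm_num)
        _ = _ := by
          rw [← add_mul]; push_cast; rfl
    refine UB.of_basis hm b (gi := fun i x => ui x i) ⟨1, fun x => ⟨hul x, ?_⟩⟩ (fun i x => (hw x).d1 i) (fun i => ⟨2 * (1 + D * (1 / t).toNNReal), fun x => ⟨(hw x).l1 i, ?_⟩⟩)
    · rw [ENNReal.coe_one, one_mul]; exact hu x
    · refine ((hNi i x).trans (h5 x)).trans (le_of_eq ?_)
      push_cast; rw [mul_assoc]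
  have all : ∀ j, j ≤ k → UB p Ω (j + 2) K u := by
    intro j
    induction j with
    | zero => intro hj; exact step hj first (hf.le (Nat.zero_le k))
    | succ j ih => intro hj; exact step hj (ih (by omega)) (hf.le hj)
  exact all k le_rfl

end EllReg15

noncomputable section EllReg16

variable {d : ℕ} {p : ℝ≥0∞} [hp : Fact (1 ≤ p)]

lemma flat_cut {h : Euc d → ℝ} {m : ℕ} (hm : 1 ≤ m) (hh : ContDiffAt ℝ m h 0) (h0 : h 0 = 0) (h1 : fderiv ℝ h 0 = 0) {δ : ℝ} (hδ : 0 < δ) :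
    ∃ G : Euc d → ℝ, ContDiff ℝ m G ∧ HasCompactSupport G ∧ (∀ z, ‖fderiv ℝ G z‖ ≤ δ) ∧ G =ᶠ[𝓝 0] h := by
  let χ : ContDiffBump (0 : Euc d) := ⟨1, 2, by norm_num, by norm_num⟩
  have hχ : ContDiff ℝ (⊤ : ℕ∞) (χ : Euc d → ℝ) := χ.contDiff
  obtain ⟨M, hM⟩ := (χ.hasCompactSupport.fderiv (𝕜 := ℝ)).exists_bound_of_continuous (hχ.continuous_fderiv (by simp))
  have hM0 : 0 ≤ M := (norm_nonneg _).trans (hM 0)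
  set δ' := δ / (1 + 2 * M) with hδ'
  have hδ'0 : 0 < δ' := by positivity
  have e1 : ∀ᶠ z in 𝓝 (0 : Euc d), ContDiffAt ℝ m h z := hh.eventually (by simp)
  have e2 : ∀ᶠ z in 𝓝 (0 : Euc d), ‖fderiv ℝ h z‖ < δ' := by
    have hc : ContinuousAt (fderiv ℝ h) 0 := (hh.fderiv_right (m := 0) (by exact_mod_cast hm)).continuousAt
    refine (hc.norm).eventually_lt_const ?_
    beta_reduce; rw [h1, norm_zero]; exact hδ'0
  obtain ⟨R, hR0, hR⟩ := Metric.eventually_nhds_iff_ball.1 (e1.and e2)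
  have hmv : ∀ z ∈ Metric.ball (0 : Euc d) R, |h z| ≤ δ' * ‖z‖ := by
    intro z hz
    have := (convex_ball (0 : Euc d) R).norm_image_sub_le_of_norm_fderiv_le (𝕜 := ℝ) (f := h) (C := δ')
      (fun y hy => (hR y hy).1.differentiableAt (by exact_mod_cast (by omega : m ≠ 0))) (fun y hy => (hR y hy).2.le) (Metric.mem_ball_self hR0) hz
    simpa [h0] using this
  set r := R / 4 with hr
  have hr0 : 0 < r := by positivity
  let c : Euc d → ℝ := fun z => χ (r⁻¹ • z)
  have hc : ContDiff ℝ (⊤ : ℕ∞) c := hχ.comp (contDiff_const_smul _)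
  have hcz : ∀ z, 2 * r ≤ ‖z‖ → c z = 0 := by
    intro z hz
    refine χ.zero_of_le_dist ?_
    rw [dist_zero_right, norm_smul, norm_inv, Real.norm_of_nonneg hr0.le]
    change 2 ≤ _
    rw [inv_mul_eq_div, le_div_iff₀ hr0]; exact hz
  have hcd : ∀ z, ‖fderiv ℝ c z‖ ≤ M / r := by
    intro z
    have : HasFDerivAt c ((fderiv ℝ χ (r⁻¹ • z)).comp (r⁻¹ • ContinuousLinearMap.id ℝ (Euc d))) z :=
      ((hχ.differentiable (by simp)) _).hasFDerivAt.comp z ((hasFDerivAt_id z).const_smul r⁻¹)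
    rw [this.fderiv]
    refine (ContinuousLinearMap.opNorm_comp_le _ _).trans ?_
    rw [div_eq_mul_inv]
    refine mul_le_mul (hM _) ?_ (norm_nonneg _) hM0
    rw [norm_smul, norm_inv, Real.norm_of_nonneg hr0.le]
    exact mul_le_of_le_one_right (by positivity) ContinuousLinearMap.norm_id_le
  have hfar : ∀ z, 2 * r < ‖z‖ → (fun z => c z * h z) =ᶠ[𝓝 z] fun _ => 0 := by
    intro z hz
    filter_upwards [(isOpen_lt continuous_const continuous_norm).mem_nhds hz] with y hy
    rw [hcz y (le_of_lt hy), zero_mul]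
  refine ⟨fun z => c z * h z, ?_, ?_, ?_, ?_⟩
  · rw [contDiff_iff_contDiffAt]
    intro z
    by_cases hz : ‖z‖ < R
    · exact ((hc.of_le (by exact_mod_cast le_top)).contDiffAt).mul (hR z (by simpa using hz)).1
    · exact contDiffAt_const.congr_of_eventuallyEq (hfar z (by linarith))
  · refine HasCompactSupport.of_support_subset_isCompact (isCompact_closedBall 0 (2 * r)) (fun z hz => ?_)
    by_contra hn
    refine hz ?_
    change c z * h z = 0
    rw [hcz z (by simpa using (le_of_lt (not_le.1 (fun h => hn (by simpa using h))))), zero_mul]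
  · intro z
    by_cases hz : 2 * r < ‖z‖
    · rw [(hfar z hz).fderiv_eq]; simp [hδ.le]
    · have hz' := not_lt.1 hz
      have hzR : z ∈ Metric.ball (0 : Euc d) R := by simp; linarith
      rw [fderiv_fun_mul ((hc.differentiable (by simp)) z) ((hR z hzR).1.differentiableAt (by exact_mod_cast (by omega : m ≠ 0)))]
      refine (norm_add_le _ _).trans ?_
      rw [norm_smul, norm_smul]
      have a1 : ‖c z‖ ≤ 1 := by rw [Real.norm_of_nonneg χ.nonneg]; exact χ.le_one
      have a2 : ‖h z‖ ≤ δ' * (2 * r) := (hmv z hzR).trans (by gcongr)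
      calc _ ≤ 1 * δ' + δ' * (2 * r) * (M / r) := by
            gcongr
            · exact (hR z hzR).2.le
            · exact hcd z
        _ = δ' * (1 + 2 * M) := by field_simp
        _ = δ := by rw [hδ']; field_simp
  · filter_upwards [Metric.ball_mem_nhds (0 : Euc d) hr0] with z hz
    have : c z = 1 := χ.one_of_mem_closedBall (by
      rw [mem_closedBall_zero_iff, norm_smul, norm_inv, Real.norm_of_nonneg hr0.le, inv_mul_eq_div]
      change _ ≤ 1
      rw [div_le_one hr0]; exact (by simpa using hz : ‖z‖ < r).le)
    simp [this]

lemma aco_small (b : OrthonormalBasis (Fin d) ℝ (Euc d)) (i0 : Fin d) {γ : Euc d → ℝ} {ε δ : ℝ} (hδ1 : δ ≤ 1)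
    (hδε : (2 + d) * δ ≤ ε) (hδ0 : 0 ≤ δ) (h : ∀ y l, |fderiv ℝ γ y (b l)| ≤ δ) (i j : Fin d) (x : Euc d) : |aco b i0 γ i j x| ≤ ε := by
  have hs : |∑ l, fderiv ℝ γ x (b l) * fderiv ℝ γ x (b l)| ≤ d * δ := by
    refine (Finset.abs_sum_le_sum_abs _ _).trans ?_
    calc _ ≤ ∑ l : Fin d, δ := Finset.sum_le_sum fun l _ => by
          rw [abs_mul]
          calc _ ≤ δ * 1 := mul_le_mul (h x l) ((h x l).trans hδ1) (abs_nonneg _) hδ0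
            _ = δ := mul_one _
      _ = _ := by simp
  have h2 : |-2 * fderiv ℝ γ x (b i)| ≤ 2 * δ := by
    rw [abs_mul]; norm_num; exact h x i
  have hd : (0:ℝ) ≤ d * δ := by positivity
  unfold aco
  split_ifs
  · exact (abs_add_le _ _).trans (by linarith)
  · rw [add_zero]; linarith
  · rw [abs_zero]; linarith

/-- projection onto the orthogonal complement of a unit vector -/
def prj (n : Euc d) : Euc d →L[ℝ] Euc d := ContinuousLinearMap.id ℝ _ - (innerSL ℝ n).smulRight n

lemma prj_apply (n y : Euc d) : prj n y = y - inner ℝ n y • n := by simp [prj]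

lemma prj_n {n : Euc d} (hn : ‖n‖ = 1) : prj n n = 0 := by
  rw [prj_apply, real_inner_self_eq_norm_sq, hn]; simp

lemma prj_idem {n : Euc d} (hn : ‖n‖ = 1) (y : Euc d) : prj n (prj n y) = prj n y := by
  rw [prj_apply n y, map_sub, map_smul, prj_n hn, smul_zero, sub_zero, prj_apply]

lemma prj_norm {n : Euc d} (hn : ‖n‖ = 1) (y : Euc d) : ‖prj n y‖ ≤ 2 * ‖y‖ := by
  rw [prj_apply]
  refine (norm_sub_le _ _).trans ?_
  rw [norm_smul, hn, mul_one]
  have := norm_inner_le_norm (𝕜 := ℝ) n y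
  rw [hn] at this; linarith

lemma local_sign {ρ : Euc d → ℝ} {q n : Euc d} {B : Set (Euc d)} (hB : IsOpen B) (hBc : Convex ℝ B) (hd : ∀ y ∈ B, DifferentiableAt ℝ ρ y)
    (hneg : ∀ y ∈ B, fderiv ℝ ρ y n < 0) (hq : q ∈ B) (hq0 : ρ q = 0) {τ : ℝ} (ht : q + τ • n ∈ B) : ρ (q + τ • n) < 0 ↔ 0 < τ := by
  let D : Set ℝ := (fun t : ℝ => q + t • n) ⁻¹' B
  have hDo : IsOpen D := hB.preimage (by fun_prop)
  have hDc : Convex ℝ D := by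
    intro s hs t ht a b ha hb hab
    change q + (a • s + b • t) • n ∈ B
    convert hBc hs ht ha hb hab using 1
    simp only [smul_add, add_smul, smul_eq_mul, mul_smul]
    nth_rewrite 1 [show q = (a + b) • q by rw [hab, one_smul]]
    rw [add_smul]; abel
  have hder : ∀ t ∈ D, HasDerivAt (fun t : ℝ => ρ (q + t • n)) (fderiv ℝ ρ (q + t • n) n) t := by
    intro t ht
    have h1 : HasDerivAt (fun t : ℝ => q + t • n) n t := by
      simpa using ((hasDerivAt_id t).smul_const n).const_add q
    exact (hd _ ht).hasFDerivAt.comp_hasDerivAt t h1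
  have hsa : StrictAntiOn (fun t : ℝ => ρ (q + t • n)) D := by
    refine strictAntiOn_of_deriv_neg hDc (fun t ht => (hder t ht).continuousAt.continuousWithinAt) (fun t ht => ?_)
    rw [hDo.interior_eq] at ht
    rw [(hder t ht).deriv]; exact hneg _ ht
  have h0 : (0 : ℝ) ∈ D := by simpa [D] using hq
  have := hsa.lt_iff_gt ht h0
  simpa [hq0] using this

lemma exists_basis {n : Euc d} (hn : ‖n‖ = 1) : ∃ (b : OrthonormalBasis (Fin d) ℝ (Euc d)) (i0 : Fin d), b i0 = n := by
  have hd : 0 < d := by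
    rcases Nat.eq_zero_or_pos d with h | h
    · subst h; rw [Subsingleton.elim n 0, norm_zero] at hn; norm_num at hn
    · exact h
  let i0 : Fin d := ⟨0, hd⟩
  obtain ⟨b, hb⟩ := Orthonormal.exists_orthonormalBasis_extension_of_card_eq (𝕜 := ℝ) (E := Euc d) (ι := Fin d) (by simp) (v := fun _ => n) (s := {i0})
    (by
      constructor
      · intro i; simpa using hn
      · intro i j hij; exact absurd (Subsingleton.elim i j) hij)
  exact ⟨b, i0, hb i0 rfl⟩

/-- local graph description near a boundary point -/
lemma graph_exists {ρ : Euc d → ℝ} {m : ℕ} (hm : 1 ≤ m) {x n : Euc d} (hn : ‖n‖ = 1) {U : Set (Euc d)} (hU : IsOpen U) (hx : x ∈ U)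
    (hρ : ContDiffOn ℝ m ρ U) (h0 : ρ x = 0) {c : ℝ} (hc : 0 < c) (hL : ∀ v, fderiv ℝ ρ x v = - c * inner ℝ n v) :
    ∃ h : Euc d → ℝ, ContDiffAt ℝ m h 0 ∧ h 0 = 0 ∧ fderiv ℝ h 0 = 0 ∧ (∀ z, h (prj n z) = h z) ∧
      ∀ᶠ y in 𝓝 x, (ρ y < 0 ↔ h (y - x) < inner ℝ n (y - x)) := by
  have hm0 : (m : WithTop ℕ∞) ≠ 0 := by exact_mod_cast (by omega : m ≠ 0)
  have hρx : ContDiffAt ℝ m ρ x := hρ.contDiffAt (hU.mem_nhds hx)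
  have hnn : fderiv ℝ ρ x n = -c := by rw [hL, real_inner_self_eq_norm_sq, hn]; ring
  let F : Euc d × ℝ → ℝ := fun w => ρ (w.1 + w.2 • n)
  have hA : HasFDerivAt (fun w : Euc d × ℝ => w.1 + w.2 • n) (ContinuousLinearMap.fst ℝ (Euc d) ℝ + (ContinuousLinearMap.snd ℝ (Euc d) ℝ).smulRight n) (x, 0) :=
    ((ContinuousLinearMap.fst ℝ (Euc d) ℝ) + (ContinuousLinearMap.snd ℝ (Euc d) ℝ).smulRight n).hasFDerivAt
  have hxx : x + (0:ℝ) • n = x := by simp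
  have hFc : ContDiffAt ℝ m F (x, 0) := by
    refine ContDiffAt.comp (x, 0) (g := ρ) (f := fun w : Euc d × ℝ => w.1 + w.2 • n) ?_ (by fun_prop)
    simpa using hρx
  have hFd : HasFDerivAt F ((fderiv ℝ ρ x).comp (ContinuousLinearMap.fst ℝ (Euc d) ℝ + (ContinuousLinearMap.snd ℝ (Euc d) ℝ).smulRight n)) (x, 0) := by
    refine HasFDerivAt.comp (x, (0:ℝ)) (g := ρ) ?_ hA
    simpa using (hρx.differentiableAt hm0).hasFDerivAt
  have hinv : (fderiv ℝ F (x, 0) ∘L .inr ℝ (Euc d) ℝ).IsInvertible := by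
    refine ⟨ContinuousLinearEquiv.unitsEquivAut ℝ (Units.mk0 (-c) (by linarith)), ?_⟩
    ext
    rw [hFd.fderiv]
    simp [hnn]
  let g := hFc.implicitFunction hm0 hinv
  have hg0 : g x = 0 := hFc.implicitFunction_apply_self hm0 hinv
  have hgc : ContDiffAt ℝ m g x := hFc.contDiffAt_implicitFunction hm0 hinv
  have hge : ∀ᶠ y in 𝓝 x, ρ (y + g y • n) = 0 := by
    have := hFc.eventually_apply_implicitFunction hm0 hinv
    filter_upwards [this] with y hy
    have h2 : F (x, 0) = 0 := by simp [F, h0]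
    rw [h2] at hy; exact hy
  have hgd := (hgc.differentiableAt hm0).hasFDerivAt
  have hg' : ∀ v, fderiv ℝ g x (prj n v) = 0 := by
    intro v
    have h1 : HasFDerivAt (fun y => y + g y • n) (ContinuousLinearMap.id ℝ (Euc d) + (fderiv ℝ g x).smulRight n) x :=
      (hasFDerivAt_id x).add (hgd.smul_const n)
    have h2 : HasFDerivAt (fun y => ρ (y + g y • n)) ((fderiv ℝ ρ x).comp (ContinuousLinearMap.id ℝ (Euc d) + (fderiv ℝ g x).smulRight n)) x := by
      refine HasFDerivAt.comp x (g := ρ) ?_ h1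
      rw [hg0, hxx]; exact (hρx.differentiableAt hm0).hasFDerivAt
    have h3 : HasFDerivAt (fun y => ρ (y + g y • n)) (0 : Euc d →L[ℝ] ℝ) x :=
      (hasFDerivAt_const (0:ℝ) x).congr_of_eventuallyEq hge
    have h4 := congrArg (fun L => L (prj n v)) (h2.unique h3)
    simp only [ContinuousLinearMap.comp_apply, add_apply, ContinuousLinearMap.smulRight_apply, map_add, map_smul, hnn,
      ContinuousLinearMap.id_apply, zero_apply, smul_eq_mul] at h4
    have h5 : fderiv ℝ ρ x (prj n v) = 0 := by
      rw [prj_apply, map_sub, map_smul, hnn, hL]; simp; ring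
    rw [h5, zero_add] at h4
    rcases mul_eq_zero.1 h4 with h | h
    · exact h
    · linarith
  let h : Euc d → ℝ := fun z => g (x + prj n z)
  have hx0 : x + prj n 0 = x := by simp
  refine ⟨h, ?_, ?_, ?_, ?_, ?_⟩
  · refine ContDiffAt.comp (0 : Euc d) (g := g) (f := fun z => x + prj n z) (by rw [hx0]; exact hgc) (contDiffAt_const.add (prj n).contDiff.contDiffAt)
  · simp only [h, hx0, hg0]
  · have : HasFDerivAt h ((fderiv ℝ g x).comp (prj n)) 0 := by
      refine HasFDerivAt.comp (0 : Euc d) (g := g) (f := fun z => x + prj n z) (by rw [hx0]; exact hgd) ((prj n).hasFDerivAt.const_add x)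
    rw [this.fderiv]
    ext v; simpa using hg' v
  · intro z; simp only [h, prj_idem hn]
  · have e1 : ∀ᶠ y in 𝓝 x, y ∈ U := hU.mem_nhds hx
    have e2 : ∀ᶠ y in 𝓝 x, fderiv ℝ ρ y n < 0 := by
      have hcn : ContinuousAt (fun y => fderiv ℝ ρ y n) x :=
        ((hρx.fderiv_right (m := 0) (by exact_mod_cast hm)).continuousAt).clm_apply continuousAt_const
      exact hcn.eventually_lt_const (by beta_reduce; rw [hnn]; linarith)
    obtain ⟨R, hR0, hR⟩ := Metric.eventually_nhds_iff_ball.1 (e1.and e2)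
    have hPc : Tendsto (fun y => x + prj n (y - x)) (𝓝 x) (𝓝 x) := by
      have : Continuous (fun y => x + prj n (y - x)) := by fun_prop
      simpa using this.tendsto x
    have hgP : Tendsto (fun y => (x + prj n (y - x)) + g (x + prj n (y - x)) • n) (𝓝 x) (𝓝 x) := by
      have := hPc.add ((hgc.continuousAt.tendsto.comp hPc).smul_const n)
      rw [hg0, hxx] at this
      exact this
    filter_upwards [hgP.eventually (Metric.ball_mem_nhds x hR0), Metric.ball_mem_nhds x hR0, hPc.eventually hge] with y hq hy hz
    have hy' : ((x + prj n (y - x)) + g (x + prj n (y - x)) • n) + (inner ℝ n (y - x) - h (y - x)) • n = y := by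
      change ((x + prj n (y - x)) + h (y - x) • n) + (inner ℝ n (y - x) - h (y - x)) • n = y
      rw [sub_smul, prj_apply]; abel
    have := local_sign Metric.isOpen_ball (convex_ball x R) (fun w hw => (hρ.contDiffAt (hU.mem_nhds (hR w hw).1)).differentiableAt hm0)
      (fun w hw => (hR w hw).2) hq hz (τ := inner ℝ n (y - x) - h (y - x)) (by rw [hy']; exact hy)
    rw [hy'] at this
    rw [this, sub_pos]

variable {Ω : Set (Euc d)} {k : ℕ} {ε : ℝ}

lemma cht_bdry (hε : 0 < ε) {x n : Euc d} (hn : ‖n‖ = 1) {h : Euc d → ℝ} (h1 : ContDiffAt ℝ (k + 2 : ℕ) h 0) (h2 : h 0 = 0)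
    (h3 : fderiv ℝ h 0 = 0) (h4 : ∀ z, h (prj n z) = h z) (h5 : ∀ᶠ y in 𝓝 x, (y ∈ Ω ↔ h (y - x) < inner ℝ n (y - x))) :
    ∃ V b i0 γ, x ∈ V ∧ Cht Ω k ε V b i0 γ := by
  obtain ⟨b, i0, hb⟩ := exists_basis hn
  set δ := min 1 (ε / (2 + d)) with hδ
  have hδ0 : 0 < δ := lt_min one_pos (by positivity)
  obtain ⟨G, hG1, hG2, hG3, hG4⟩ := flat_cut (by omega) h1 h2 h3 (δ := δ / 2) (by positivity)
  let γ : Euc d → ℝ := fun y => inner ℝ n x + G (prj n y - prj n x)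
  have hev : ∀ᶠ y in 𝓝 x, (y ∈ Ω ↔ γ y < inner ℝ n y) := by
    have ht : Tendsto (fun y => prj n y - prj n x) (𝓝 x) (𝓝 0) := by
      have : Continuous (fun y => prj n y - prj n x) := by fun_prop
      simpa using this.tendsto x
    filter_upwards [h5, ht.eventually hG4] with y hy1 hy2
    rw [hy1]
    simp only [γ, hy2]
    rw [← map_sub, h4, inner_sub_right]
    constructor <;> intro h <;> linarith
  obtain ⟨R, hR0, hR⟩ := Metric.eventually_nhds_iff_ball.1 hev
  refine ⟨Metric.ball x R, b, i0, γ, Metric.mem_ball_self hR0, Metric.isOpen_ball, Metric.isBounded_ball, ?_, ?_, ?_, ?_⟩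
  · refine (CB.const _ _).add (CB.comp_lin (prj n) (g := fun z => G (z - prj n x)) (hG1.comp (contDiff_id.sub contDiff_const)) ?_)
    exact hG2.comp_homeomorph (Homeomorph.subRight (prj n x))
  · intro y t
    simp only [γ, hb, map_add, map_smul, prj_n hn, smul_zero, add_zero]
  · refine aco_small b i0 (δ := δ) (min_le_left _ _) ?_ hδ0.le (fun y l => ?_)
    · rw [mul_comm, ← le_div_iff₀ (by positivity)]; exact min_le_right _ _
    · have hd : HasFDerivAt γ ((fderiv ℝ G (prj n y - prj n x)).comp (prj n)) y := by
        refine HasFDerivAt.const_add _ ?_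
        exact HasFDerivAt.comp y (g := G) (f := fun y => prj n y - prj n x) ((hG1.differentiable (by simp)) _).hasFDerivAt ((prj n).hasFDerivAt.sub_const _)
      rw [hd.fderiv]
      have := ((fderiv ℝ G (prj n y - prj n x)).le_opNorm (prj n (b l))).trans (mul_le_mul (hG3 _) (prj_norm hn (b l)) (norm_nonneg _) (by positivity))
      rw [b.norm_eq_one] at this
      rw [ContinuousLinearMap.comp_apply, ← Real.norm_eq_abs]; linarith
  · ext y
    simp only [Set.mem_inter_iff, Set.mem_ofPred_eq, hb]
    constructor
    · rintro ⟨a, c⟩; exact ⟨(hR y c).1 a, c⟩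
    · rintro ⟨a, c⟩; exact ⟨(hR y c).2 a, c⟩

lemma cht_all (hd : 0 < d) (hε : 0 < ε) (hΩ : IsOpen Ω) (hk : HasCkBoundary Ω (k + 2 : ℕ)) (x : Euc d) (hx : x ∈ closure Ω) :
    ∃ V b i0 γ, x ∈ V ∧ Cht Ω k ε V b i0 γ := by
  by_cases hxΩ : x ∈ Ω
  · obtain ⟨R, hR0, hR⟩ := Metric.isOpen_iff.1 hΩ x hxΩ
    let b := EuclideanSpace.basisFun (Fin d) ℝ
    let i0 : Fin d := ⟨0, hd⟩
    refine ⟨Metric.ball x R, b, i0, fun _ => - (‖x‖ + R), Metric.mem_ball_self hR0, Metric.isOpen_ball, Metric.isBounded_ball, CB.const _ _, fun _ _ => rfl, ?_, ?_⟩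
    · exact aco_small b i0 (δ := 0) zero_le_one (by simpa using hε.le) le_rfl (fun y l => by simp)
    · ext y
      simp only [Set.mem_inter_iff, Set.mem_ofPred_eq]
      refine ⟨fun h => ⟨?_, h.2⟩, fun h => ⟨hR h.2, h.2⟩⟩
      have h1 := norm_inner_le_norm (𝕜 := ℝ) (b i0) y
      rw [b.norm_eq_one, one_mul] at h1
      have h2 : ‖y‖ < ‖x‖ + R := by
        have := h.2
        rw [Metric.mem_ball, dist_eq_norm] at this
        have h3 := norm_add_le (y - x) x
        rw [sub_add_cancel] at h3; linarith
      have h3 := (abs_le.1 h1).1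
      linarith
  · have hxf : x ∈ frontier Ω := ⟨hx, by rwa [hΩ.interior_eq]⟩
    obtain ⟨U, ρ, hU, hxU, hρ, hne, hO, hF⟩ := hk x hxf
    have h0 : ρ x = 0 := by
      have : x ∈ frontier Ω ∩ U := ⟨hxf, hxU⟩
      rw [hF] at this; exact this.2
    let a := (InnerProductSpace.toDual ℝ (Euc d)).symm (fderiv ℝ ρ x)
    have ha : ∀ v, fderiv ℝ ρ x v = inner ℝ a v := fun v => by simp [a]
    have ha0 : 0 < ‖a‖ := by
      rw [norm_pos_iff]; intro h
      refine hne x hxU ?_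
      ext v; rw [ha, h]; simp
    let n := -(‖a‖⁻¹ • a)
    have hn : ‖n‖ = 1 := by
      simp only [n]; rw [norm_neg, norm_smul, norm_inv, norm_norm, inv_mul_cancel₀ ha0.ne']
    obtain ⟨h, h1, h2, h3, h4, h5⟩ := graph_exists (by omega : 1 ≤ k + 2) hn hU hxU hρ h0 ha0 (fun v => by
      rw [ha]; simp only [n]; rw [inner_neg_left, real_inner_smul_left]; field_simp)
    refine cht_bdry hε hn h1 h2 h3 h4 ?_
    filter_upwards [h5, hU.mem_nhds hxU] with y hy hyU
    rw [← hy]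
    have := Set.ext_iff.1 hO y
    simp only [Set.mem_inter_iff, Set.mem_ofPred_eq] at this
    constructor
    · intro h; exact (this.1 ⟨h, hyU⟩).2
    · intro h; exact (this.2 ⟨hyU, h⟩).1

end EllReg16

noncomputable section EllReg17

variable {d : ℕ} {p : ℝ≥0∞} [hp : Fact (1 ≤ p)]

variable {Ω U : Set (Euc d)}

lemma IsTestFun.add {φ ψ : Euc d → ℝ} (h : IsTestFun Ω φ) (h' : IsTestFun Ω ψ) : IsTestFun Ω (fun x => φ x + ψ x) :=
  ⟨h.1.add h'.1, h.2.1.add h'.2.1, (tsupport_add φ ψ).trans (Set.union_subset h.2.2 h'.2.2)⟩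

lemma IsTestFun.zero (Ω : Set (Euc d)) : IsTestFun Ω (fun _ => 0) := by
  have : tsupport (fun _ : Euc d => (0:ℝ)) = ∅ := by rw [tsupport_eq_empty_iff]; rfl
  exact ⟨contDiff_const, HasCompactSupport.zero, by rw [this]; exact Set.empty_subset _⟩

lemma IsTestFun.cmul {φ : Euc d → ℝ} (c : ℝ) (h : IsTestFun Ω φ) : IsTestFun Ω (fun x => c * φ x) :=
  ⟨contDiff_const.mul h.1, h.2.1.mul_left, (tsupport_mul_subset_right (f := fun _ => c) (g := φ)).trans h.2.2⟩

lemma IsTestFun.sum {ι : Type*} (s : Finset ι) {φ : ι → Euc d → ℝ} (h : ∀ i, IsTestFun Ω (φ i)) : IsTestFun Ω (fun x => ∑ i ∈ s, φ i x) := by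
  classical
  induction s using Finset.induction_on with
  | empty => simpa using IsTestFun.zero Ω
  | insert a s ha ih => simp only [Finset.sum_insert ha]; exact (h a).add ih

lemma IsTestFun.pdi {φ : Euc d → ℝ} (h : IsTestFun Ω φ) (i : Fin d) : IsTestFun Ω (_root_.pd i φ) := h.pd _

lemma IsTestFun.lap {φ : Euc d → ℝ} (h : IsTestFun Ω φ) : IsTestFun Ω (_root_.lap φ) :=
  IsTestFun.sum Finset.univ fun i => (h.pdi i).pdi i

lemma IsTestFun.iter {m : ℕ} (a : Fin m → Fin d) {φ : Euc d → ℝ} (h : IsTestFun Ω φ) : IsTestFun Ω (iterPD a φ) := by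
  induction m generalizing φ with
  | zero => exact h
  | succ m ih => exact ih _ (h.pdi (a 0))

lemma IsTestFun.mono' {V : Set (Euc d)} (hV : U ⊆ V) {φ : Euc d → ℝ} (h : IsTestFun U φ) : IsTestFun V φ := ⟨h.1, h.2.1, h.2.2.trans hV⟩

lemma dich (hΩ : IsOpen Ω) {F G : Euc d → ℝ} (hF : LpU p Ω F)
    (h : ∀ φ, IsTestFun Ω φ → ∫ x in Ω, G x * φ x = ∫ x in Ω, F x * φ x) :
    F =ᵐ[volume.restrict Ω] (fun _ => 0) ∨ G =ᵐ[volume.restrict Ω] F := by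
  have hm := hΩ.measurableSet
  by_cases h0 : ∀ φ, IsTestFun Ω φ → ∫ x in Ω, F x * φ x = 0
  · left
    refine ae_eq_of_test hΩ hF MemLp.zero' (fun φ hφ => ?_)
    rw [← setInt_eq hm hφ.z, h0 φ hφ]; simp
  right
  push Not at h0
  obtain ⟨φ, hφ, hne⟩ := h0
  have hIF : ∀ ψ, IsTestFun Ω ψ → IntegrableOn (fun x => F x * ψ x) Ω := fun ψ hψ => int_mul' hm hF hψ.t1.cc
  have hI0 : ∀ ψ, IsTestFun Ω ψ → ∫ x in Ω, F x * ψ x ≠ 0 → IntegrableOn (fun x => G x * ψ x) Ω := by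
    intro ψ hψ hn
    rw [← h ψ hψ] at hn
    exact not_imp_comm.1 integral_undef hn
  have hI : ∀ ψ, IsTestFun Ω ψ → IntegrableOn (fun x => G x * ψ x) Ω := by
    intro ψ hψ
    by_cases hz : ∫ x in Ω, F x * ψ x = 0
    · have h1 : ∫ x in Ω, F x * (ψ x + φ x) ≠ 0 := by
        simp only [mul_add]
        rw [integral_add (hIF ψ hψ) (hIF φ hφ), hz, zero_add]; exact hne
      refine ((hI0 _ (hψ.add hφ) h1).sub (hI0 φ hφ hne)).congr (ae_of_all _ fun x => ?_)
      simp; ring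
    · exact hI0 ψ hψ hz
  have hl : LocallyIntegrableOn G Ω := by
    intro x hx
    obtain ⟨R, hR0, hR⟩ := Metric.isOpen_iff.1 hΩ x hx
    let χ : ContDiffBump x := ⟨R / 4, R / 2, by positivity, by linarith⟩
    have hχ : IsTestFun Ω χ := ⟨χ.contDiff, χ.hasCompactSupport, by
      rw [χ.tsupport_eq]
      exact (Metric.closedBall_subset_ball (by change R / 2 < R; linarith)).trans hR⟩
    refine ⟨Metric.ball x (R / 4) ∩ Ω, inter_mem (mem_nhdsWithin_of_mem_nhds (Metric.ball_mem_nhds x (by positivity))) self_mem_nhdsWithin, ?_⟩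
    refine ((hI χ hχ).mono_set Set.inter_subset_right).congr_fun (fun y hy => ?_) (Metric.isOpen_ball.measurableSet.inter hm)
    have : χ y = 1 := χ.one_of_mem_closedBall (Metric.ball_subset_closedBall hy.1)
    simp [this]
  have hlF : LocallyIntegrableOn F Ω := by
    have h1 := ((memLp_indicator_iff_restrict hm).2 hF).locallyIntegrable hp.out
    refine (h1.locallyIntegrableOn Ω).congr ?_
    rw [EventuallyEq, ae_restrict_iff' hm]
    exact ae_of_all _ fun x hx => by simp [hx]
  have := hΩ.ae_eq_zero_of_integral_contDiff_smul_eq_zero (hl.sub hlF) (fun g h1 h2 h3 => by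
    have hT : IsTestFun Ω g := ⟨h1, h2, h3⟩
    have e : ∀ x, g x • ((G - F) x) = (G x - F x) * g x := fun x => by simp [mul_comm]
    simp only [e]
    rw [← setInt_eq (u := fun x => G x - F x) hm hT.z]
    simp only [sub_mul]
    rw [integral_sub (hI g hT) (hIF g hT), h g hT, sub_self])
  rw [EventuallyEq, ae_restrict_iff' hm]
  filter_upwards [this] with x hx hxU
  have := hx hxU
  simp at this; linarith

lemma dich_norm (hΩ : IsOpen Ω) {F G : Euc d → ℝ} (hF : LpU p Ω F)
    (h : ∀ φ, IsTestFun Ω φ → ∫ x in Ω, G x * φ x = ∫ x in Ω, F x * φ x) :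
    eLpNorm F p (volume.restrict Ω) ≤ eLpNorm G p (volume.restrict Ω) := by
  rcases dich hΩ hF h with h | h
  · rw [eLpNorm_congr_ae h]; simp
  · rw [eLpNorm_congr_ae h]

lemma bnorm' (i : Fin d) : ‖(EuclideanSpace.single i 1 : Euc d)‖ = 1 := by simp

/-- families of weak derivatives give `SB` -/
lemma fam_SB (hΩ : IsOpen Ω) {k : ℕ} {u : Euc d → ℝ} {V : (m : ℕ) → (Fin m → Fin d) → Euc d → ℝ} (hV : ∀ m ≤ k, HasWeakDerivs Ω m u (V m))
    (hL : ∀ m ≤ k, ∀ a, LpU p Ω (V m a)) {K : ℝ≥0∞} (hK : ∀ m ≤ k, ∀ a, eLpNorm (V m a) p (volume.restrict Ω) ≤ K) (n : ℕ) :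
    ∀ m a, m + n ≤ k → SB p Ω n ((d + 1) ^ n * K) (V m a) := by
  have hm := hΩ.measurableSet
  induction n with
  | zero => intro m a hmk; exact ⟨hL m (by omega) a, by simpa using hK m (by omega) a⟩
  | succ n ih =>
    intro m a hmk
    rw [pow_succ', mul_assoc]
    refine SB.of_basis hm (EuclideanSpace.basisFun (Fin d) ℝ) (hL m (by omega) a) ?_ (fun i => ⟨V (m + 1) (Fin.cons i a), ?_, ih _ _ (by omega)⟩)
    · refine (hK m (by omega) a).trans ?_
      calc K = 1 * K := (one_mul K).symm
        _ ≤ _ := by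
          gcongr
          exact one_le_pow₀ (by simp)
    · rw [EuclideanSpace.basisFun_apply]
      refine WD.of_smooth hΩ (hL _ (by omega) _) (hL _ (by omega) _) (fun φ hφ => ?_)
      have h1 := hV (m + 1) (by omega) (Fin.cons i a) φ hφ
      have h2 := hV m (by omega) a (_root_.pd i φ) (hφ.pdi i)
      have h3 : iterPD (Fin.cons i a : Fin (m + 1) → Fin d) φ = iterPD a (_root_.pd i φ) := by simp [iterPD]
      rw [h3, h2, pow_succ] at h1
      rw [setInt_eq hm (hφ.pdi i).z, setInt_eq hm hφ.z] at h1
      have h4 : ((-1:ℝ)) ^ m ≠ 0 := pow_ne_zero _ (by norm_num)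
      refine mul_left_cancel₀ h4 ?_
      refine h1.trans ?_
      ring

lemma SB.fam {K : ℝ≥0∞} {u : Euc d → ℝ} (m : ℕ) : ∀ n, SB p U (m + n) K u → ∃ v : (Fin m → Fin d) → Euc d → ℝ,
    (∀ a φ, IsTestFun U φ → ∫ x, u x * iterPD a φ x = (-1) ^ m * ∫ x, v a x * φ x) ∧ ∀ a, SB p U n K (v a) := by
  induction m with
  | zero => intro n h; exact ⟨fun _ => u, fun a φ hφ => by simp [iterPD], fun a => by simpa using h⟩
  | succ m ih =>
    intro n h
    obtain ⟨v, h1, h2⟩ := ih (n + 1) (by rwa [show m + (n + 1) = m + 1 + n by omega])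
    choose w h3 h4 using fun (a : Fin (m + 1) → Fin d) => (h2 (fun i => a i.succ)).2 (EuclideanSpace.single (a 0) 1) (bnorm' _).le
    refine ⟨w, fun a φ hφ => ?_, h4⟩
    have := h1 (fun i => a i.succ) (_root_.pd (a 0) φ) (hφ.pdi _)
    refine this.trans ?_
    have h5 := h3 a φ hφ.t1
    change _ * ∫ x, v (fun i => a i.succ) x * fderiv ℝ φ x (EuclideanSpace.single (a 0) 1) = _
    rw [h5, pow_succ]; ring

lemma WD.test {φ : Euc d → ℝ} (h : IsTestFun U φ) (e : Euc d) : WD Set.univ e φ (fun x => fderiv ℝ φ x e) := by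
  intro ψ hψ
  have h1 := h.t1
  exact integral_mul_fderiv_eq_neg_fderiv_mul_of_integrable ((h1.ccd e).mul hψ.cc).integrable (h1.cc.mul (hψ.ccd e)).integrable
    (h1.cc.mul hψ.cc).integrable (fun x _ => h1.1.differentiable (by norm_num) x) (fun x _ => hψ.1.differentiable (by norm_num) x)

end EllReg17

noncomputable section EllReg18

variable {d : ℕ} {p : ℝ≥0∞} [hp : Fact (1 ≤ p)]

variable {Ω U : Set (Euc d)}

lemma bc_of (hΩ : IsOpen Ω) {u : Euc d → ℝ} (hu : LpU p Ω u) {v : Fin d → Euc d → ℝ} (hv : ∀ i, LpU p Ω (v i)) {φ : ℕ → Euc d → ℝ}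
    (hφ : ∀ n, IsTestFun Ω (φ n)) (hT : Tendsto (fun n => eLpNorm (fun x => u x - φ n x) p (volume.restrict Ω) +
        ∑ i : Fin d, eLpNorm (fun x => v i x - pd i (φ n) x) p (volume.restrict Ω)) atTop (𝓝 0)) (e : Euc d) :
    ∃ v, LpU p Ω v ∧ WD Set.univ e (Ω.indicator u) (Ω.indicator v) := by
  have hm := hΩ.measurableSet
  have conv : ∀ {w : Euc d → ℝ} {ψ : ℕ → Euc d → ℝ}, (∀ n, ∀ x ∉ Ω, ψ n x = 0) →
      Tendsto (fun n => eLpNorm (fun x => w x - ψ n x) p (volume.restrict Ω)) atTop (𝓝 0) →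
      Tendsto (fun n => eLpNorm (ψ n - Ω.indicator w) p (volume.restrict Set.univ)) atTop (𝓝 0) := by
    intro w ψ hz h
    refine h.congr fun n => ?_
    rw [← eLpNorm_indicator_eq_eLpNorm_restrict hm, Measure.restrict_univ, ← eLpNorm_neg]
    congr 1
    ext x
    by_cases hx : x ∈ Ω
    · simp [hx]
    · simp [hx, hz n x hx]
  have hi : ∀ i, WD Set.univ (EuclideanSpace.single i 1) (Ω.indicator u) (Ω.indicator (v i)) := by
    intro i
    refine WD.lim (p := p) MeasurableSet.univ (un := φ) (vn := fun n => pd i (φ n)) (fun n => ((hφ n).t1.cc.memLp p).restrict _) (indLp' hm hu)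
      (fun n => ((hφ n).pdi i).t1.cc.memLp p |>.restrict _) (indLp' hm (hv i)) ?_ ?_ (fun n => WD.test (hφ n) _)
    · refine conv (fun n => (hφ n).z) (tendsto_of_tendsto_of_tendsto_of_le_of_le tendsto_const_nhds hT (fun n => zero_le) (fun n => le_self_add))
    · refine conv (fun n => ((hφ n).pdi i).z) (tendsto_of_tendsto_of_tendsto_of_le_of_le tendsto_const_nhds hT (fun n => zero_le) (fun n => ?_))
      exact (Finset.single_le_sum (f := fun i => eLpNorm (fun x => v i x - pd i (φ n) x) p (volume.restrict Ω)) (fun _ _ => zero_le) (Finset.mem_univ i)).trans le_add_self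
  refine ⟨fun x => ∑ i, e i * v i x, memLp_finsetSum _ fun i _ => (hv i).const_mul _, ?_⟩
  have h1 := WD.dsum (p := p) MeasurableSet.univ Finset.univ (e := fun i => e i • (EuclideanSpace.single i 1 : Euc d)) (indLp' hm hu)
    (v := fun i x => e i * Ω.indicator (v i) x) (fun i => (indLp' hm (hv i)).const_mul _) (fun i => (hi i).dsmul (e i))
  have h2 : ∑ i, e i • (EuclideanSpace.single i 1 : Euc d) = e := by
    have := (EuclideanSpace.basisFun (Fin d) ℝ).sum_repr e
    simpa using this
  rw [h2] at h1
  refine h1.congr MeasurableSet.univ (ae_of_all _ fun _ => rfl) (ae_of_all _ fun x => ?_)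
  by_cases hx : x ∈ Ω <;> simp [hx]

lemma HasWeakDerivs.zeroth {u : Euc d → ℝ} {v : (Fin 0 → Fin d) → Euc d → ℝ} (h : HasWeakDerivs Ω 0 u v) (φ : Euc d → ℝ) (hφ : IsTestFun Ω φ) :
    ∫ x in Ω, u x * φ x = ∫ x in Ω, v Fin.elim0 x * φ x := by
  simpa [iterPD] using h Fin.elim0 φ hφ

lemma SB.hwd (hΩ : IsOpen Ω) (hU : IsOpen U) (hUΩ : U ⊆ Ω) {m : ℕ} {K : ℝ≥0∞} {u u' : Euc d → ℝ} (h : SB p U m K u')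
    (he : ∀ φ, IsTestFun Ω φ → ∫ x in Ω, u x * φ x = ∫ x in Ω, u' x * φ x) :
    ∃ v, HasWeakDerivs U m u v ∧ ∀ a, LpU p U (v a) ∧ eLpNorm (v a) p (volume.restrict U) ≤ K := by
  obtain ⟨v, h1, h2⟩ := SB.fam m 0 (by simpa using h)
  refine ⟨v, fun a φ hφ => ?_, fun a => ⟨(h2 a).lp, (h2 a).nm⟩⟩
  have hi := hφ.iter a
  have hi' := hi.mono' hUΩ
  rw [setInt_eq hU.measurableSet hi.z, setInt_eq hU.measurableSet hφ.z, ← h1 a φ hφ, ← setInt_eq hΩ.measurableSet hi'.z, he _ hi', setInt_eq hΩ.measurableSet hi'.z]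

lemma main_pos (hd : 0 < d) (k : ℕ) (Ω : Set (Euc d)) (hΩ : IsBoundedDomain Ω)
    (hΩk : HasCkBoundary Ω (k + 2 : ℕ)) (hp1 : 1 < p) (hp2 : p ≠ ⊤)
    (Ω' : Set (Euc d)) (hΩ' : IsOpen Ω') (hΩ'sub : Ω' ⊆ Ω) :
    ∃ C : ℝ, 0 < C ∧
      ∀ u f : Euc d → ℝ, MemW Ω p 2 u → MemW Ω p k f →
        IsWeakLap Ω u f → MemW10 Ω p u →
        MemW Ω' p (k + 2) u ∧
        ∃ v, HasWeakDerivs Ω' (k + 2) u v ∧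
          ∀ g : (m : ℕ) → (Fin m → Fin d) → Euc d → ℝ,
            (∀ m, m ≤ k → HasWeakDerivs Ω m f (g m)) →
            DkNorm Ω' p v ≤ ENNReal.ofReal C *
              (eLpNorm u p (volume.restrict Ω) +
                ∑ m ∈ Finset.range (k + 1), DkNorm Ω p (g m)) := by
  obtain ⟨hO, -, hB⟩ := hΩ
  have hm := hO.measurableSet
  obtain ⟨ε, hε0, -, hR⟩ := reg_H (p := p) d hp1 hp2
  let ι : Type := {w : (Euc d → ℝ) × (Euc d → ℝ) // MemW Ω p 2 w.1 ∧ MemW Ω p k w.2 ∧ IsWeakLap Ω w.1 w.2 ∧ MemW10 Ω p w.1}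
  have hu0 : ∀ w : ι, ∃ V : (m : ℕ) → (Fin m → Fin d) → Euc d → ℝ, ∀ m ≤ 2, HasWeakDerivs Ω m w.1.1 (V m) ∧ ∀ a, LpU p Ω (V m a) := by
    intro w
    have := w.2.1
    choose! V hV using this
    exact ⟨V, hV⟩
  have hf0 : ∀ w : ι, ∃ V : (m : ℕ) → (Fin m → Fin d) → Euc d → ℝ, ∀ m ≤ k, HasWeakDerivs Ω m w.1.2 (V m) ∧ ∀ a, LpU p Ω (V m a) := by
    intro w
    have := w.2.2.1
    choose! V hV using this
    exact ⟨V, hV⟩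
  choose Vu hVu using hu0
  choose Vf hVf using hf0
  let u : ι → Euc d → ℝ := fun w => Vu w 0 Fin.elim0
  let f : ι → Euc d → ℝ := fun w => Vf w 0 Fin.elim0
  have hul : ∀ w, LpU p Ω (u w) := fun w => (hVu w 0 (by omega)).2 _
  have hfl : ∀ w, LpU p Ω (f w) := fun w => (hVf w 0 (by omega)).2 _
  have hue : ∀ w φ, IsTestFun Ω φ → ∫ x in Ω, w.1.1 x * φ x = ∫ x in Ω, u w x * φ x := fun w φ hφ => (hVu w 0 (by omega)).1.zeroth φ hφ
  have hfe : ∀ w φ, IsTestFun Ω φ → ∫ x in Ω, w.1.2 x * φ x = ∫ x in Ω, f w x * φ x := fun w φ hφ => (hVf w 0 (by omega)).1.zeroth φ hφ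
  let K : ι → ℝ≥0∞ := fun w => eLpNorm (u w) p (volume.restrict Ω) + ∑ m ∈ Finset.range (k + 1), ∑ a, eLpNorm (Vf w m a) p (volume.restrict Ω)
  have hS : ∀ w, Sol p Ω (u w) (f w) := by
    intro w
    refine ⟨?_, ?_, hfl w, ?_⟩
    · refine ⟨_, fam_SB hO (k := 2) (fun m hm => (hVu w m hm).1) (fun m hm => (hVu w m hm).2) (K := ⊤) (fun m hm a => le_top) 2 0 Fin.elim0 (by omega)⟩
    · intro e
      obtain ⟨v, -, hv, φ, hφ, hT⟩ := w.2.2.2.2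
      rcases dich hO (hul w) (hue w) with h | h
      · refine ⟨fun _ => 0, MemLp.zero', ?_⟩
        refine (WD.zero Set.univ e).congr MeasurableSet.univ ?_ (ae_of_all _ fun x => by simp)
        rw [Measure.restrict_univ]
        rw [EventuallyEq, ae_restrict_iff' hm] at h
        filter_upwards [h] with x hx
        by_cases hxΩ : x ∈ Ω
        · simp [hxΩ, hx hxΩ]
        · simp [hxΩ]
      · refine bc_of hO (hul w) hv hφ (hT.congr fun n => ?_) e
        congr 1
        refine eLpNorm_congr_ae ?_
        filter_upwards [h] with x hx
        rw [hx]
    · intro φ hφ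
      have h1 := w.2.2.2.1 φ hφ
      rw [hue w _ hφ.lap, hfe w φ hφ, setInt_eq hm hφ.lap.z, setInt_eq hm hφ.z] at h1
      exact h1
  have hfB : UB p Ω k K f := by
    refine ⟨(d + 1) ^ k, fun w => ?_⟩
    have := fam_SB hO (k := k) (fun m hm => (hVf w m hm).1) (fun m hm => (hVf w m hm).2) (K := K w) (fun m hm a => ?_) k 0 Fin.elim0 (by omega)
    · push_cast; exact this
    · refine le_trans ?_ le_add_self
      refine le_trans ?_ (Finset.single_le_sum (f := fun m => ∑ a, eLpNorm (Vf w m a) p (volume.restrict Ω)) (fun _ _ => zero_le) (Finset.mem_range.2 (by omega : m < k + 1)))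
      exact Finset.single_le_sum (f := fun a => eLpNorm (Vf w m a) p (volume.restrict Ω)) (fun _ _ => zero_le) (Finset.mem_univ a)
  obtain ⟨C, hC⟩ := (reg_dom hp2 hR hO hB (cht_all hd hε0 hO hΩk) hS (fun w => le_self_add) hfB).restrict hΩ'sub
  let D : ℝ≥0 := ∑ m ∈ Finset.range (k + 1), (d : ℝ≥0) ^ m
  have hD1 : 1 ≤ D := by
    calc (1 : ℝ≥0) = (d : ℝ≥0) ^ 0 := by simp
      _ ≤ D := Finset.single_le_sum (f := fun m => (d : ℝ≥0) ^ m) (fun _ _ => zero_le) (by simp)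
  let A : ℝ≥0 := (d : ℝ≥0) ^ (k + 2) * C * D + 1
  refine ⟨A, by positivity, fun u0 f0 h1 h2 h3 h4 => ?_⟩
  let w : ι := ⟨(u0, f0), h1, h2, h3, h4⟩
  refine ⟨fun m hm => ?_, ?_⟩
  · obtain ⟨v, hv1, hv2⟩ := ((hC w).le hm).hwd hO hΩ' hΩ'sub (hue w)
    exact ⟨v, hv1, fun a => (hv2 a).1⟩
  · obtain ⟨v, hv1, hv2⟩ := (hC w).hwd hO hΩ' hΩ'sub (hue w)
    refine ⟨v, hv1, fun g hg => ?_⟩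
    set N := eLpNorm u0 p (volume.restrict Ω) + ∑ m ∈ Finset.range (k + 1), DkNorm Ω p (g m) with hN
    have hKN : K w ≤ D * N := by
      have e1 : eLpNorm (u w) p (volume.restrict Ω) ≤ eLpNorm u0 p (volume.restrict Ω) := dich_norm hO (hul w) (hue w)
      have e2 : ∀ m ∈ Finset.range (k + 1), ∑ a, eLpNorm (Vf w m a) p (volume.restrict Ω) ≤ D * DkNorm Ω p (g m) := by
        intro m hm
        have hmk : m ≤ k := by have := Finset.mem_range.1 hm; omega
        calc _ ≤ ∑ a : Fin m → Fin d, DkNorm Ω p (g m) := by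
              refine Finset.sum_le_sum fun a _ => ?_
              refine (dich_norm hO ((hVf w m hmk).2 a) (G := g m a) (fun φ hφ => ?_)).trans ?_
              · have a1 := hg m hmk a φ hφ
                have a2 := (hVf w m hmk).1 a φ hφ
                have h5 : ((-1:ℝ)) ^ m ≠ 0 := pow_ne_zero _ (by norm_num)
                exact mul_left_cancel₀ h5 (a1.symm.trans a2)
              · refine eLpNorm_mono_real fun x => ?_
                exact Finset.single_le_sum (f := fun a => |g m a x|) (fun _ _ => abs_nonneg _) (Finset.mem_univ a)
          _ = (d : ℝ≥0∞) ^ m * DkNorm Ω p (g m) := by simp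
          _ ≤ _ := by
              gcongr
              have : (d : ℝ≥0) ^ m ≤ D := Finset.single_le_sum (f := fun m => (d : ℝ≥0) ^ m) (fun _ _ => zero_le) hm
              exact_mod_cast ENNReal.coe_le_coe.2 this
      rw [hN, mul_add, Finset.mul_sum]
      refine add_le_add (e1.trans ?_) (Finset.sum_le_sum e2)
      calc _ = 1 * eLpNorm u0 p (volume.restrict Ω) := (one_mul _).symm
        _ ≤ _ := by gcongr; exact_mod_cast hD1
    calc DkNorm Ω' p v ≤ ∑ a : Fin (k + 2) → Fin d, eLpNorm (v a) p (volume.restrict Ω') := by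
          unfold DkNorm
          have : Dmag v = ∑ a, fun x => |v a x| := by ext x; simp [Dmag]
          rw [this]
          refine (eLpNorm_sum_le (fun a _ => (hv2 a).1.1.norm) hp.out).trans (Finset.sum_le_sum fun a _ => ?_)
          exact (eLpNorm_norm (v a)).le
      _ ≤ ∑ a : Fin (k + 2) → Fin d, C * (D * N) := Finset.sum_le_sum fun a _ => (hv2 a).2.trans (by gcongr)
      _ = (d : ℝ≥0∞) ^ (k + 2) * (C * (D * N)) := by simp
      _ = ((d : ℝ≥0) ^ (k + 2) * C * D : ℝ≥0) * N := by push_cast; ring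
      _ ≤ (A : ℝ≥0∞) * N := by
        gcongr
        exact le_self_add
      _ = _ := by simp

lemma main_zero (k : ℕ) (Ω : Set (Euc 0)) (p : ℝ≥0∞) (Ω' : Set (Euc 0)) (hne : Ω'.Nonempty) (hΩ'sub : Ω' ⊆ Ω) :
    ∃ C : ℝ, 0 < C ∧
      ∀ u f : Euc 0 → ℝ, MemW Ω p 2 u → MemW Ω p k f →
        IsWeakLap Ω u f → MemW10 Ω p u →
        MemW Ω' p (k + 2) u ∧
        ∃ v, HasWeakDerivs Ω' (k + 2) u v ∧
          ∀ g : (m : ℕ) → (Fin m → Fin 0) → Euc 0 → ℝ,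
            (∀ m, m ≤ k → HasWeakDerivs Ω m f (g m)) →
            DkNorm Ω' p v ≤ ENNReal.ofReal C *
              (eLpNorm u p (volume.restrict Ω) +
                ∑ m ∈ Finset.range (k + 1), DkNorm Ω p (g m)) := by
  have e1 : Ω' = Set.univ := Subsingleton.eq_univ_of_nonempty hne
  have e2 : Ω = Set.univ := Subsingleton.eq_univ_of_nonempty (hne.mono hΩ'sub)
  subst e1 e2
  refine ⟨1, one_pos, fun u f h1 h2 h3 h4 => ⟨fun m hm => ?_, fun _ _ => 0, fun a => (a 0).elim0, fun g hg => ?_⟩⟩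
  · cases m with
    | zero => exact h1 0 (by omega)
    | succ m => exact ⟨fun _ _ => 0, fun a => (a 0).elim0, fun a => (a 0).elim0⟩
  · have : Dmag (fun (_ : Fin (k + 2) → Fin 0) (_ : Euc 0) => (0:ℝ)) = fun _ => 0 := by ext x; simp [Dmag]
    unfold DkNorm
    rw [this]; simp

end EllReg18

/-- Higher elliptic regularity up to the boundary: on a bounded
domain with `C^{k+2}` boundary, if `u ∈ W^{2,p}(Ω)` solves `Δu = f` with
`f ∈ W^{k,p}(Ω)` and `u = 0` on `∂Ω`, then for every subdomain `Ω'` compactly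
contained in `Ω ∪ ∂Ω` (so `Ω'` may touch the boundary), `u ∈ W^{k+2,p}(Ω')` and
`‖D^{k+2}u‖_{L^p(Ω')} ≤ C(‖u‖_{L^p(Ω)} + ‖f‖_{W^{k,p}(Ω)})`. -/
theorem elliptic_up_to_boundary_higher_regularity
    (d k : ℕ) (Ω : Set (Euc d)) (hΩ : IsBoundedDomain Ω)
    (hΩk : HasCkBoundary Ω (k + 2 : ℕ)) (p : ℝ≥0∞) (hp1 : 1 < p) (hp2 : p ≠ ⊤)
    (Ω' : Set (Euc d)) (hΩ' : IsOpen Ω') (hΩ'c : IsConnected Ω') (hΩ'sub : Ω' ⊆ Ω)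
    (hsub : closure Ω' ⊆ Ω ∪ frontier Ω) (hcpt : IsCompact (closure Ω')) :
    ∃ C : ℝ, 0 < C ∧
      ∀ u f : Euc d → ℝ, MemW Ω p 2 u → MemW Ω p k f →
        IsWeakLap Ω u f → MemW10 Ω p u →
        MemW Ω' p (k + 2) u ∧
        ∃ v, HasWeakDerivs Ω' (k + 2) u v ∧
          ∀ g : (m : ℕ) → (Fin m → Fin d) → Euc d → ℝ,
            (∀ m, m ≤ k → HasWeakDerivs Ω m f (g m)) →
            DkNorm Ω' p v ≤ ENNReal.ofReal C *
              (eLpNorm u p (volume.restrict Ω) +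
                ∑ m ∈ Finset.range (k + 1), DkNorm Ω p (g m)) := by
  rcases Nat.eq_zero_or_pos d with h | h
  · subst h
    exact main_zero k Ω p Ω' hΩ'c.nonempty hΩ'sub
  · haveI : Fact (1 ≤ p) := ⟨hp1.le⟩
    exact main_pos h k Ω hΩ hΩk hp1 hp2 Ω' hΩ' hΩ'sub
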